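/- Proposition (topological mixing). For every f ∈ Bimod and every interval I ⊂ 𝕋¹ with nonempty interior, there exists an integer N ≥ 1 such that f^N(I) = 𝕋¹. In particular f is topologically mixing. -/

import Mathlib

open MeasureTheory Set Filter

noncomputable section

/-- Iterated fractional parts in the continued fraction algorithm:
`cfFrac ρ 0 = ρ - ⌊ρ⌋` and `cfFrac ρ (k+1) = 1/(cfFrac ρ k) - ⌊1/(cfFrac ρ k)⌋`. -/
noncomputable def cfFrac (ρ : ℝ) : ℕ → ℝ
  | 0 => Int.fract ρ
  | n + 1 => Int.fract (1 / cfFrac ρ n)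

/-- Partial quotients `a_k` of the continued fraction expansion of `ρ`. -/
noncomputable def cfA (ρ : ℝ) : ℕ → ℤ
  | 0 => ⌊ρ⌋
  | n + 1 => ⌊1 / cfFrac ρ n⌋

/-- Denominators `q_k` of the convergents of `ρ`:
`q_0 = 1`, `q_1 = a_1` (since `q_{-1} = 0`), `q_{k+1} = a_{k+1} q_k + q_{k-1}`. -/
noncomputable def cfQ (ρ : ℝ) : ℕ → ℕ
  | 0 => 1
  | 1 => (cfA ρ 1).toNat
  | n + 2 => (cfA ρ (n + 2)).toNat * cfQ ρ (n + 1) + cfQ ρ n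
/-- The class `Bimod` of degree one bimodal circle endomorphisms, given by the
circle map `f : 𝕋¹ → 𝕋¹` together with a lift `F : ℝ → ℝ` (`π ∘ F = f ∘ π`,
`F(x+1) = F(x)+1`), satisfying (A1) (`C²`, bimodal with non-flat critical points
`c̃⁺ < c̃⁻` of orders `ℓ⁺, ℓ⁻`), (A2) (the rotation numbers of the upper and lower
maps `F₊, F₋` are irrational) and (A3) (all periodic orbits are hyperbolic repelling). -/
structure BimodData where
  /-- the lift -/
  F : ℝ → ℝ
  /-- the circle endomorphism -/
  f : UnitAddCircle → UnitAddCircle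
  /-- lift of the critical point `c⁺` -/
  ctp : ℝ
  /-- lift of the critical point `c⁻` -/
  ctm : ℝ
  /-- `d̃⁺`, the second preimage of the critical value of `c⁺` -/
  dtp : ℝ
  /-- `d̃⁻`, the second preimage of the critical value of `c⁻` -/
  dtm : ℝ
  /-- the non-flatness order `ℓ⁺` -/
  lp : ℝ
  /-- the non-flatness order `ℓ⁻` -/
  lm : ℝ
  /-- the upper map `F₊` (a monotone degree one lift) -/
  Fp : CircleDeg1Lift
  /-- the lower map `F₋` (a monotone degree one lift) -/
  Fm : CircleDeg1Lift
  /-- the diffeomorphism `ψ⁺` -/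
  psip : ℝ → ℝ
  /-- the diffeomorphism `ψ⁻` -/
  psim : ℝ → ℝ
  hf : ∀ x : ℝ, f ((x : ℝ) : UnitAddCircle) = ((F x : ℝ) : UnitAddCircle)
  h0 : 0 < ctp
  h1 : ctp < ctm
  h2 : ctm < 1
  hlift : ∀ x, F (x + 1) = F x + 1
  hC2 : ContDiff ℝ 2 F
  hdecr : ∀ x ∈ Set.Ioo ctp ctm, deriv F x < 0
  hincr : ∀ x ∈ Set.Ioo ctm (ctp + 1), 0 < deriv F x
  hlp : 1 < lp
  hlm : 1 < lm
  hpsipC2 : ContDiff ℝ 2 psip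
  hpsipBij : Function.Bijective psip
  hpsipD : ∀ x, deriv psip x ≠ 0
  hpsip0 : psip ctp = 0
  hpsipEq : ∀ᶠ x in nhds ctp, F x = F ctp - |psip x| ^ lp
  hpsimC2 : ContDiff ℝ 2 psim
  hpsimBij : Function.Bijective psim
  hpsimD : ∀ x, deriv psim x ≠ 0
  hpsim0 : psim ctm = 0
  hpsimEq : ∀ᶠ x in nhds ctm, F x = F ctm + |psim x| ^ lm
  hdtp : dtp ∈ Set.Ioo ctm (ctp + 1)
  hdtpF : F dtp = F ctp
  hFp1 : ∀ x ∈ Set.Icc ctp dtp, Fp x = F ctp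
  hFp2 : ∀ x ∈ Set.Icc dtp (ctp + 1), Fp x = F x
  hdtm : dtm ∈ Set.Ioo (ctm - 1) ctp
  hdtmF : F dtm = F ctm
  hFm1 : ∀ x ∈ Set.Icc dtm ctm, Fm x = F ctm
  hFm2 : ∀ x ∈ Set.Icc ctm (dtm + 1), Fm x = F x
  hirrp : Irrational Fp.translationNumber
  hirrm : Irrational Fm.translationNumber
  hA3 : ∀ (x : ℝ) (n : ℕ), 1 ≤ n → (∃ m : ℤ, F^[n] x = x + (m : ℝ)) →
    1 < |deriv (F^[n]) x|

namespace BimodData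

/-- The critical point `c⁺ = π(c̃⁺)`. -/
noncomputable def cp (B : BimodData) : UnitAddCircle := ((B.ctp : ℝ) : UnitAddCircle)

/-- The critical point `c⁻ = π(c̃⁻)`. -/
noncomputable def cm (B : BimodData) : UnitAddCircle := ((B.ctm : ℝ) : UnitAddCircle)

/-- The interval `𝕀 = π([c̃⁺, c̃⁻])` on which `f` is decreasing. -/
def II (B : BimodData) : Set UnitAddCircle :=
  (fun x : ℝ => ((x : ℝ) : UnitAddCircle)) '' Set.Icc B.ctp B.ctm

/-- The upper rotation number `ρ⁺`. -/
noncomputable def rhop (B : BimodData) : ℝ := B.Fp.translationNumber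

/-- The lower rotation number `ρ⁻`. -/
noncomputable def rhom (B : BimodData) : ℝ := B.Fm.translationNumber

/-- Condition (C⁻): `Σ_{k≥0} q⁻_{2k+1} · d(f^{q⁻_{2k}}(c⁻), c⁻) < ∞`. -/
def CondCm (B : BimodData) : Prop :=
  Summable fun k : ℕ =>
    (cfQ B.rhom (2 * k + 1) : ℝ) * dist (B.f^[cfQ B.rhom (2 * k)] B.cm) B.cm

/-- Condition (C⁺): `Σ_{k≥1} q⁺_{2k} · d(f^{q⁺_{2k-1}}(c⁺), c⁺) < ∞`. -/
def CondCp (B : BimodData) : Prop :=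
  Summable fun k : ℕ =>
    (cfQ B.rhop (2 * k + 2) : ℝ) * dist (B.f^[cfQ B.rhop (2 * k + 1)] B.cp) B.cp

end BimodData

/-! ### Iterates of lifts -/

/-- `F` commutes with the unit translation. -/
def IsLift (F : ℝ → ℝ) : Prop := ∀ x, F (x + 1) = F x + 1

namespace IsLift
variable {F : ℝ → ℝ}

lemma add_nat (h : IsLift F) (x : ℝ) (m : ℕ) : F (x + m) = F x + m := by
  induction m with
  | zero => simp
  | succ k ih =>
    have := h (x + k)
    push_cast
    rw [← add_assoc, this, ih]; ring

lemma add_int (h : IsLift F) (x : ℝ) (m : ℤ) : F (x + m) = F x + m := by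
  obtain ⟨k, rfl | rfl⟩ := m.eq_nat_or_neg
  · simpa using h.add_nat x k
  · have := h.add_nat (x - k) k
    simp only [sub_add_cancel] at this
    push_cast
    rw [this, ← sub_eq_add_neg]; ring

lemma sub_int (h : IsLift F) (x : ℝ) (m : ℤ) : F (x - m) = F x - m := by
  have := h.add_int x (-m)
  push_cast at this
  simpa [sub_eq_add_neg] using this

lemma iterate (h : IsLift F) (n : ℕ) : IsLift (F^[n]) := by
  induction n with
  | zero => intro x; rfl
  | succ k ih => intro x; rw [Function.iterate_succ_apply', ih x, h, Function.iterate_succ_apply']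

lemma iter_add (h : IsLift F) (n : ℕ) (x : ℝ) (m : ℤ) : F^[n] (x + m) = F^[n] x + m :=
  (h.iterate n).add_int x m

lemma iter_sub (h : IsLift F) (n : ℕ) (x : ℝ) (m : ℤ) : F^[n] (x - m) = F^[n] x - m :=
  (h.iterate n).sub_int x m

end IsLift

/-! ### Absence of attracting returns -/

lemma MonotoneOn.Icc_of_Ioo {g : ℝ → ℝ} {u v : ℝ} (hg : ContinuousOn g (Icc u v))
    (hm : MonotoneOn g (Ioo u v)) : MonotoneOn g (Icc u v) := by
  intro x hx y hy hxy
  rcases hxy.eq_or_lt with rfl | hlt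
  · exact le_rfl
  have hl : ∀ t ∈ Ioo (0 : ℝ) (1 / 3), x + (y - x) * t ∈ Ioo u v ∧ y - (y - x) * t ∈ Ioo u v ∧
      x + (y - x) * t ≤ y - (y - x) * t := by
    intro t ht
    have h1 : 0 < (y - x) * t := mul_pos (by linarith) ht.1
    have h2 : (y - x) * t < (y - x) * (1 / 3) := mul_lt_mul_of_pos_left ht.2 (by linarith)
    obtain ⟨hx1, hx2⟩ := hx
    obtain ⟨hy1, hy2⟩ := hy
    refine ⟨⟨by linarith, by linarith⟩, ⟨by linarith, by linarith⟩, by linarith⟩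
  have key : ∀ w : ℝ → ℝ, Continuous w → w 0 ∈ Icc u v →
      (∀ t ∈ Ioo (0 : ℝ) (1 / 3), w t ∈ Ioo u v) →
      Tendsto (fun t => g (w t)) (nhdsWithin 0 (Ioo 0 (1 / 3))) (nhds (g (w 0))) := by
    intro w hw h0 hmem
    refine Tendsto.comp (hg (w 0) h0) (tendsto_nhdsWithin_iff.2 ⟨?_, ?_⟩)
    · exact (hw.tendsto 0).mono_left nhdsWithin_le_nhds
    · filter_upwards [self_mem_nhdsWithin] with t ht using Ioo_subset_Icc_self (hmem t ht)
  have hne : (nhdsWithin (0 : ℝ) (Ioo 0 (1 / 3))).NeBot := by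
    rw [← mem_closure_iff_nhdsWithin_neBot, closure_Ioo (by norm_num)]
    constructor <;> norm_num
  have k1 := key (fun t => x + (y - x) * t) (by fun_prop) (by simpa using hx)
    (fun t ht => (hl t ht).1)
  have k2 := key (fun t => y - (y - x) * t) (by fun_prop) (by simpa using hy)
    (fun t ht => (hl t ht).2.1)
  have := le_of_tendsto_of_tendsto k1 k2 (by
    filter_upwards [self_mem_nhdsWithin] with t ht
    exact hm (hl t ht).1 (hl t ht).2.1 (hl t ht).2.2)
  simpa using this

lemma exists_gt_of_one_lt_deriv {g : ℝ → ℝ} {p : ℝ} (hg : DifferentiableAt ℝ g p)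
    (hp : g p = p) (hd : 1 < deriv g p) :
    ∀ᶠ x in nhds p, (p < x → x < g x) ∧ (x < p → g x < x) := by
  have h := hg.hasDerivAt
  rw [hasDerivAt_iff_tendsto_slope] at h
  have h2 := h.eventually (lt_mem_nhds hd)
  rw [eventually_nhdsWithin_iff] at h2
  filter_upwards [h2] with x hx
  constructor
  · intro hlt
    have := hx (ne_of_gt hlt)
    rw [slope_def_field, hp, lt_div_iff₀ (by linarith)] at this
    linarith
  · intro hlt
    have := hx (ne_of_lt hlt)
    rw [slope_def_field, hp, lt_div_iff_of_neg (by linarith)] at this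
    linarith

lemma right_fixed_of_repelling {g : ℝ → ℝ} {u v : ℝ} (huv : u < v) (hd : Differentiable ℝ g)
    (hm : MonotoneOn g (Icc u v)) (hmap : MapsTo g (Icc u v) (Icc u v))
    (hrep : ∀ x ∈ Icc u v, g x = x → 1 < deriv g x) : g v = v := by
  set A := {x | x ∈ Icc u v ∧ x ≤ g x}
  have hu : u ∈ Icc u v := ⟨le_rfl, huv.le⟩
  have hA : u ∈ A := ⟨hu, (hmap hu).1⟩
  have hbd : BddAbove A := ⟨v, fun x hx => hx.1.2⟩
  set p := sSup A
  have hup : u ≤ p := le_csSup hbd hA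
  have hpv : p ≤ v := csSup_le ⟨u, hA⟩ fun x hx => hx.1.2
  have hp : p ∈ Icc u v := ⟨hup, hpv⟩
  have h1 : p ≤ g p := csSup_le ⟨u, hA⟩ fun x hx =>
    hx.2.trans (hm hx.1 hp (le_csSup hbd hx))
  have h2 : g p ≤ p := le_csSup hbd ⟨hmap hp, hm hp (hmap hp) h1⟩
  have hfix : g p = p := le_antisymm h2 h1
  rcases hpv.eq_or_lt with h | h
  · rw [← h]; exact hfix
  exfalso
  have hev := exists_gt_of_one_lt_deriv (hd p) hfix (hrep p hp hfix)
  have h3 : ∀ᶠ x in nhdsWithin p (Ioi p), x ∈ Ioo p v := Ioo_mem_nhdsGT h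
  obtain ⟨x, hx, hxm⟩ := ((hev.filter_mono nhdsWithin_le_nhds).and h3).exists
  have : x ≤ p := le_csSup hbd ⟨⟨hup.trans hxm.1.le, hxm.2.le⟩, (hx.1 hxm.1).le⟩
  exact absurd hxm.1 (not_lt.2 this)

lemma false_of_repelling {g : ℝ → ℝ} {u v : ℝ} (huv : u < v) (hd : Differentiable ℝ g)
    (hm : MonotoneOn g (Icc u v)) (hmap : MapsTo g (Icc u v) (Icc u v))
    (hrep : ∀ x ∈ Icc u v, g x = x → 1 < deriv g x) : False := by
  have hv := right_fixed_of_repelling huv hd hm hmap hrep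
  have hev := exists_gt_of_one_lt_deriv (hd v) hv (hrep v ⟨huv.le, le_rfl⟩ hv)
  have h3 : ∀ᶠ x in nhdsWithin v (Iio v), x ∈ Ioo u v := Ioo_mem_nhdsLT huv
  obtain ⟨x, hx, hxm⟩ := ((hev.filter_mono nhdsWithin_le_nhds).and h3).exists
  have hlt := hx.2 hxm.2
  have hsub : Icc u x ⊆ Icc u v := Icc_subset_Icc_right hxm.2.le
  have hxmem : x ∈ Icc u v := ⟨hxm.1.le, hxm.2.le⟩
  have := right_fixed_of_repelling hxm.1 hd (hm.mono hsub)
    (fun y hy => ⟨(hmap (hsub hy)).1, (hm (hsub hy) hxmem hy.2).trans hlt.le⟩)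
    (fun y hy => hrep y (hsub hy))
  linarith

/-- All periodic points (modulo integers) of `F` are hyperbolic repelling. -/
def PeriodicRepelling (F : ℝ → ℝ) : Prop :=
  ∀ (x : ℝ) (n : ℕ), 1 ≤ n → (∃ m : ℤ, F^[n] x = x + (m : ℝ)) → 1 < |deriv (F^[n]) x|

lemma PeriodicRepelling.not_mapsTo {F : ℝ → ℝ} (hrep : PeriodicRepelling F) (hF : IsLift F)
    (hd : Differentiable ℝ F) {u v : ℝ} (huv : u < v) {j : ℕ} (hj : 1 ≤ j) (a : ℤ)
    (hinj : InjOn F^[j] (Ioo u v)) :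
    ¬ MapsTo (fun x => F^[j] x - a) (Icc u v) (Icc u v) := by
  intro hmap
  have hdj : ∀ n : ℕ, Differentiable ℝ F^[n] := fun n => hd.iterate n
  set G : ℝ → ℝ := fun x => F^[j] x - a with hG
  have hGc : Continuous G := ((hdj j).continuous).sub continuous_const
  have hGinj : InjOn G (Ioo u v) := fun x hx y hy h => hinj hx hy (by simpa [hG] using h)
  have hGG : ∀ x, G (G x) = F^[j + j] x - ((2 * a : ℤ) : ℝ) := by
    intro x
    simp only [hG]
    rw [hF.iter_sub, Function.iterate_add_apply]; push_cast; ring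
  have hGGfun : (G ∘ G) = fun x => F^[j + j] x - ((2 * a : ℤ) : ℝ) := funext hGG
  have hmono : MonotoneOn (G ∘ G) (Icc u v) := by
    rcases ContinuousOn.strictMonoOn_of_injOn_Ioo huv hGc.continuousOn hGinj with h | h
    · have := MonotoneOn.Icc_of_Ioo hGc.continuousOn h.monotoneOn
      exact this.comp this hmap
    · have h' : AntitoneOn G (Icc u v) := by
        have := MonotoneOn.Icc_of_Ioo (g := fun x => - G x) (u := u) (v := v)
          hGc.neg.continuousOn (fun x hx y hy hxy => neg_le_neg (h.antitoneOn hx hy hxy))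
        intro x hx y hy hxy
        exact neg_le_neg_iff.1 (this hx hy hxy)
      exact h'.comp h' hmap
  refine false_of_repelling huv (g := G ∘ G) ?_ hmono (hmap.comp hmap) ?_
  · rw [hGGfun]; exact (hdj _).sub_const _
  · intro x hx hfix
    have h1 : F^[j + j] x = x + ((2 * a : ℤ) : ℝ) := by
      have := hGG x
      simp only [Function.comp] at hfix
      rw [hfix] at this; linarith
    have h2 := hrep x (j + j) (by omega) ⟨_, h1⟩
    have h3 : deriv (G ∘ G) x = deriv F^[j + j] x := by
      rw [hGGfun, deriv_sub_const]
    have h4 : 0 ≤ deriv (G ∘ G) x := by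
      have hdiff : DifferentiableAt ℝ (G ∘ G) x := by
        rw [hGGfun]; exact ((hdj _).sub_const _) x
      have hu : UniqueDiffWithinAt ℝ (Icc u v) x := (uniqueDiffOn_Icc huv) x hx
      rw [← hdiff.derivWithin hu]
      exact hmono.derivWithin_nonneg
    rw [h3] at h4 ⊢
    rwa [abs_of_nonneg h4] at h2

/-! ### Total length of arcs with bounded multiplicity -/

lemma sum_length_le_of_multiplicity {ι : Type*} (s : Finset ι) (l r : ι → ℝ) (k : ℕ)
    (hlr : ∀ i ∈ s, l i ≤ r i) (hr1 : ∀ i ∈ s, r i ≤ l i + 1)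
    (h : ∀ x : ℝ, ∀ t ⊆ s, (∀ i ∈ t, ∃ b : ℤ, x + b ∈ Icc (l i) (r i)) → t.card ≤ k) :
    ∑ i ∈ s, (r i - l i) ≤ k := by
  classical
  set S : ι → Set UnitAddCircle := fun i => (fun x : ℝ => (x : UnitAddCircle)) '' Icc (l i) (r i)
  have hSm : ∀ i, MeasurableSet (S i) := fun i =>
    (isCompact_Icc.image (AddCircle.continuous_mk' 1)).isClosed.measurableSet
  have hvol : ∀ i ∈ s, ENNReal.ofReal (r i - l i) ≤ volume (S i) := by
    intro i hi
    have hmp := UnitAddCircle.measurePreserving_mk (l i)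
    rw [← hmp.measure_preimage (hSm i).nullMeasurableSet, ← Real.volume_Ioc,
      Measure.restrict_apply (hmp.measurable (hSm i))]
    refine measure_mono fun x hx => ⟨⟨x, ⟨hx.1.le, hx.2⟩, rfl⟩, hx.1, hx.2.trans (hr1 i hi)⟩
  have hpt : ∀ y : UnitAddCircle, ∑ i ∈ s, (S i).indicator (fun _ => (1 : ENNReal)) y ≤ k := by
    intro y
    obtain ⟨x, rfl⟩ := QuotientAddGroup.mk_surjective y
    have h1 : ∑ i ∈ s, (S i).indicator (fun _ => (1 : ENNReal)) (x : UnitAddCircle) =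
        ((s.filter fun i => (x : UnitAddCircle) ∈ S i).card : ENNReal) := by
      rw [Finset.card_filter, Nat.cast_sum]
      refine Finset.sum_congr rfl fun i _ => ?_
      by_cases hx : (x : UnitAddCircle) ∈ S i <;> simp [hx]
    refine h1.le.trans ?_
    have h2 := h x (s.filter fun i => (x : UnitAddCircle) ∈ S i) (Finset.filter_subset _ _) (by
      intro i hi
      obtain ⟨z, hz, hzx⟩ := (Finset.mem_filter.1 hi).2
      obtain ⟨b, hb⟩ : -x + z ∈ AddSubgroup.zmultiples (1 : ℝ) := QuotientAddGroup.eq.1 hzx.symm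
      refine ⟨b, ?_⟩
      have : x + b = z := by
        simp at hb; linarith
      rwa [this])
    exact_mod_cast h2
  have hle : ∑ i ∈ s, volume (S i) ≤ k := by
    calc ∑ i ∈ s, volume (S i) = ∑ i ∈ s, ∫⁻ y, (S i).indicator (fun _ => (1 : ENNReal)) y := by
          refine Finset.sum_congr rfl fun i _ => ?_
          rw [lintegral_indicator (hSm i)]; simp
      _ = ∫⁻ y, ∑ i ∈ s, (S i).indicator (fun _ => (1 : ENNReal)) y := by
          rw [lintegral_finsetSum]
          exact fun i _ => measurable_const.indicator (hSm i)
      _ ≤ ∫⁻ _ : UnitAddCircle, (k : ENNReal) := lintegral_mono hpt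
      _ = k := by simp
  have h3 : ENNReal.ofReal (∑ i ∈ s, (r i - l i)) ≤ k := by
    rw [ENNReal.ofReal_sum_of_nonneg fun i hi => sub_nonneg.2 (hlr i hi)]
    exact (Finset.sum_le_sum hvol).trans hle
  have h4 := ENNReal.ofReal_le_iff_le_toReal (by simp) |>.1 h3
  simpa using h4

/-! ### Cross ratios -/

/-- The cross ratio of three consecutive segments of lengths `l`, `m`, `r`. -/
def crossX (l m r : ℝ) : ℝ := m * (l + m + r) / (l * r)

lemma crossX_comm (l m r : ℝ) : crossX l m r = crossX r m l := by
  unfold crossX; ring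

lemma mul_sinh_le_mul_sinh {l t : ℝ} (hl : 0 ≤ l) (hlt : l ≤ t) :
    t * Real.sinh l ≤ l * Real.sinh t := by
  rcases hl.eq_or_lt with rfl | hl
  · simp
  have ht : 0 < t := hl.trans_le hlt
  have hconv : ConvexOn ℝ (Ici 0) Real.sinh := by
    refine convexOn_of_deriv2_nonneg (convex_Ici 0) Real.continuous_sinh.continuousOn
      Real.differentiable_sinh.differentiableOn ?_ ?_
    · rw [Real.deriv_sinh]; exact Real.differentiable_cosh.differentiableOn
    · intro x hx
      rw [interior_Ici] at hx
      simp only [Function.iterate_succ, Function.iterate_zero, Function.comp, id,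
        Real.deriv_sinh, Real.deriv_cosh]
      exact Real.sinh_nonneg_iff.2 (le_of_lt hx)
  have := hconv.2 (mem_Ici.2 ht.le) (mem_Ici.2 le_rfl)
    (show 0 ≤ l / t by positivity)
    (show 0 ≤ 1 - l / t by rw [sub_nonneg, div_le_one ht]; exact hlt) (by ring)
  simp only [smul_eq_mul, mul_zero, add_zero, Real.sinh_zero] at this
  rw [div_mul_cancel₀ _ ht.ne'] at this
  have h2 : l / t * Real.sinh t = l * Real.sinh t / t := by ring
  rw [h2, le_div_iff₀ ht] at this
  linarith

/-- The cross ratio is expanded by primitives of exponentials. -/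
lemma crossX_le_of_exp {E : ℝ → ℝ} {A β : ℝ} (hE : ∀ x, HasDerivAt E (Real.exp (A + β * x)) x)
    {a b c d : ℝ} (hab : a < b) (hbc : b < c) (hcd : c < d) :
    crossX (b - a) (c - b) (d - c) ≤ crossX (E b - E a) (E c - E b) (E d - E c) := by
  have hmono : StrictMono E := strictMono_of_deriv_pos fun x => by
    rw [(hE x).deriv]; exact Real.exp_pos _
  have h1 := hmono hab
  have h2 := hmono hbc
  have h3 := hmono hcd
  have aux : ∀ L M R : ℝ, 0 < L → 0 < R → crossX L M R = ((L + M) / L) * ((M + R) / R) - 1 := by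
    intro L M R hL hR
    unfold crossX
    field_simp; ring
  rw [aux _ _ _ (by linarith) (by linarith), aux _ _ _ (by linarith) (by linarith)]
  have e1 : E b - E a + (E c - E b) = E c - E a := by ring
  have e2 : E c - E b + (E d - E c) = E d - E b := by ring
  have e3 : b - a + (c - b) = c - a := by ring
  have e4 : c - b + (d - c) = d - b := by ring
  rw [e1, e2, e3, e4]
  rcases eq_or_ne β 0 with rfl | hβ
  · have hlin : ∀ x y, E y - E x = Real.exp A * (y - x) := by
      intro x y
      have hc : ∀ z, HasDerivAt (fun z => E z - Real.exp A * z) 0 z := by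
        intro z
        have := (hE z).sub ((hasDerivAt_id z).const_mul (Real.exp A))
        rw [zero_mul, add_zero, mul_one, sub_self] at this
        exact this
      have := is_const_of_deriv_eq_zero (fun z => (hc z).differentiableAt)
        (fun z => (hc z).deriv) x y
      linarith
    have hp := Real.exp_pos A
    simp only [hlin]
    rw [mul_div_mul_left _ _ hp.ne', mul_div_mul_left _ _ hp.ne']
  · have hform : ∀ x y, E y - E x =
        2 / β * Real.exp A * (Real.exp (β * x / 2) * Real.exp (β * y / 2)) *
          Real.sinh (β * (y - x) / 2) := by
      intro x y
      have hc : ∀ z, HasDerivAt (fun z => E z - Real.exp (A + β * z) / β) 0 z := by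
        intro z
        have h5 : HasDerivAt (fun z => Real.exp (A + β * z)) (Real.exp (A + β * z) * β) z := by
          have : HasDerivAt (fun z => A + β * z) β z := by
            simpa using ((hasDerivAt_id z).const_mul β).const_add A
          exact this.exp
        have := (hE z).sub (h5.div_const β)
        rwa [mul_div_cancel_right₀ _ hβ, sub_self] at this
      have := is_const_of_deriv_eq_zero (fun z => (hc z).differentiableAt)
        (fun z => (hc z).deriv) x y
      have h6 : E y - E x = (Real.exp (A + β * y) - Real.exp (A + β * x)) / β := by
        rw [sub_div]; linarith
      rw [h6, Real.sinh_eq, Real.exp_add, Real.exp_add]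
      have h7 : Real.exp (β * (y - x) / 2) = Real.exp (β * y / 2) / Real.exp (β * x / 2) := by
        rw [← Real.exp_sub]; ring_nf
      have h8 : Real.exp (-(β * (y - x) / 2)) = Real.exp (β * x / 2) / Real.exp (β * y / 2) := by
        rw [← Real.exp_sub]; ring_nf
      have h9 : ∀ z, Real.exp (β * z) = Real.exp (β * z / 2) ^ 2 := by
        intro z; rw [← Real.exp_nat_mul]; ring_nf
      rw [h7, h8, h9 x, h9 y]
      have := (Real.exp_pos (β * x / 2)).ne'
      have := (Real.exp_pos (β * y / 2)).ne'
      field_simp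
    have hsr : ∀ s t : ℝ, 0 < s → s < t →
        0 < t / s ∧ t / s ≤ Real.sinh (β * t / 2) / Real.sinh (β * s / 2) := by
      intro s t hs hst
      refine ⟨div_pos (hs.trans hst) hs, ?_⟩
      have hb : 0 < |β| := abs_pos.2 hβ
      have e : Real.sinh (β * t / 2) / Real.sinh (β * s / 2) =
          Real.sinh (|β| * t / 2) / Real.sinh (|β| * s / 2) := by
        rcases abs_choice β with h | h <;> rw [h]
        have e1 : -β * t / 2 = -(β * t / 2) := by ring
        have e2 : -β * s / 2 = -(β * s / 2) := by ring
        rw [e1, e2, Real.sinh_neg, Real.sinh_neg, neg_div_neg_eq]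
      rw [e]
      have hs2 : 0 < |β| * s / 2 := by positivity
      have := mul_sinh_le_mul_sinh (l := |β| * s / 2) (t := |β| * t / 2) hs2.le (by gcongr)
      rw [div_le_div_iff₀ hs (Real.sinh_pos_iff.2 hs2)]
      have h10 : |β| / 2 * (t * Real.sinh (|β| * s / 2)) ≤
          |β| / 2 * (Real.sinh (|β| * t / 2) * s) := by linarith
      exact le_of_mul_le_mul_left h10 (by positivity)
    have k1 := hsr (b - a) (c - a) (by linarith) (by linarith)
    have k2 := hsr (d - c) (d - b) (by linarith) (by linarith)
    have hprod : (E c - E a) / (E b - E a) * ((E d - E b) / (E d - E c)) =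
        Real.sinh (β * (c - a) / 2) / Real.sinh (β * (b - a) / 2) *
          (Real.sinh (β * (d - b) / 2) / Real.sinh (β * (d - c) / 2)) := by
      have n1 : Real.sinh (β * (b - a) / 2) ≠ 0 := by
        intro h0; have := hform a b; rw [h0, mul_zero] at this; linarith
      have n2 : Real.sinh (β * (d - c) / 2) ≠ 0 := by
        intro h0; have := hform c d; rw [h0, mul_zero] at this; linarith
      rw [hform a c, hform a b, hform b d, hform c d]
      have q1 := (Real.exp_pos (β * a / 2)).ne'
      have q2 := (Real.exp_pos (β * b / 2)).ne'
      have q3 := (Real.exp_pos (β * c / 2)).ne'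
      have q4 := (Real.exp_pos (β * d / 2)).ne'
      have q5 := (Real.exp_pos A).ne'
      field_simp
    rw [hprod]
    have := mul_le_mul k1.2 k2.2 k2.1.le (k1.1.le.trans k1.2)
    linarith

lemma exists_exp_primitive (A β : ℝ) :
    ∃ E : ℝ → ℝ, ∀ x, HasDerivAt E (Real.exp (A + β * x)) x := by
  rcases eq_or_ne β 0 with rfl | hβ
  · exact ⟨fun x => Real.exp A * x, fun x => by
      simpa using (hasDerivAt_id x).const_mul (Real.exp A)⟩
  · refine ⟨fun x => Real.exp (A + β * x) / β, fun x => ?_⟩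
    have : HasDerivAt (fun z => A + β * z) β x := by
      simpa using ((hasDerivAt_id x).const_mul β).const_add A
    have := this.exp.div_const β
    rwa [mul_div_cancel_right₀ _ hβ] at this

lemma sub_le_sub_of_deriv_le {f g f' g' : ℝ → ℝ} {a b : ℝ} (hab : a ≤ b)
    (hf : ∀ x ∈ Icc a b, HasDerivAt f (f' x) x) (hg : ∀ x ∈ Icc a b, HasDerivAt g (g' x) x)
    (h : ∀ x ∈ Icc a b, f' x ≤ g' x) : f b - f a ≤ g b - g a := by
  have hm : MonotoneOn (fun x => g x - f x) (Icc a b) := by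
    refine monotoneOn_of_deriv_nonneg (convex_Icc a b) ?_ ?_ ?_
    · exact fun x hx => ((hg x hx).sub (hf x hx)).continuousAt.continuousWithinAt
    · exact fun x hx => ((hg x (interior_subset hx)).sub
        (hf x (interior_subset hx))).differentiableAt.differentiableWithinAt
    · intro x hx
      have hx' := interior_subset hx
      have := ((hg x hx').sub (hf x hx')).deriv
      change 0 ≤ deriv (g - f) x
      rw [this]; linarith [h x hx']
  have := hm ⟨le_rfl, hab⟩ ⟨hab, le_rfl⟩ hab
  simp only at this; linarith

lemma crossX_distortion {F F' p q : ℝ → ℝ} {a b c d K : ℝ} (hab : a < b) (hbc : b < c)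
    (hcd : c < d) (hK : 0 ≤ K) (hF : ∀ x ∈ Icc a d, HasDerivAt F (F' x) x)
    (hF' : ∀ x ∈ Icc a d, F' x = Real.exp (p x + q x)) (hp : ConcaveOn ℝ (Icc a d) p)
    (hq : ∀ x ∈ Icc a d, ∀ y ∈ Icc a d, |q x - q y| ≤ K * |x - y|) :
    Real.exp (-(4 * K * (d - a))) * crossX (b - a) (c - b) (d - c) ≤
      crossX (F b - F a) (F c - F b) (F d - F c) := by
  set β := (p c - p b) / (c - b) with hβ
  set A := p b - β * b with hA
  have hbc' : c - b ≠ 0 := by linarith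
  have hpb : A + β * b = p b := by simp [hA]
  have hpc : A + β * c = p c := by
    have : β * (c - b) = p c - p b := by rw [hβ]; field_simp
    linarith
  clear_value A β
  have mb : b ∈ Icc a d := ⟨by linarith, by linarith⟩
  have mc : c ∈ Icc a d := ⟨by linarith, by linarith⟩
  obtain ⟨E, hE⟩ := exists_exp_primitive A β
  set t := d - a with ht
  set s := Real.exp (K * t) with hs
  set q0 := Real.exp (q b) with hq0
  have hs1 : 1 ≤ s := Real.one_le_exp (mul_nonneg hK (by linarith))
  have hspos : 0 < s := by linarith
  have hq0pos : 0 < q0 := Real.exp_pos _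
  have hqb : ∀ x ∈ Icc a d, q b - K * t ≤ q x ∧ q x ≤ q b + K * t := by
    intro x hx
    have h1 := hq x hx b mb
    have h2 : |x - b| ≤ t := abs_le.2 ⟨by linarith [hx.1, mb.2], by linarith [hx.2, mb.1]⟩
    have h3 := abs_le.1 (h1.trans (mul_le_mul_of_nonneg_left h2 hK))
    constructor <;> linarith [h3.1, h3.2]
  have hmid : ∀ x ∈ Icc b c, A + β * x ≤ p x := by
    intro x hx
    have := hp.2 mb mc
      (show 0 ≤ (c - x) / (c - b) from div_nonneg (by linarith [hx.2]) (by linarith))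
      (show 0 ≤ (x - b) / (c - b) from div_nonneg (by linarith [hx.1]) (by linarith))
      (by field_simp; ring)
    simp only [smul_eq_mul] at this
    have e1 : (c - x) / (c - b) * b + (x - b) / (c - b) * c = x := by field_simp; ring
    have e2 : (c - x) / (c - b) * p b + (x - b) / (c - b) * p c = A + β * x := by
      rw [← hpb, ← hpc]; field_simp; ring
    rwa [e1, e2] at this
  have hleft : ∀ x ∈ Icc a b, p x ≤ A + β * x := by
    intro x hx
    rcases hx.2.eq_or_lt with rfl | hxb
    · exact hpb.ge
    have mx : x ∈ Icc a d := ⟨hx.1, by linarith⟩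
    have := hp.2 mx mc
      (show 0 ≤ (c - b) / (c - x) from div_nonneg (by linarith) (by linarith))
      (show 0 ≤ (b - x) / (c - x) from div_nonneg (by linarith) (by linarith))
      (by have : c - x ≠ 0 := by linarith
          field_simp; ring)
    simp only [smul_eq_mul] at this
    have hcx : 0 < c - x := by linarith
    have e1 : (c - b) / (c - x) * x + (b - x) / (c - x) * c = b := by
      have := hcx.ne'; field_simp; ring
    rw [e1, ← hpb, ← hpc, div_mul_eq_mul_div, div_mul_eq_mul_div, ← add_div,
      div_le_iff₀ hcx] at this
    have h4 : (c - b) * p x ≤ (c - b) * (A + β * x) := by linarith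
    exact le_of_mul_le_mul_left h4 (by linarith)
  have hright : ∀ x ∈ Icc c d, p x ≤ A + β * x := by
    intro x hx
    rcases hx.1.eq_or_lt with rfl | hxb
    · exact hpc.ge
    have mx : x ∈ Icc a d := ⟨by linarith, hx.2⟩
    have := hp.2 mb mx
      (show 0 ≤ (x - c) / (x - b) from div_nonneg (by linarith) (by linarith))
      (show 0 ≤ (c - b) / (x - b) from div_nonneg (by linarith) (by linarith))
      (by have : x - b ≠ 0 := by linarith
          field_simp; ring)
    simp only [smul_eq_mul] at this
    have hcx : 0 < x - b := by linarith
    have e1 : (x - c) / (x - b) * b + (c - b) / (x - b) * x = c := by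
      have := hcx.ne'; field_simp; ring
    rw [e1, ← hpb, ← hpc, div_mul_eq_mul_div, div_mul_eq_mul_div, ← add_div,
      div_le_iff₀ hcx] at this
    have h4 : (c - b) * p x ≤ (c - b) * (A + β * x) := by linarith
    exact le_of_mul_le_mul_left h4 (by linarith)
  have hup : ∀ x ∈ Icc a d, p x ≤ A + β * x → F' x ≤ q0 * s * Real.exp (A + β * x) := by
    intro x hx h
    rw [hF' x hx, hq0, hs, ← Real.exp_add, ← Real.exp_add]
    exact Real.exp_le_exp.2 (by linarith [(hqb x hx).2])
  have hdn : ∀ x ∈ Icc a d, A + β * x ≤ p x → q0 / s * Real.exp (A + β * x) ≤ F' x := by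
    intro x hx h
    rw [hF' x hx, hq0, hs, ← Real.exp_sub, ← Real.exp_add]
    exact Real.exp_le_exp.2 (by linarith [(hqb x hx).1])
  have hL : F b - F a ≤ q0 * s * (E b - E a) := by
    have := sub_le_sub_of_deriv_le hab.le (fun x hx => hF x ⟨hx.1, by linarith [hx.2]⟩)
      (fun x _ => (hE x).const_mul (q0 * s))
      (fun x hx => hup x ⟨hx.1, by linarith [hx.2]⟩ (hleft x hx))
    linarith
  have hR : F d - F c ≤ q0 * s * (E d - E c) := by
    have := sub_le_sub_of_deriv_le hcd.le (fun x hx => hF x ⟨by linarith [hx.1], hx.2⟩)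
      (fun x _ => (hE x).const_mul (q0 * s))
      (fun x hx => hup x ⟨by linarith [hx.1], hx.2⟩ (hright x hx))
    linarith
  have hM : q0 / s * (E c - E b) ≤ F c - F b := by
    have := sub_le_sub_of_deriv_le hbc.le (fun x _ => (hE x).const_mul (q0 / s))
      (fun x hx => hF x ⟨by linarith [hx.1], by linarith [hx.2]⟩)
      (fun x hx => hdn x ⟨by linarith [hx.1], by linarith [hx.2]⟩ (hmid x hx))
    linarith
  have hFmono : StrictMonoOn F (Icc a d) := by
    refine strictMonoOn_of_deriv_pos (convex_Icc a d)
      (fun x hx => (hF x hx).continuousAt.continuousWithinAt) fun x hx => ?_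
    have hx' := interior_subset hx
    rw [(hF x hx').deriv, hF' x hx']; exact Real.exp_pos _
  have hEmono : StrictMono E := strictMono_of_deriv_pos fun x => by
    rw [(hE x).deriv]; exact Real.exp_pos _
  have ma : a ∈ Icc a d := ⟨le_rfl, by linarith⟩
  have md : d ∈ Icc a d := ⟨by linarith, le_rfl⟩
  have f1 := hFmono ma mb hab
  have f2 := hFmono mb mc hbc
  have f3 := hFmono mc md hcd
  have g1 := hEmono hab
  have g2 := hEmono hbc
  have g3 := hEmono hcd
  have hX := crossX_le_of_exp hE hab hbc hcd
  have hs4 : Real.exp (-(4 * K * t)) = 1 / s ^ 4 := by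
    rw [hs, ← Real.exp_nat_mul, one_div, ← Real.exp_neg]
    congr 1; push_cast; ring
  rw [hs4]
  refine (mul_le_mul_of_nonneg_left hX (by positivity)).trans ?_
  set L := E b - E a
  set M := E c - E b
  set R := E d - E c
  have hLp : 0 < L := by simp only [L]; linarith
  have hMp : 0 < M := by simp only [M]; linarith
  have hRp : 0 < R := by simp only [R]; linarith
  set fL := F b - F a
  set fM := F c - F b
  set fR := F d - F c
  have hfL : 0 < fL := by simp only [fL]; linarith
  have hfM : 0 < fM := by simp only [fM]; linarith
  have hfR : 0 < fR := by simp only [fR]; linarith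
  have expand : ∀ l m r : ℝ, 0 < l → 0 < r → crossX l m r = (1 + m / l) * (1 + m / r) - 1 := by
    intro l m r hl hr
    unfold crossX; field_simp; ring
  have hml : ∀ l fl : ℝ, 0 < l → 0 < fl → fl ≤ q0 * s * l → M / l / s ^ 2 ≤ fM / fl := by
    intro l fl hl hfl hle
    rw [div_div, div_le_div_iff₀ (by positivity) hfl]
    have h5 : M * fl ≤ M * (q0 * s * l) := mul_le_mul_of_nonneg_left hle hMp.le
    have h6 : q0 / s * M * (s ^ 2 * l) ≤ fM * (s ^ 2 * l) :=
      mul_le_mul_of_nonneg_right hM (by positivity)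
    have h7 : q0 / s * M * (s ^ 2 * l) = M * (q0 * s * l) := by field_simp
    linarith
  have u1 := hml L fL hLp hfL hL
  have u2 := hml R fR hRp hfR hR
  rw [expand _ _ _ hLp hRp, expand _ _ _ hfL hfR]
  have v1 : 0 < M / L := by positivity
  have v2 : 0 < M / R := by positivity
  set x1 := M / L
  set x2 := M / R
  have w : 1 / s ^ 4 * ((1 + x1) * (1 + x2) - 1) ≤ (1 + x1 / s ^ 2) * (1 + x2 / s ^ 2) - 1 := by
    have hs2 : 1 ≤ s ^ 2 := one_le_pow₀ hs1
    have : (1 + x1 / s ^ 2) * (1 + x2 / s ^ 2) - 1 =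
        1 / s ^ 4 * (s ^ 2 * (x1 + x2) + x1 * x2) := by field_simp; ring
    rw [this]
    refine mul_le_mul_of_nonneg_left ?_ (by positivity)
    nlinarith
  refine w.trans ?_
  have := mul_le_mul (add_le_add_right u1 1) (add_le_add_right u2 1) (by positivity)
    (by positivity)
  linarith

/-! ### Distortion on the laps of a map with non-flat critical points -/

lemma nonflat_bound {F ψ : ℝ → ℝ} {c ℓ s : ℝ} (hs : s = 1 ∨ s = -1) (hℓ : 1 < ℓ)
    (hF : ContDiff ℝ 2 F) (hψ : ContDiff ℝ 2 ψ) (hψd : deriv ψ c ≠ 0) (hψ0 : ψ c = 0)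
    (hEq : ∀ᶠ x in nhds c, F x = F c + s * |ψ x| ^ ℓ) :
    ∃ M, ∀ᶠ x in nhdsWithin c {c}ᶜ,
      |deriv (deriv F) x / deriv F x - (ℓ - 1) / (x - c)| ≤ M := by
  have hF1 : ContDiff ℝ 1 (deriv F) := (contDiff_succ_iff_deriv (n := 1)).1 hF |>.2.2
  have hψ1 : ContDiff ℝ 1 (deriv ψ) := (contDiff_succ_iff_deriv (n := 1)).1 hψ |>.2.2
  have hFd : Differentiable ℝ (deriv F) := hF1.differentiable (by norm_num)
  have hψdd : Differentiable ℝ (deriv ψ) := hψ1.differentiable (by norm_num)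
  have hψdf : Differentiable ℝ ψ := hψ.differentiable (by norm_num)
  have hcont2 : Continuous (deriv (deriv ψ)) := hψ1.continuous_deriv le_rfl
  obtain ⟨C, U, hU, hLip⟩ := (hψ1.contDiffAt (x := c)).exists_lipschitzOnWith
  set k := |deriv ψ c| / 2 with hk
  have hkpos : 0 < k := by have := abs_pos.2 hψd; positivity
  have e1 : ∀ᶠ x in nhds c, k ≤ |deriv ψ x| := by
    have : ContinuousAt (fun x => |deriv ψ x|) c := (hψ1.continuous.abs).continuousAt
    have h1 : k < |deriv ψ c| := by rw [hk]; linarith [abs_pos.2 hψd]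
    filter_upwards [this.eventually (lt_mem_nhds h1)] with x hx using hx.le
  have e2 : ∀ᶠ x in nhds c, |deriv (deriv ψ) x| ≤ |deriv (deriv ψ) c| + 1 := by
    have : ContinuousAt (fun x => |deriv (deriv ψ) x|) c := hcont2.abs.continuousAt
    filter_upwards [this.eventually (gt_mem_nhds (lt_add_one _))] with x hx using hx.le
  obtain ⟨ε, hε, hball⟩ := Metric.eventually_nhds_iff_ball.1 ((hEq.and (e1.and e2)).and hU)
  refine ⟨(ℓ - 1) * (C / k) + (|deriv (deriv ψ) c| + 1) / k, ?_⟩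
  have hmv : ∀ x ∈ Metric.ball c ε, x ≠ c → ∃ ξ ∈ Metric.ball c ε, |ξ - x| ≤ |x - c| ∧
      ψ x = deriv ψ ξ * (x - c) := by
    intro x hx hxc
    rw [Metric.mem_ball, Real.dist_eq] at hx
    rcases lt_or_gt_of_ne hxc with h | h
    · obtain ⟨ξ, hξ, he⟩ := exists_deriv_eq_slope ψ h hψdf.continuous.continuousOn
        hψdf.differentiableOn
      rw [abs_of_neg (by linarith)] at hx
      refine ⟨ξ, ?_, ?_, ?_⟩
      · rw [Metric.mem_ball, Real.dist_eq, abs_of_neg (by linarith [hξ.2])]; linarith [hξ.1]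
      · rw [abs_of_nonneg (by linarith [hξ.1]), abs_of_neg (by linarith)]; linarith [hξ.2]
      · have : c - x ≠ 0 := by linarith
        rw [he, hψ0]; field_simp; ring
    · obtain ⟨ξ, hξ, he⟩ := exists_deriv_eq_slope ψ h hψdf.continuous.continuousOn
        hψdf.differentiableOn
      rw [abs_of_pos (by linarith)] at hx
      refine ⟨ξ, ?_, ?_, ?_⟩
      · rw [Metric.mem_ball, Real.dist_eq, abs_of_pos (by linarith [hξ.1])]; linarith [hξ.2]
      · rw [abs_of_nonpos (by linarith [hξ.2]), abs_of_pos (by linarith)]; linarith [hξ.1]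
      · have : x - c ≠ 0 := by linarith
        rw [he, hψ0]; field_simp; ring
  have hψne : ∀ x ∈ Metric.ball c ε, x ≠ c → ψ x ≠ 0 := by
    intro x hx hxc
    obtain ⟨ξ, hξ, _, he⟩ := hmv x hx hxc
    rw [he]
    refine mul_ne_zero ?_ (sub_ne_zero.2 hxc)
    intro h0
    have := (hball ξ hξ).1.2.1
    rw [h0, abs_zero] at this; linarith
  have hψdne : ∀ x ∈ Metric.ball c ε, deriv ψ x ≠ 0 := by
    intro x hx h0
    have := (hball x hx).1.2.1
    rw [h0, abs_zero] at this; linarith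
  have hsne : s ≠ 0 := by rcases hs with rfl | rfl <;> norm_num
  have hlogs : Real.log s = 0 := by rcases hs with rfl | rfl <;> simp
  have hopen : IsOpen (Metric.ball c ε \ {c}) := Metric.isOpen_ball.sdiff isClosed_singleton
  have hF' : ∀ x ∈ Metric.ball c ε \ {c},
      deriv F x = s * (Real.exp (Real.log (ψ x) * ℓ) * (deriv ψ x / ψ x * ℓ)) := by
    intro x hx
    have hev : F =ᶠ[nhds x] fun y => F c + s * Real.exp (Real.log (ψ y) * ℓ) := by
      filter_upwards [hopen.mem_nhds hx] with y hy
      rw [(hball y hy.1).1.1, Real.rpow_def_of_pos (abs_pos.2 (hψne y hy.1 hy.2)), Real.log_abs]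
    rw [hev.deriv_eq]
    have h1 := ((hψdf x).hasDerivAt.log (hψne x hx.1 hx.2)).mul_const ℓ
    exact ((h1.exp.const_mul s).const_add (F c)).deriv
  have hlog : ∀ x ∈ Metric.ball c ε \ {c}, Real.log (deriv F x) =
      Real.log (ψ x) * (ℓ - 1) + Real.log (deriv ψ x) + Real.log ℓ := by
    intro x hx
    have n1 := hψne x hx.1 hx.2
    have n2 := hψdne x hx.1
    have n3 : ℓ ≠ 0 := by linarith
    rw [hF' x hx, Real.log_mul hsne (by positivity), Real.log_mul (by positivity) (by positivity),
      Real.log_mul (by positivity) n3, Real.log_div n2 n1, Real.log_exp, hlogs]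
    ring
  have hN : ∀ x ∈ Metric.ball c ε \ {c}, deriv (deriv F) x / deriv F x =
      deriv ψ x / ψ x * (ℓ - 1) + deriv (deriv ψ) x / deriv ψ x := by
    intro x hx
    have n1 := hψne x hx.1 hx.2
    have n2 := hψdne x hx.1
    have n3 : ℓ ≠ 0 := by linarith
    have n4 : deriv F x ≠ 0 := by
      rw [hF' x hx]
      exact mul_ne_zero hsne (mul_ne_zero (Real.exp_pos _).ne' (mul_ne_zero (div_ne_zero n2 n1) n3))
    have h1 := ((hFd x).hasDerivAt.log n4).deriv
    have hev : (fun y => Real.log (deriv F y)) =ᶠ[nhds x] fun y =>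
        Real.log (ψ y) * (ℓ - 1) + Real.log (deriv ψ y) + Real.log ℓ := by
      filter_upwards [hopen.mem_nhds hx] with y hy using hlog y hy
    rw [← h1, hev.deriv_eq]
    exact (((((hψdf x).hasDerivAt.log n1).mul_const (ℓ - 1)).add
      ((hψdd x).hasDerivAt.log n2)).add_const (Real.log ℓ)).deriv
  have hmem : ∀ᶠ x in nhdsWithin c {c}ᶜ, x ∈ Metric.ball c ε \ {c} := by
    rw [eventually_nhdsWithin_iff]
    filter_upwards [Metric.ball_mem_nhds c hε] with x hx hxc using ⟨hx, hxc⟩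
  filter_upwards [hmem] with x hx
  have hxc : x ≠ c := hx.2
  have hxc' : x - c ≠ 0 := sub_ne_zero.2 hxc
  obtain ⟨ξ, hξ, hle, he⟩ := hmv x hx.1 hxc
  rw [hN x hx]
  have hd : deriv ψ x / ψ x - 1 / (x - c) = (deriv ψ x - deriv ψ ξ) / (deriv ψ ξ * (x - c)) := by
    have := hψdne ξ hξ
    rw [he]; field_simp
  have b1 : |deriv ψ x / ψ x - 1 / (x - c)| ≤ C / k := by
    rw [hd, abs_div, abs_mul, div_le_div_iff₀
      (mul_pos (abs_pos.2 (hψdne ξ hξ)) (abs_pos.2 hxc')) hkpos]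
    have h2 := hLip.dist_le_mul x (hball x hx.1).2 ξ (hball ξ hξ).2
    rw [Real.dist_eq, Real.dist_eq, abs_sub_comm x ξ] at h2
    have h3 : |deriv ψ x - deriv ψ ξ| ≤ C * |x - c| :=
      h2.trans (mul_le_mul_of_nonneg_left hle C.2)
    have h4 := (hball ξ hξ).1.2.1
    calc |deriv ψ x - deriv ψ ξ| * k ≤ C * |x - c| * |deriv ψ ξ| :=
          mul_le_mul h3 h4 hkpos.le (mul_nonneg C.2 (abs_nonneg _))
      _ = C * (|deriv ψ ξ| * |x - c|) := by ring
  have b2 : |deriv (deriv ψ) x / deriv ψ x| ≤ (|deriv (deriv ψ) c| + 1) / k := by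
    rw [abs_div]
    exact div_le_div₀ (by positivity) (hball x hx.1).1.2.2 hkpos (hball x hx.1).1.2.1
  have e : deriv ψ x / ψ x * (ℓ - 1) + deriv (deriv ψ) x / deriv ψ x - (ℓ - 1) / (x - c) =
      (ℓ - 1) * (deriv ψ x / ψ x - 1 / (x - c)) + deriv (deriv ψ) x / deriv ψ x := by ring
  rw [e]
  refine (abs_add_le _ _).trans (add_le_add ?_ b2)
  rw [abs_mul, abs_of_pos (by linarith : (0 : ℝ) < ℓ - 1)]
  exact mul_le_mul_of_nonneg_left b1 (by linarith)

lemma exists_lap_crossX {F : ℝ → ℝ} (hC2 : ContDiff ℝ 2 F) {u v : ℝ} (huv : u < v)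
    (hsign : (∀ x ∈ Ioo u v, 0 < deriv F x) ∨ (∀ x ∈ Ioo u v, deriv F x < 0))
    {lu lv Mu Mv : ℝ} (hlu : 1 < lu) (hlv : 1 < lv)
    (hu : ∀ᶠ x in nhdsWithin u {u}ᶜ,
      |deriv (deriv F) x / deriv F x - (lu - 1) / (x - u)| ≤ Mu)
    (hv : ∀ᶠ x in nhdsWithin v {v}ᶜ,
      |deriv (deriv F) x / deriv F x - (lv - 1) / (x - v)| ≤ Mv) :
    ∃ K, 0 ≤ K ∧ ∀ a b c d, u < a → a < b → b < c → c < d → d < v →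
      Real.exp (-(K * (d - a))) * crossX (b - a) (c - b) (d - c) ≤
        crossX |F b - F a| |F c - F b| |F d - F c| := by
  have hF1 : ContDiff ℝ 1 (deriv F) := (contDiff_succ_iff_deriv (n := 1)).1 hC2 |>.2.2
  have hFd : Differentiable ℝ (deriv F) := hF1.differentiable (by norm_num)
  have hF0 : Differentiable ℝ F := hC2.differentiable (by norm_num)
  have hne : ∀ x ∈ Ioo u v, deriv F x ≠ 0 := by
    rcases hsign with h | h
    · exact fun x hx => (h x hx).ne'
    · exact fun x hx => (h x hx).ne
  set N : ℝ → ℝ := fun x =>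
    deriv (deriv F) x / deriv F x - (lu - 1) / (x - u) - (lv - 1) / (x - v) with hNdef
  have hNcont : ContinuousOn N (Ioo u v) := by
    have h1 : ContinuousOn (deriv (deriv F)) (Ioo u v) :=
      (hF1.continuous_deriv le_rfl).continuousOn
    refine ((h1.div hF1.continuous.continuousOn hne).sub ?_).sub ?_
    · exact continuousOn_const.div (by fun_prop) fun x hx => by linarith [hx.1]
    · exact continuousOn_const.div (by fun_prop) fun x hx => by linarith [hx.2]
  obtain ⟨K, hK⟩ : ∃ K, ∀ x ∈ Ioo u v, |N x| ≤ K := by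
    rw [eventually_nhdsWithin_iff, Metric.eventually_nhds_iff] at hu hv
    obtain ⟨ε1, hε1, h1⟩ := hu
    obtain ⟨ε2, hε2, h2⟩ := hv
    set ε := min (min ε1 ε2) (v - u) / 2 with hε
    have hm : 0 < min (min ε1 ε2) (v - u) := lt_min (lt_min hε1 hε2) (by linarith)
    have hεp : 0 < ε := by positivity
    have hε1' : ε < ε1 := by
      have := (min_le_left (min ε1 ε2) (v - u)).trans (min_le_left _ _); linarith
    have hε2' : ε < ε2 := by
      have := (min_le_left (min ε1 ε2) (v - u)).trans (min_le_right _ _); linarith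
    have hεv : 2 * ε ≤ v - u := by
      have := (min_le_right (min ε1 ε2) (v - u)); linarith
    have hsub : Icc (u + ε) (v - ε) ⊆ Ioo u v := fun x hx =>
      ⟨by linarith [hx.1], by linarith [hx.2]⟩
    obtain ⟨K0, hK0⟩ := isCompact_Icc.exists_bound_of_continuousOn (hNcont.mono hsub)
    refine ⟨max K0 (max (Mu + (lv - 1) / ε) (Mv + (lu - 1) / ε)), fun x hx => ?_⟩
    by_cases c1 : x < u + ε
    · refine le_max_of_le_right (le_max_of_le_left ?_)
      have t1 := h1 (y := x) (by rw [Real.dist_eq, abs_of_pos (by linarith [hx.1])]; linarith)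
        (ne_of_gt hx.1)
      have t2 : |(lv - 1) / (x - v)| ≤ (lv - 1) / ε := by
        rw [abs_div, abs_of_pos (by linarith : (0 : ℝ) < lv - 1), abs_of_neg (by linarith [hx.2])]
        exact div_le_div_of_nonneg_left (by linarith) hεp (by linarith)
      exact (abs_sub _ _).trans (add_le_add t1 t2)
    by_cases c2 : v - ε < x
    · refine le_max_of_le_right (le_max_of_le_right ?_)
      have t1 := h2 (y := x) (by rw [Real.dist_eq, abs_of_neg (by linarith [hx.2])]; linarith)
        (ne_of_lt hx.2)
      have t2 : |(lu - 1) / (x - u)| ≤ (lu - 1) / ε := by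
        rw [abs_div, abs_of_pos (by linarith : (0 : ℝ) < lu - 1), abs_of_pos (by linarith [hx.1])]
        exact div_le_div_of_nonneg_left (by linarith) hεp (by linarith)
      have e : N x = deriv (deriv F) x / deriv F x - (lv - 1) / (x - v) - (lu - 1) / (x - u) := by
        simp only [hNdef]; ring
      rw [e]
      exact (abs_sub _ _).trans (add_le_add t1 t2)
    · exact le_max_of_le_left (hK0 x ⟨by linarith, by linarith⟩)
  have hK0 : 0 ≤ K := by
    have := hK ((u + v) / 2) ⟨by linarith, by linarith⟩
    exact (abs_nonneg _).trans this
  refine ⟨4 * K, by positivity, fun a b c d hua hab hbc hcd hdv => ?_⟩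
  set p : ℝ → ℝ := fun x => (lu - 1) * Real.log (x - u) + (lv - 1) * Real.log (v - x) with hp
  set q : ℝ → ℝ := fun x => Real.log (deriv F x) - p x with hq
  have hqd : ∀ x ∈ Ioo u v, HasDerivAt q (N x) x := by
    intro x hx
    have h1 := (hFd x).hasDerivAt.log (hne x hx)
    have h2 : HasDerivAt (fun y => Real.log (y - u)) (1 / (x - u)) x :=
      ((hasDerivAt_id x).sub_const u).log (by simp only [id]; linarith [hx.1])
    have h3 : HasDerivAt (fun y => Real.log (v - y)) (-1 / (v - x)) x :=
      ((hasDerivAt_id x).const_sub v).log (by simp only [id]; linarith [hx.2])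
    have := h1.sub ((h2.const_mul (lu - 1)).add (h3.const_mul (lv - 1)))
    have n1 : x - u ≠ 0 := by linarith [hx.1]
    have n2 : v - x ≠ 0 := by linarith [hx.2]
    have n3 : x - v ≠ 0 := by linarith [hx.2]
    have e : (lv - 1) / (x - v) = (lv - 1) * (-1 / (v - x)) := by
      rw [← neg_sub v x, div_neg]; ring
    have e2 : N x = deriv (deriv F) x / deriv F x -
        ((lu - 1) * (1 / (x - u)) + (lv - 1) * (-1 / (v - x))) := by
      simp only [hNdef]; rw [e]; ring
    rw [e2]; exact this
  have hsub : Icc a d ⊆ Ioo u v := fun x hx => ⟨by linarith [hx.1], by linarith [hx.2]⟩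
  have hqL : ∀ x ∈ Icc a d, ∀ y ∈ Icc a d, |q x - q y| ≤ K * |x - y| := by
    intro x hx y hy
    have := (convex_Ioo u v).norm_image_sub_le_of_norm_hasDerivWithin_le
      (fun z hz => (hqd z hz).hasDerivWithinAt) (fun z hz => hK z hz) (hsub hy) (hsub hx)
    simpa [Real.norm_eq_abs] using this
  have hpc : ConcaveOn ℝ (Icc a d) p := by
    have h1 : ConcaveOn ℝ (Icc a d) (fun x => Real.log (x - u)) := by
      have := strictConcaveOn_log_Ioi.concaveOn.comp_affineMap
        (AffineMap.id ℝ ℝ - AffineMap.const ℝ ℝ u)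
      exact this.subset (fun x hx => by
        simp only [mem_preimage, mem_Ioi]
        change 0 < x - u
        linarith [hx.1]) (convex_Icc a d)
    have h2 : ConcaveOn ℝ (Icc a d) (fun x => Real.log (v - x)) := by
      have := strictConcaveOn_log_Ioi.concaveOn.comp_affineMap
        (AffineMap.const ℝ ℝ v - AffineMap.id ℝ ℝ)
      exact this.subset (fun x hx => by
        simp only [mem_preimage, mem_Ioi]
        change 0 < v - x
        linarith [hx.2]) (convex_Icc a d)
    exact (h1.smul (by linarith : (0 : ℝ) ≤ lu - 1)).add (h2.smul (by linarith : (0 : ℝ) ≤ lv - 1))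
  rcases hsign with hpos | hneg
  · have hexp : ∀ x ∈ Icc a d, deriv F x = Real.exp (p x + q x) := by
      intro x hx
      simp only [hq, add_sub_cancel]
      rw [Real.exp_log (hpos x (hsub hx))]
    have := crossX_distortion hab hbc hcd hK0 (fun x _ => (hF0 x).hasDerivAt) hexp hpc hqL
    have hm : StrictMonoOn F (Icc a d) := strictMonoOn_of_deriv_pos (convex_Icc a d)
      hF0.continuous.continuousOn fun x hx => hpos x (hsub (interior_subset hx))
    have m1 := hm ⟨le_rfl, by linarith⟩ ⟨hab.le, by linarith⟩ hab
    have m2 := hm ⟨hab.le, by linarith⟩ ⟨by linarith, hcd.le⟩ hbc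
    have m3 := hm ⟨by linarith, hcd.le⟩ ⟨by linarith, le_rfl⟩ hcd
    rwa [abs_of_pos (sub_pos.2 m1), abs_of_pos (sub_pos.2 m2), abs_of_pos (sub_pos.2 m3)]
  · have hexp : ∀ x ∈ Icc a d, -deriv F x = Real.exp (p x + q x) := by
      intro x hx
      simp only [hq, add_sub_cancel]
      rw [← Real.log_neg_eq_log, Real.exp_log (neg_pos.2 (hneg x (hsub hx)))]
    have := crossX_distortion hab hbc hcd hK0 (fun x _ => (hF0 x).hasDerivAt.neg) hexp hpc hqL
    have hm : StrictAntiOn F (Icc a d) := strictAntiOn_of_deriv_neg (convex_Icc a d)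
      hF0.continuous.continuousOn fun x hx => hneg x (hsub (interior_subset hx))
    have m1 := hm ⟨le_rfl, by linarith⟩ ⟨hab.le, by linarith⟩ hab
    have m2 := hm ⟨hab.le, by linarith⟩ ⟨by linarith, hcd.le⟩ hbc
    have m3 := hm ⟨by linarith, hcd.le⟩ ⟨by linarith, le_rfl⟩ hcd
    rw [abs_of_neg (sub_neg.2 m1), abs_of_neg (sub_neg.2 m2), abs_of_neg (sub_neg.2 m3)]
    convert this using 2 <;> simp only [Pi.neg_apply] <;> ring

/-! ### Fold maps -/

lemma exists_lap_of_ne {c e a b : ℝ} (hab : a ≤ b)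
    (h : ∀ x ∈ Icc a b, ∀ m : ℤ, x ≠ c + m ∧ x ≠ e + m) :
    ∃ m : ℤ, (e - 1 + m < a ∧ b < c + m) ∨ (c + m < a ∧ b < e + m) := by
  set m := ⌊a - (e - 1)⌋
  have h1 : (m : ℝ) ≤ a - (e - 1) := Int.floor_le _
  have h2 : a - (e - 1) < m + 1 := Int.lt_floor_add_one _
  have ha : a ∈ Icc a b := ⟨le_rfl, hab⟩
  refine ⟨m, ?_⟩
  have h3 : a ≠ e - 1 + m := fun h0 => (h a ha (m - 1)).2 (by push_cast; linarith)
  have h3' : e - 1 + m < a := lt_of_le_of_ne (by linarith) (Ne.symm h3)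
  by_cases hac : a < c + m
  · left
    refine ⟨h3', ?_⟩
    by_contra hb
    exact (h (c + m) ⟨hac.le, not_lt.1 hb⟩ m).1 rfl
  · right
    refine ⟨lt_of_le_of_ne (not_lt.1 hac) (Ne.symm (h a ha m).1), ?_⟩
    by_contra hb
    exact (h (e + m) ⟨by linarith, not_lt.1 hb⟩ m).2 rfl

/-- A degree one map folded at `c` (local maximum) and `e` (local minimum), normalised so that the
orbit of `e` never enters the plateau `[d, e]`, without attracting returns, and with controlled
distortion of cross ratios. -/
structure FoldMap where
  F : ℝ → ℝ
  c : ℝ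
  d : ℝ
  e : ℝ
  cont : Continuous F
  lift : IsLift F
  hed : e - 1 < d
  hdc : d < c
  hce : c < e
  mono : StrictMonoOn F (Icc (e - 1) c)
  anti : StrictAntiOn F (Icc c e)
  hde : F d = F e
  noAttr : ∀ u v : ℝ, u < v → ∀ j : ℕ, 1 ≤ j → ∀ a : ℤ, InjOn F^[j] (Ioo u v) →
    ¬ MapsTo (fun x => F^[j] x - a) (Icc u v) (Icc u v)
  noRestr : ∀ j : ℕ, 1 ≤ j → ∀ (a : ℤ) (C : ℝ), ∃ t : ℕ, C < |F^[t * j] (F c) - t * a|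
  e_orbit : ∀ j : ℕ, 1 ≤ j → ∀ a : ℤ, F^[j] e + a ∉ Icc d e
  K : ℝ
  K_nonneg : 0 ≤ K
  cross : ∀ x₁ x₂ x₃ x₄ : ℝ, x₁ < x₂ → x₂ < x₃ → x₃ < x₄ →
    (∀ x ∈ Icc x₁ x₄, ∀ a : ℤ, x ≠ c + a ∧ x ≠ e + a) →
    Real.exp (-(K * (x₄ - x₁))) * crossX (x₂ - x₁) (x₃ - x₂) (x₄ - x₃) ≤
      crossX |F x₂ - F x₁| |F x₃ - F x₂| |F x₄ - F x₃|
  g : ℝ → ℝ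
  η : ℝ
  k₁ : ℝ
  k₂ : ℝ
  η_pos : 0 < η
  k₁_pos : 0 < k₁
  k₁_le : k₁ ≤ k₂
  g_c : g c = 0
  g_lip : ∀ x ∈ Ioo (c - η) (c + η), ∀ y ∈ Ioo (c - η) (c + η), x ≤ y →
    k₁ * (y - x) ≤ g y - g x ∧ g y - g x ≤ k₂ * (y - x)
  g_height : ∀ x ∈ Ioo (c - η) (c + η), ∀ y ∈ Ioo (c - η) (c + η), (F x ≤ F y ↔ |g y| ≤ |g x|)

namespace FoldMap
variable (Φ : FoldMap)

/-- Lifts of the critical points. -/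
def Crit (x : ℝ) : Prop := ∃ a : ℤ, x = Φ.c + a ∨ x = Φ.e + a

/-- The first `n` points of the orbit of `x` are not critical. -/
def FreeN (n : ℕ) (x : ℝ) : Prop := ∀ i < n, ¬ Φ.Crit (Φ.F^[i] x)

variable {Φ}

lemma cont_iter (n : ℕ) : Continuous Φ.F^[n] := Φ.cont.iterate n

lemma crit_add_int {x : ℝ} (m : ℤ) : Φ.Crit (x + m) ↔ Φ.Crit x := by
  constructor
  · rintro ⟨a, h | h⟩
    · exact ⟨a - m, Or.inl (by push_cast; linarith)⟩
    · exact ⟨a - m, Or.inr (by push_cast; linarith)⟩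
  · rintro ⟨a, h | h⟩
    · exact ⟨a + m, Or.inl (by push_cast; linarith)⟩
    · exact ⟨a + m, Or.inr (by push_cast; linarith)⟩

lemma crit_sub_int {x : ℝ} (m : ℤ) : Φ.Crit (x - m) ↔ Φ.Crit x := by
  have := crit_add_int (Φ := Φ) (x := x) (-m)
  push_cast at this
  rwa [← sub_eq_add_neg] at this

lemma isClosed_crit : IsClosed {x | Φ.Crit x} := by
  have h : ∀ y : ℝ, IsClosed {x : ℝ | ∃ a : ℤ, x = y + a} := by
    intro y
    have := Int.isClosedEmbedding_coe_real.isClosed_range.preimage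
      (continuous_sub_right y)
    convert this using 1
    ext x
    simp only [mem_ofPred_eq, mem_preimage, mem_range]
    exact ⟨fun ⟨a, ha⟩ => ⟨a, by linarith⟩, fun ⟨a, ha⟩ => ⟨a, by linarith⟩⟩
  convert (h Φ.c).union (h Φ.e) using 1
  ext x
  simp only [Crit, mem_ofPred_eq, mem_union, ← exists_or]

lemma isOpen_freeN (n : ℕ) : IsOpen {x | Φ.FreeN n x} := by
  have : {x | Φ.FreeN n x} = ⋂ i ∈ Finset.range n, (Φ.F^[i]) ⁻¹' {x | Φ.Crit x}ᶜ := by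
    ext x; simp [FreeN]
  rw [this]
  exact isOpen_biInter_finset fun i _ => isClosed_crit.isOpen_compl.preimage (cont_iter i)

lemma FreeN.mono {n m : ℕ} {x : ℝ} (h : Φ.FreeN n x) (hm : m ≤ n) : Φ.FreeN m x :=
  fun i hi => h i (hi.trans_le hm)

lemma FreeN.shift {n m : ℕ} {x : ℝ} (h : Φ.FreeN (m + n) x) : Φ.FreeN n (Φ.F^[m] x) := by
  intro i hi
  rw [← Function.iterate_add_apply]
  exact h (i + m) (by omega)

lemma FreeN.sub_int {n : ℕ} {x : ℝ} (h : Φ.FreeN n x) (a : ℤ) : Φ.FreeN n (x - a) := by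
  intro i hi
  rw [Φ.lift.iter_sub, crit_sub_int]
  exact h i hi

/-- A critical-point-free segment is contained in a single lap. -/
lemma exists_lap {a b : ℝ} (hab : a ≤ b) (h : ∀ x ∈ Icc a b, ¬ Φ.Crit x) :
    ∃ m : ℤ, (Φ.e - 1 + m < a ∧ b < Φ.c + m) ∨ (Φ.c + m < a ∧ b < Φ.e + m) :=
  exists_lap_of_ne hab fun x hx a =>
    ⟨fun h0 => h x hx ⟨a, Or.inl h0⟩, fun h0 => h x hx ⟨a, Or.inr h0⟩⟩

lemma length_lt_one {a b : ℝ} (hab : a ≤ b) (h : ∀ x ∈ Icc a b, ¬ Φ.Crit x) : b - a < 1 := by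
  obtain ⟨m, h1 | h1⟩ := exists_lap hab h
  · linarith [h1.1, h1.2, Φ.hce]
  · linarith [h1.1, h1.2, Φ.hed, Φ.hdc]

lemma uIcc_length_lt_one {a b : ℝ} (h : ∀ x ∈ uIcc a b, ¬ Φ.Crit x) : |b - a| < 1 := by
  have := length_lt_one (a := min a b) (b := max a b) min_le_max h
  rwa [max_sub_min_eq_abs] at this

lemma injOn_of_not_crit {a b : ℝ} (h : ∀ x ∈ uIcc a b, ¬ Φ.Crit x) : InjOn Φ.F (uIcc a b) := by
  obtain ⟨m, h1 | h1⟩ := exists_lap (a := min a b) (b := max a b) min_le_max h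
  · intro x hx y hy hxy
    have hx' : x - m ∈ Icc (Φ.e - 1) Φ.c := ⟨by linarith [hx.1], by linarith [hx.2]⟩
    have hy' : y - m ∈ Icc (Φ.e - 1) Φ.c := ⟨by linarith [hy.1], by linarith [hy.2]⟩
    have := Φ.mono.injOn hx' hy' (by rw [Φ.lift.sub_int, Φ.lift.sub_int, hxy])
    linarith
  · intro x hx y hy hxy
    have hx' : x - m ∈ Icc Φ.c Φ.e := ⟨by linarith [hx.1], by linarith [hx.2]⟩
    have hy' : y - m ∈ Icc Φ.c Φ.e := ⟨by linarith [hy.1], by linarith [hy.2]⟩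
    have := Φ.anti.injOn hx' hy' (by rw [Φ.lift.sub_int, Φ.lift.sub_int, hxy])
    linarith

end FoldMap

lemma ContinuousOn.strictMonoOn_or_strictAntiOn_uIcc {f : ℝ → ℝ} {a b : ℝ}
    (hf : ContinuousOn f (uIcc a b)) (hi : InjOn f (uIcc a b)) :
    StrictMonoOn f (uIcc a b) ∨ StrictAntiOn f (uIcc a b) :=
  ContinuousOn.strictMonoOn_of_injOn_Icc' min_le_max hf hi

lemma ContinuousOn.image_uIcc_of_injOn {f : ℝ → ℝ} {a b : ℝ}
    (hf : ContinuousOn f (uIcc a b)) (hi : InjOn f (uIcc a b)) :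
    f '' uIcc a b = uIcc (f a) (f b) := by
  refine Subset.antisymm ?_ (intermediate_value_uIcc hf)
  rcases hf.strictMonoOn_or_strictAntiOn_uIcc hi with h | h
  · exact h.monotoneOn.image_uIcc_subset
  · exact h.antitoneOn.image_uIcc_subset

namespace FoldMap
variable {Φ : FoldMap}

lemma iter_injOn_and_image {n : ℕ} {x y : ℝ} (h : ∀ z ∈ uIcc x y, Φ.FreeN n z) :
    InjOn Φ.F^[n] (uIcc x y) ∧ Φ.F^[n] '' uIcc x y = uIcc (Φ.F^[n] x) (Φ.F^[n] y) := by
  suffices hinj : InjOn Φ.F^[n] (uIcc x y) from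
    ⟨hinj, (cont_iter n).continuousOn.image_uIcc_of_injOn hinj⟩
  induction n with
  | zero => exact injOn_id _
  | succ k ih =>
    have hk := ih fun z hz => (h z hz).mono (Nat.le_succ k)
    have himg := (cont_iter (Φ := Φ) k).continuousOn.image_uIcc_of_injOn hk
    rw [Function.iterate_succ']
    refine InjOn.comp (t := uIcc (Φ.F^[k] x) (Φ.F^[k] y)) (injOn_of_not_crit ?_) hk ?_
    · rw [← himg]
      rintro _ ⟨z, hz, rfl⟩
      exact h z hz k (Nat.lt_succ_self k)
    · rw [← himg]; exact mapsTo_image _ _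

lemma iter_injOn {n : ℕ} {x y : ℝ} (h : ∀ z ∈ uIcc x y, Φ.FreeN n z) :
    InjOn Φ.F^[n] (uIcc x y) := (iter_injOn_and_image h).1

lemma iter_image {n : ℕ} {x y : ℝ} (h : ∀ z ∈ uIcc x y, Φ.FreeN n z) :
    Φ.F^[n] '' uIcc x y = uIcc (Φ.F^[n] x) (Φ.F^[n] y) := (iter_injOn_and_image h).2

/-! ### Koebe principle -/

/-- Four points in increasing or in decreasing order. -/
def Ordered (x₁ x₂ x₃ x₄ : ℝ) : Prop :=
  (x₁ < x₂ ∧ x₂ < x₃ ∧ x₃ < x₄) ∨ (x₄ < x₃ ∧ x₃ < x₂ ∧ x₂ < x₁)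

lemma Ordered.image {f : ℝ → ℝ} {x₁ x₂ x₃ x₄ : ℝ} (h : Ordered x₁ x₂ x₃ x₄)
    (hf : ContinuousOn f (uIcc x₁ x₄)) (hi : InjOn f (uIcc x₁ x₄)) :
    Ordered (f x₁) (f x₂) (f x₃) (f x₄) := by
  have m1 : x₁ ∈ uIcc x₁ x₄ := left_mem_uIcc
  have m4 : x₄ ∈ uIcc x₁ x₄ := right_mem_uIcc
  have m2 : x₂ ∈ uIcc x₁ x₄ := by
    rcases h with ⟨h1, h2, h3⟩ | ⟨h1, h2, h3⟩
    · exact mem_uIcc_of_le h1.le (by linarith)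
    · exact mem_uIcc_of_ge (by linarith) (by linarith)
  have m3 : x₃ ∈ uIcc x₁ x₄ := by
    rcases h with ⟨h1, h2, h3⟩ | ⟨h1, h2, h3⟩
    · exact mem_uIcc_of_le (by linarith) (by linarith)
    · exact mem_uIcc_of_ge (by linarith) (by linarith)
  rcases hf.strictMonoOn_or_strictAntiOn_uIcc hi with hm | hm <;>
    rcases h with ⟨h1, h2, h3⟩ | ⟨h1, h2, h3⟩
  · exact Or.inl ⟨hm m1 m2 h1, hm m2 m3 h2, hm m3 m4 h3⟩
  · exact Or.inr ⟨hm m4 m3 h1, hm m3 m2 h2, hm m2 m1 h3⟩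
  · exact Or.inr ⟨hm m3 m4 h3, hm m2 m3 h2, hm m1 m2 h1⟩
  · exact Or.inl ⟨hm m2 m1 h3, hm m3 m2 h2, hm m4 m3 h1⟩

lemma cross_ordered {x₁ x₂ x₃ x₄ : ℝ} (h : Ordered x₁ x₂ x₃ x₄)
    (hc : ∀ x ∈ uIcc x₁ x₄, ¬ Φ.Crit x) :
    Real.exp (-(Φ.K * |x₄ - x₁|)) * crossX |x₂ - x₁| |x₃ - x₂| |x₄ - x₃| ≤
      crossX |Φ.F x₂ - Φ.F x₁| |Φ.F x₃ - Φ.F x₂| |Φ.F x₄ - Φ.F x₃| := by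
  have hc' : ∀ x ∈ uIcc x₁ x₄, ∀ a : ℤ, x ≠ Φ.c + a ∧ x ≠ Φ.e + a := fun x hx a =>
    ⟨fun h0 => hc x hx ⟨a, Or.inl h0⟩, fun h0 => hc x hx ⟨a, Or.inr h0⟩⟩
  rcases h with ⟨h1, h2, h3⟩ | ⟨h1, h2, h3⟩
  · rw [uIcc_of_le (by linarith)] at hc'
    rw [abs_of_pos (sub_pos.2 h1), abs_of_pos (sub_pos.2 h2), abs_of_pos (sub_pos.2 h3),
      abs_of_pos (by linarith : 0 < x₄ - x₁)]
    exact Φ.cross _ _ _ _ h1 h2 h3 hc'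
  · rw [uIcc_of_ge (by linarith)] at hc'
    have := Φ.cross _ _ _ _ h1 h2 h3 hc'
    rw [abs_of_neg (sub_neg.2 h1), abs_of_neg (sub_neg.2 h2), abs_of_neg (sub_neg.2 h3),
      abs_of_neg (by linarith : x₄ - x₁ < 0), crossX_comm, crossX_comm |Φ.F x₂ - Φ.F x₁|,
      abs_sub_comm (Φ.F x₂), abs_sub_comm (Φ.F x₃), abs_sub_comm (Φ.F x₄)]
    convert this using 2 <;> ring_nf

lemma cross_iterate {x₁ x₂ x₃ x₄ : ℝ} (h : Ordered x₁ x₂ x₃ x₄) {n : ℕ}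
    (hfree : ∀ x ∈ uIcc x₁ x₄, Φ.FreeN n x) :
    Real.exp (-(Φ.K * ∑ i ∈ Finset.range n, |Φ.F^[i] x₄ - Φ.F^[i] x₁|)) *
        crossX |x₂ - x₁| |x₃ - x₂| |x₄ - x₃| ≤
      crossX |Φ.F^[n] x₂ - Φ.F^[n] x₁| |Φ.F^[n] x₃ - Φ.F^[n] x₂| |Φ.F^[n] x₄ - Φ.F^[n] x₃| := by
  induction n with
  | zero => simp
  | succ k ih =>
    have hk : ∀ x ∈ uIcc x₁ x₄, Φ.FreeN k x := fun x hx => (hfree x hx).mono (Nat.le_succ k)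
    have h1 := ih hk
    have hord := h.image (cont_iter k).continuousOn (iter_injOn hk)
    have h2 := cross_ordered hord (by
      rw [← iter_image hk]
      rintro _ ⟨z, hz, rfl⟩
      exact hfree z hz k (Nat.lt_succ_self k))
    simp only [Function.iterate_succ_apply']
    refine le_trans ?_ h2
    rw [Finset.sum_range_succ]
    have h3 := mul_le_mul_of_nonneg_left h1
      (Real.exp_pos (-(Φ.K * |Φ.F^[k] x₄ - Φ.F^[k] x₁|))).le
    refine le_trans (le_of_eq ?_) h3
    rw [← mul_assoc, ← Real.exp_add]
    congr 2; ring

/-- Koebe constant for total length `S` and relative space `τ`. -/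
def koebe (Φ : FoldMap) (S τ : ℝ) : ℝ := Real.exp (Φ.K * S) * ((1 + 1 / τ) ^ 2 - 1)

lemma koebe_pos {S τ : ℝ} (hτ : 0 < τ) : 0 < Φ.koebe S τ := by
  unfold koebe
  have : 0 < 1 / τ := by positivity
  have : 0 < (1 + 1 / τ) ^ 2 - 1 := by nlinarith
  positivity

lemma koebe_space {x₁ x₂ x₃ x₄ : ℝ} (h : Ordered x₁ x₂ x₃ x₄) {n : ℕ} {S τ : ℝ} (hτ : 0 < τ)
    (hfree : ∀ x ∈ uIcc x₁ x₄, Φ.FreeN n x)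
    (hS : ∑ i ∈ Finset.range n, |Φ.F^[i] x₄ - Φ.F^[i] x₁| ≤ S)
    (hl : τ * |Φ.F^[n] x₃ - Φ.F^[n] x₂| ≤ |Φ.F^[n] x₂ - Φ.F^[n] x₁|)
    (hr : τ * |Φ.F^[n] x₃ - Φ.F^[n] x₂| ≤ |Φ.F^[n] x₄ - Φ.F^[n] x₃|) :
    |x₃ - x₂| / Φ.koebe S τ ≤ |x₂ - x₁| ∧ |x₃ - x₂| / Φ.koebe S τ ≤ |x₄ - x₃| := by
  have hpos : ∀ {y₁ y₂ y₃ y₄ : ℝ}, Ordered y₁ y₂ y₃ y₄ →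
      0 < |y₂ - y₁| ∧ 0 < |y₃ - y₂| ∧ 0 < |y₄ - y₃| := by
    rintro y₁ y₂ y₃ y₄ (⟨h1, h2, h3⟩ | ⟨h1, h2, h3⟩) <;>
    exact ⟨abs_pos.2 (by linarith), abs_pos.2 (by linarith), abs_pos.2 (by linarith)⟩
  have hX := cross_iterate h hfree
  have hord := h.image (cont_iter n).continuousOn (iter_injOn hfree)
  obtain ⟨p1, p2, p3⟩ := hpos h
  obtain ⟨q1, q2, q3⟩ := hpos hord
  have expand : ∀ l m r : ℝ, 0 < l → 0 < r → crossX l m r = (1 + m / l) * (1 + m / r) - 1 := by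
    intro l m r hl hr
    unfold crossX; field_simp; ring
  rw [expand _ _ _ q1 q3] at hX
  have hb : ∀ l : ℝ, 0 < l → τ * |Φ.F^[n] x₃ - Φ.F^[n] x₂| ≤ l →
      |Φ.F^[n] x₃ - Φ.F^[n] x₂| / l ≤ 1 / τ := by
    intro l hl h0
    rw [div_le_div_iff₀ hl hτ]; linarith
  have hX2 := mul_le_mul (add_le_add_right (hb _ q1 hl) 1) (add_le_add_right (hb _ q3 hr) 1)
    (by positivity) (by positivity)
  have hX3 : crossX |x₂ - x₁| |x₃ - x₂| |x₄ - x₃| ≤ Φ.koebe S τ := by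
    have e1 : Real.exp (-(Φ.K * S)) * crossX |x₂ - x₁| |x₃ - x₂| |x₄ - x₃| ≤
        (1 + 1 / τ) ^ 2 - 1 := by
      refine le_trans (mul_le_mul_of_nonneg_right (Real.exp_le_exp.2
        (neg_le_neg (mul_le_mul_of_nonneg_left hS Φ.K_nonneg))) ?_) (hX.trans ?_)
      · unfold crossX; positivity
      · rw [sq]; linarith
    unfold koebe
    rw [Real.exp_neg, inv_mul_le_iff₀ (Real.exp_pos _)] at e1
    exact e1
  rw [expand _ _ _ p1 p3] at hX3
  have hk := koebe_pos (Φ := Φ) (S := S) hτ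
  have r1 : 0 < |x₃ - x₂| / |x₂ - x₁| := by positivity
  have r2 : 0 < |x₃ - x₂| / |x₄ - x₃| := by positivity
  have r3 := mul_pos r1 r2
  constructor
  · rw [div_le_comm₀ hk p1]; nlinarith
  · rw [div_le_comm₀ hk p3]; nlinarith

end FoldMap

namespace FoldMap
variable {Φ : FoldMap}

/-! ### Heights above the plateau -/

lemma lt_height {x : ℝ} (hx : x ∈ Ioo Φ.d Φ.e) : Φ.F Φ.e < Φ.F x := by
  have h1 := Φ.hed
  have h2 := Φ.hdc
  have h3 := Φ.hce
  rcases le_total x Φ.c with h | h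
  · rw [← Φ.hde]
    exact Φ.mono ⟨h1.le, h2.le⟩ ⟨by linarith [hx.1], h⟩ hx.1
  · exact Φ.anti ⟨h, hx.2.le⟩ ⟨h3.le, le_rfl⟩ hx.2

lemma height_le {x : ℝ} (hx : x ∈ Icc (Φ.e - 1) Φ.e) : Φ.F x ≤ Φ.F Φ.c := by
  have h1 := Φ.hed
  have h2 := Φ.hdc
  have h3 := Φ.hce
  rcases le_total x Φ.c with h | h
  · exact Φ.mono.monotoneOn ⟨hx.1, h⟩ ⟨by linarith, le_rfl⟩ h
  · exact Φ.anti.antitoneOn ⟨le_rfl, h3.le⟩ ⟨h, hx.2⟩ h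

lemma height_lt {x : ℝ} (hx : x ∈ Icc (Φ.e - 1) Φ.e) (hxc : x ≠ Φ.c) : Φ.F x < Φ.F Φ.c := by
  have h1 := Φ.hed
  have h2 := Φ.hdc
  have h3 := Φ.hce
  rcases lt_or_gt_of_ne hxc with h | h
  · exact Φ.mono ⟨hx.1, h.le⟩ ⟨by linarith, le_rfl⟩ h
  · exact Φ.anti ⟨le_rfl, h3.le⟩ ⟨h.le, hx.2⟩ h

lemma height_le_of_notMem {x : ℝ} (hx : x ∈ Ioo (Φ.e - 1) Φ.e) (hx' : x ∉ Ioo Φ.d Φ.e) :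
    Φ.F x ≤ Φ.F Φ.e := by
  have h1 := Φ.hed
  have h2 := Φ.hdc
  have h : x ≤ Φ.d := not_lt.1 fun h => hx' ⟨h, hx.2⟩
  rw [← Φ.hde]
  exact Φ.mono.monotoneOn ⟨hx.1.le, by linarith⟩ ⟨h1.le, h2.le⟩ h

lemma exists_superlevel {y : ℝ} (h1 : Φ.F Φ.e < y) (h2 : y < Φ.F Φ.c) :
    ∃ x₁ ∈ Ioo Φ.d Φ.c, ∃ x₂ ∈ Ioo Φ.c Φ.e, Φ.F x₁ = y ∧ Φ.F x₂ = y ∧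
      ∀ x ∈ Ioo Φ.d Φ.e, (y ≤ Φ.F x ↔ x ∈ Icc x₁ x₂) := by
  have h3 := Φ.hed
  have h4 := Φ.hdc
  have h5 := Φ.hce
  obtain ⟨x₁, m1, e1⟩ := intermediate_value_Ioo h4.le Φ.cont.continuousOn
    (show y ∈ Ioo (Φ.F Φ.d) (Φ.F Φ.c) from ⟨by rw [Φ.hde]; exact h1, h2⟩)
  obtain ⟨x₂, m2, e2⟩ := intermediate_value_Ioo' h5.le Φ.cont.continuousOn
    (show y ∈ Ioo (Φ.F Φ.e) (Φ.F Φ.c) from ⟨h1, h2⟩)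
  refine ⟨x₁, m1, x₂, m2, e1, e2, fun x hx => ?_⟩
  have k1 : x₁ ∈ Icc (Φ.e - 1) Φ.c := ⟨by linarith [m1.1], m1.2.le⟩
  have k2 : x₂ ∈ Icc Φ.c Φ.e := ⟨m2.1.le, m2.2.le⟩
  rcases le_total x Φ.c with h | h
  · have kx : x ∈ Icc (Φ.e - 1) Φ.c := ⟨by linarith [hx.1], h⟩
    rw [← e1, Φ.mono.le_iff_le k1 kx]
    exact ⟨fun h0 => ⟨h0, by linarith [m2.1]⟩, fun h0 => h0.1⟩
  · have kx : x ∈ Icc Φ.c Φ.e := ⟨h, hx.2.le⟩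
    rw [← e2, Φ.anti.le_iff_ge k2 kx]
    exact ⟨fun h0 => ⟨by linarith [m1.2], h0⟩, fun h0 => h0.2⟩

lemma int_eq_of_mem {x : ℝ} {a b : ℤ} (ha : x - a ∈ Ioo (Φ.e - 1) Φ.e)
    (hb : x - b ∈ Ioo (Φ.e - 1) Φ.e) : a = b := by
  have h1 : (a : ℝ) < b + 1 := by linarith [ha.1, hb.2]
  have h2 : (b : ℝ) < a + 1 := by linarith [hb.1, ha.2]
  have h1' : a < b + 1 := by exact_mod_cast h1
  have h2' : b < a + 1 := by exact_mod_cast h2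
  omega

lemma mem_big {x : ℝ} (hx : x ∈ Ioo Φ.d Φ.e) : x ∈ Ioo (Φ.e - 1) Φ.e :=
  ⟨Φ.hed.trans hx.1, hx.2⟩

/-! ### Wandering segments and their records -/

/-- A segment whose images avoid the critical points, are pairwise disjoint modulo integers and
accumulate at `c`. -/
structure Wandering (Φ : FoldMap) (α β : ℝ) : Prop where
  lt : α < β
  free : ∀ x ∈ Icc α β, ∀ i, ¬ Φ.Crit (Φ.F^[i] x)
  disj : ∀ i j, ∀ x ∈ Icc α β, ∀ y ∈ Icc α β, ∀ a : ℤ, Φ.F^[i] x + a = Φ.F^[j] y → i = j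
  acc : ∀ y < Φ.F Φ.c, ∀ N, ∃ i ≥ N, ∃ x ∈ Icc α β, ∃ b : ℤ,
    Φ.F^[i] x - b ∈ Ioo Φ.d Φ.e ∧ y < Φ.F (Φ.F^[i] x - b)

/-- The data of a record: a time `n`, an integer translation `a`, and the lowest and highest
heights `y`, `z` of the segment at that time. -/
structure RecData where
  n : ℕ
  a : ℤ
  y : ℝ
  z : ℝ

/-- At time `r.n` the segment is closer to `c` than at any earlier time. -/
structure IsRec (Φ : FoldMap) (α β : ℝ) (r : RecData) : Prop where
  sub : ∀ x ∈ Icc α β, Φ.F^[r.n] x - r.a ∈ Ioo Φ.d Φ.e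
  img : ∀ x ∈ Icc α β, Φ.F (Φ.F^[r.n] x - r.a) ∈ Icc r.y r.z
  att : ∀ h ∈ Icc r.y r.z, ∃ x ∈ Icc α β, Φ.F (Φ.F^[r.n] x - r.a) = h
  far : ∀ i < r.n, ∀ b : ℤ, ∀ x ∈ Icc α β, Φ.F^[i] x - b ∈ Ioo Φ.d Φ.e →
    Φ.F (Φ.F^[i] x - b) < r.y

/-- `s` is the first record after `r`. -/
structure IsNext (Φ : FoldMap) (α β : ℝ) (r s : RecData) : Prop where
  left : IsRec Φ α β r
  right : IsRec Φ α β s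
  lt : r.n < s.n
  height_lt : r.z < s.y
  gap : ∀ i < s.n, i ≠ r.n → ∀ b : ℤ, ∀ x ∈ Icc α β, Φ.F^[i] x - b ∈ Ioo Φ.d Φ.e →
    Φ.F (Φ.F^[i] x - b) < r.y

variable {α β : ℝ}

lemma F_iter_sub (n : ℕ) (a : ℤ) (x : ℝ) : Φ.F (Φ.F^[n] x - a) = Φ.F^[n + 1] x - a := by
  rw [Φ.lift.sub_int, Function.iterate_succ_apply']

namespace Wandering

lemma freeN (w : Wandering Φ α β) {x : ℝ} (hx : x ∈ Icc α β) (n : ℕ) : Φ.FreeN n x :=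
  fun i _ => w.free x hx i

lemma uIcc_eq (w : Wandering Φ α β) : uIcc α β = Icc α β := uIcc_of_le w.lt.le

lemma image (w : Wandering Φ α β) (n : ℕ) :
    Φ.F^[n] '' Icc α β = uIcc (Φ.F^[n] α) (Φ.F^[n] β) := by
  rw [← w.uIcc_eq]
  refine iter_image fun z hz => ?_
  rw [w.uIcc_eq] at hz
  exact w.freeN hz n

lemma ordConnected (w : Wandering Φ α β) (n : ℕ) : OrdConnected (Φ.F^[n] '' Icc α β) := by
  rw [w.image]; exact ordConnected_uIcc

lemma disj_sub (w : Wandering Φ α β) {i j : ℕ} {x y : ℝ} (hx : x ∈ Icc α β) (hy : y ∈ Icc α β)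
    {a b : ℤ} (h : Φ.F^[i] x - a = Φ.F^[j] y - b) : i = j := by
  refine w.disj i j x hx y hy (b - a) ?_
  push_cast; linarith

lemma disj_height (w : Wandering Φ α β) {i j : ℕ} {x y : ℝ} (hx : x ∈ Icc α β)
    (hy : y ∈ Icc α β) {a b : ℤ} (h : Φ.F (Φ.F^[i] x - a) = Φ.F (Φ.F^[j] y - b)) : i = j := by
  rw [F_iter_sub, F_iter_sub] at h
  have := w.disj_sub hx hy h
  omega

lemma left_mem (w : Wandering Φ α β) : α ∈ Icc α β := ⟨le_rfl, w.lt.le⟩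

lemma right_mem (w : Wandering Φ α β) : β ∈ Icc α β := ⟨w.lt.le, le_rfl⟩

lemma height_connected (w : Wandering Φ α β) {n : ℕ} {a : ℤ} {x y h : ℝ} (hx : x ∈ Icc α β)
    (hy : y ∈ Icc α β) (h1 : Φ.F (Φ.F^[n] x - a) ≤ h) (h2 : h ≤ Φ.F (Φ.F^[n] y - a)) :
    ∃ z ∈ Icc α β, Φ.F (Φ.F^[n] z - a) = h := by
  have hc := (w.ordConnected (n + 1)).out (mem_image_of_mem _ hx) (mem_image_of_mem _ hy)
  rw [F_iter_sub] at h1 h2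
  obtain ⟨z, hz, e⟩ := hc (show h + a ∈ _ from ⟨by linarith, by linarith⟩)
  exact ⟨z, hz, by rw [F_iter_sub, e]; ring⟩

end Wandering

lemma IsRec.pt_ne_c (w : Wandering Φ α β) {i : ℕ} {b : ℤ} {x : ℝ} (hx : x ∈ Icc α β) :
    Φ.F^[i] x - b ≠ Φ.c := fun h => w.free x hx i ⟨b, Or.inl (by linarith)⟩

namespace IsRec
variable {r : RecData}

lemma y_le_z (w : Wandering Φ α β) (h : IsRec Φ α β r) : r.y ≤ r.z :=
  (h.img α w.left_mem).1.trans (h.img α w.left_mem).2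

lemma lt_y (w : Wandering Φ α β) (h : IsRec Φ α β r) : Φ.F Φ.e < r.y := by
  obtain ⟨x, hx, e⟩ := h.att r.y ⟨le_rfl, h.y_le_z w⟩
  rw [← e]; exact lt_height (h.sub x hx)

lemma z_lt (w : Wandering Φ α β) (h : IsRec Φ α β r) : r.z < Φ.F Φ.c := by
  obtain ⟨x, hx, e⟩ := h.att r.z ⟨h.y_le_z w, le_rfl⟩
  rw [← e]
  have := mem_big (h.sub x hx)
  exact height_lt ⟨this.1.le, this.2.le⟩ (pt_ne_c w hx)

lemma y_lt (w : Wandering Φ α β) (h : IsRec Φ α β r) : r.y < Φ.F Φ.c :=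
  (h.y_le_z w).trans_lt (h.z_lt w)

end IsRec

/-- Construction of a record from a time at which the segment is closer than height `y`. -/
lemma exists_isRec_of_first (w : Wandering Φ α β) {n : ℕ} {b : ℤ}
    (hsub : ∀ x ∈ Icc α β, Φ.F^[n] x - b ∈ Ioo Φ.d Φ.e) {y : ℝ}
    (hy : ∃ x ∈ Icc α β, y ≤ Φ.F (Φ.F^[n] x - b))
    (hfar : ∀ i < n, ∀ a : ℤ, ∀ x ∈ Icc α β, Φ.F^[i] x - a ∈ Ioo Φ.d Φ.e →
      Φ.F (Φ.F^[i] x - a) < y) :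
    ∃ r : RecData, r.n = n ∧ r.a = b ∧ IsRec Φ α β r := by
  set u := Φ.F (Φ.F^[n] α - b)
  set v := Φ.F (Φ.F^[n] β - b)
  have himg : ∀ x ∈ Icc α β, Φ.F (Φ.F^[n] x - b) ∈ Icc (min u v) (max u v) := by
    intro x hx
    have h1 : Φ.F^[n + 1] x ∈ uIcc (Φ.F^[n + 1] α) (Φ.F^[n + 1] β) := by
      rw [← w.image]; exact mem_image_of_mem _ hx
    rw [F_iter_sub]
    simp only [u, v, F_iter_sub]
    rw [min_sub_sub_right, max_sub_sub_right]
    exact ⟨by linarith [h1.1], by linarith [h1.2]⟩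
  have hatt : ∀ h ∈ Icc (min u v) (max u v), ∃ x ∈ Icc α β, Φ.F (Φ.F^[n] x - b) = h := by
    intro h hh
    rcases le_total u v with huv | huv
    · rw [min_eq_left huv, max_eq_right huv] at hh
      exact w.height_connected w.left_mem w.right_mem hh.1 hh.2
    · rw [min_eq_right huv, max_eq_left huv] at hh
      exact w.height_connected w.right_mem w.left_mem hh.1 hh.2
  refine ⟨⟨n, b, min u v, max u v⟩, rfl, rfl, hsub, himg, hatt, ?_⟩
  intro i hi a x hx hmem
  by_contra hcon
  obtain ⟨x0, hx0, hyx0⟩ := hy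
  have h1 := hfar i hi a x hx hmem
  have h2 := (himg x0 hx0).2
  obtain ⟨x', hx', e⟩ := hatt (Φ.F (Φ.F^[i] x - a)) ⟨not_lt.1 hcon, by linarith⟩
  have := w.disj_height hx' hx e
  simp only at hi
  omega

lemma exists_isNext (w : Wandering Φ α β) {r : RecData} (hr : IsRec Φ α β r) :
    ∃ s, IsNext Φ α β r s := by
  classical
  have hex : ∃ i, r.n < i ∧ ∃ x ∈ Icc α β, ∃ b : ℤ, Φ.F^[i] x - b ∈ Ioo Φ.d Φ.e ∧
      r.y ≤ Φ.F (Φ.F^[i] x - b) := by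
    obtain ⟨i, hi, x, hx, b, h1, h2⟩ := w.acc r.y (hr.y_lt w) (r.n + 1)
    exact ⟨i, by omega, x, hx, b, h1, h2.le⟩
  set n := Nat.find hex with hn
  obtain ⟨hlt, x0, hx0, b, hm0, hy0⟩ := Nat.find_spec hex
  have hmin : ∀ i, r.n < i → i < n → ∀ a : ℤ, ∀ x ∈ Icc α β, Φ.F^[i] x - a ∈ Ioo Φ.d Φ.e →
      Φ.F (Φ.F^[i] x - a) < r.y := by
    intro i h1 h2 a x hx hmem
    by_contra hcon
    exact Nat.find_min hex h2 ⟨h1, x, hx, a, hmem, not_lt.1 hcon⟩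
  rw [← hn] at hlt hm0 hy0
  obtain ⟨x₁, m1, x₂, m2, e1, e2, hU⟩ := exists_superlevel (hr.lt_y w) (hr.y_lt w)
  have hend : ∀ x ∈ Icc α β, Φ.F (Φ.F^[n] x - b) ≠ r.y := by
    intro x hx h0
    obtain ⟨x', hx', e'⟩ := hr.att r.y ⟨le_rfl, hr.y_le_z w⟩
    have := w.disj_height hx hx' (h0.trans e'.symm)
    omega
  have hin : ∀ x ∈ Icc α β, Φ.F^[n] x - b ∈ Icc x₁ x₂ := by
    intro x hx
    have h0 := (hU _ hm0).1 hy0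
    have hoc := (w.ordConnected n)
    constructor
    · by_contra hcon
      obtain ⟨z, hz, e⟩ := hoc.out (mem_image_of_mem _ hx) (mem_image_of_mem _ hx0)
        (show x₁ + b ∈ _ from ⟨by linarith, by linarith [h0.1]⟩)
      exact hend z hz (by rw [e, add_sub_cancel_right, e1])
    · by_contra hcon
      obtain ⟨z, hz, e⟩ := hoc.out (mem_image_of_mem _ hx0) (mem_image_of_mem _ hx)
        (show x₂ + b ∈ _ from ⟨by linarith [h0.2], by linarith⟩)
      exact hend z hz (by rw [e, add_sub_cancel_right, e2])
  have hsub : ∀ x ∈ Icc α β, Φ.F^[n] x - b ∈ Ioo Φ.d Φ.e := fun x hx =>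
    ⟨m1.1.trans_le (hin x hx).1, (hin x hx).2.trans_lt m2.2⟩
  have hgap : ∀ i < n, i ≠ r.n → ∀ b : ℤ, ∀ x ∈ Icc α β, Φ.F^[i] x - b ∈ Ioo Φ.d Φ.e →
      Φ.F (Φ.F^[i] x - b) < r.y := by
    intro i hi hne a x hx hmem
    rcases lt_or_gt_of_ne hne with h | h
    · exact hr.far i h a x hx hmem
    · exact hmin i h hi a x hx hmem
  have hhigh : ∀ x ∈ Icc α β, r.z < Φ.F (Φ.F^[n] x - b) := by
    intro x hx
    have h1 := (hU _ (hsub x hx)).2 (hin x hx)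
    by_contra hcon
    obtain ⟨x', hx', e'⟩ := hr.att _ ⟨h1, not_lt.1 hcon⟩
    have := w.disj_height hx' hx e'
    omega
  have hle : ∀ i < n, ∀ a : ℤ, ∀ x ∈ Icc α β, Φ.F^[i] x - a ∈ Ioo Φ.d Φ.e →
      Φ.F (Φ.F^[i] x - a) ≤ r.z := by
    intro i hi a x hx hmem
    by_cases hir : i = r.n
    · subst hir
      have := int_eq_of_mem (mem_big hmem) (mem_big (hr.sub x hx))
      subst this
      exact (hr.img x hx).2
    · exact (hgap i hi hir a x hx hmem).le.trans (hr.y_le_z w)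
  obtain ⟨s, sn, sa, hs⟩ := exists_isRec_of_first w hsub
    ⟨α, w.left_mem, le_rfl⟩ (fun i hi a x hx hmem =>
      (hle i hi a x hx hmem).trans_lt (hhigh α w.left_mem))
  refine ⟨s, hr, hs, by omega, ?_, ?_⟩
  · obtain ⟨x, hx, e⟩ := hs.att s.y ⟨le_rfl, hs.y_le_z w⟩
    rw [← e, sn, sa]; exact hhigh x hx
  · rw [sn]; exact hgap

/-- The images before time `N` stay below some height. -/
lemma exists_height_bound (w : Wandering Φ α β) (N : ℕ) :
    ∃ y < Φ.F Φ.c, ∀ i < N, ∀ b : ℤ, ∀ x ∈ Icc α β, Φ.F^[i] x - b ∈ Ioo Φ.d Φ.e →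
      Φ.F (Φ.F^[i] x - b) < y := by
  have h3 := Φ.hed
  have h4 := Φ.hdc
  have h5 := Φ.hce
  induction N with
  | zero => exact ⟨Φ.F Φ.c - 1, by linarith, fun i hi => absurd hi (Nat.not_lt_zero i)⟩
  | succ k ih =>
    obtain ⟨y, hy, hyk⟩ := ih
    obtain ⟨y', hy', hk⟩ : ∃ y' < Φ.F Φ.c, ∀ b : ℤ, ∀ x ∈ Icc α β,
        Φ.F^[k] x - b ∈ Ioo Φ.d Φ.e → Φ.F (Φ.F^[k] x - b) ≤ y' := by
      have himg := w.image k
      have hfr : ∀ x ∈ Icc (min (Φ.F^[k] α) (Φ.F^[k] β)) (max (Φ.F^[k] α) (Φ.F^[k] β)),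
          ¬ Φ.Crit x := by
        intro x hx
        change x ∈ uIcc _ _ at hx
        rw [← himg] at hx
        obtain ⟨z, hz, rfl⟩ := hx
        exact w.free z hz k
      set A := min (Φ.F^[k] α) (Φ.F^[k] β)
      set B := max (Φ.F^[k] α) (Φ.F^[k] β)
      have hAB : A ≤ B := min_le_max
      have hmemAB : ∀ x ∈ Icc α β, Φ.F^[k] x ∈ Icc A B := fun x hx => by
        change _ ∈ uIcc _ _; rw [← himg]; exact mem_image_of_mem _ hx
      obtain ⟨m, hm | hm⟩ := exists_lap hAB hfr
      · refine ⟨Φ.F (B - m), Φ.mono ⟨by linarith, by linarith⟩ ⟨by linarith, le_rfl⟩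
          (by linarith), fun b x hx hmem => ?_⟩
        have hk := hmemAB x hx
        have : b = m := int_eq_of_mem (mem_big hmem) ⟨by linarith [hk.1], by linarith [hk.2]⟩
        subst this
        exact Φ.mono.monotoneOn ⟨by linarith [hk.1], by linarith [hk.2]⟩
          ⟨by linarith, by linarith⟩ (by linarith [hk.2])
      · refine ⟨Φ.F (A - m), Φ.anti ⟨le_rfl, h5.le⟩ ⟨by linarith, by linarith⟩
          (by linarith), fun b x hx hmem => ?_⟩
        have hk := hmemAB x hx
        have : b = m := int_eq_of_mem (mem_big hmem) ⟨by linarith [hk.1], by linarith [hk.2]⟩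
        subst this
        exact Φ.anti.antitoneOn ⟨by linarith, by linarith⟩
          ⟨by linarith [hk.1], by linarith [hk.2]⟩ (by linarith [hk.1])
    refine ⟨max y ((y' + Φ.F Φ.c) / 2), max_lt hy (by linarith), fun i hi b x hx hmem => ?_⟩
    rcases Nat.lt_succ_iff_lt_or_eq.1 hi with h | rfl
    · exact lt_max_of_lt_left (hyk i h b x hx hmem)
    · exact lt_max_of_lt_right (by linarith [hk b x hx hmem])

/-- There are records closer to `c` than any prescribed height and time. -/
lemma exists_isRec (w : Wandering Φ α β) (y₀ : ℝ) (hy₀ : y₀ < Φ.F Φ.c) (N : ℕ) :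
    ∃ r, IsRec Φ α β r ∧ N ≤ r.n ∧ y₀ < r.y := by
  classical
  -- At most one image contains a translate of `d`.
  obtain ⟨N₁, hN₁⟩ : ∃ N₁, ∀ i ≥ N₁, ∀ x ∈ Icc α β, ∀ b : ℤ, Φ.F^[i] x - b ≠ Φ.d := by
    by_cases h : ∃ i, ∃ x ∈ Icc α β, ∃ b : ℤ, Φ.F^[i] x - b = Φ.d
    · obtain ⟨i, x, hx, b, e⟩ := h
      refine ⟨i + 1, fun j hj x' hx' b' e' => ?_⟩
      have := w.disj_sub hx hx' (e.trans e'.symm)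
      omega
    · push Not at h
      exact ⟨0, fun i _ x hx b => h i x hx b⟩
  obtain ⟨y₁, hy₁, hb⟩ := exists_height_bound w (max N₁ N)
  set y := max y₀ y₁ with hy
  have hyc : y < Φ.F Φ.c := max_lt hy₀ hy₁
  have hex : ∃ i, ∃ x ∈ Icc α β, ∃ b : ℤ, Φ.F^[i] x - b ∈ Ioo Φ.d Φ.e ∧
      y < Φ.F (Φ.F^[i] x - b) := by
    obtain ⟨i, hi, h⟩ := w.acc y hyc 0
    exact ⟨i, h⟩
  obtain ⟨x0, hx0, b, hm0, hy0⟩ := Nat.find_spec hex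
  set n := Nat.find hex with hn
  have hnN : max N₁ N ≤ n := by
    by_contra hcon
    have := hb n (not_le.1 hcon) b x0 hx0 hm0
    have := le_max_right y₀ y₁
    linarith
  have hsub : ∀ x ∈ Icc α β, Φ.F^[n] x - b ∈ Ioo Φ.d Φ.e := by
    intro x hx
    have hoc := w.ordConnected n
    constructor
    · by_contra hcon
      obtain ⟨z, hz, e⟩ := hoc.out (mem_image_of_mem _ hx) (mem_image_of_mem _ hx0)
        (show Φ.d + b ∈ _ from ⟨by linarith, by linarith [hm0.1]⟩)
      exact hN₁ n ((le_max_left _ _).trans hnN) z hz b (by rw [e]; ring)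
    · by_contra hcon
      obtain ⟨z, hz, e⟩ := hoc.out (mem_image_of_mem _ hx0) (mem_image_of_mem _ hx)
        (show Φ.e + b ∈ _ from ⟨by linarith [hm0.2], by linarith⟩)
      exact w.free z hz n ⟨b, Or.inr e⟩
  have hfar : ∀ i < n, ∀ a : ℤ, ∀ x ∈ Icc α β, Φ.F^[i] x - a ∈ Ioo Φ.d Φ.e →
      Φ.F (Φ.F^[i] x - a) < Φ.F (Φ.F^[n] x0 - b) := by
    intro i hi a x hx hmem
    refine lt_of_le_of_lt ?_ hy0
    by_contra hcon
    exact Nat.find_min hex hi ⟨x, hx, a, hmem, not_le.1 hcon⟩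
  obtain ⟨r, rn, ra, hr⟩ := exists_isRec_of_first w hsub ⟨x0, hx0, le_rfl⟩ hfar
  obtain ⟨s, hs⟩ := exists_isNext w hr
  refine ⟨s, hs.right, ?_, ?_⟩
  · have := hs.lt
    have := (le_max_right N₁ N).trans hnN
    omega
  · have h1 := (hr.img x0 hx0).2
    rw [rn, ra] at h1
    have h2 := le_max_left y₀ y₁
    linarith [hs.height_lt]

end FoldMap

namespace FoldMap
variable {Φ : FoldMap} {α β : ℝ}

/-! ### Pulling back superlevel sets -/

/-- The set of points of `(d, e)` of height at least `y` is `[x₁, x₂]`. -/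
structure IsSuper (Φ : FoldMap) (y x₁ x₂ : ℝ) : Prop where
  left : x₁ ∈ Ioo Φ.d Φ.c
  right : x₂ ∈ Ioo Φ.c Φ.e
  hleft : Φ.F x₁ = y
  hright : Φ.F x₂ = y
  iff : ∀ x ∈ Ioo Φ.d Φ.e, (y ≤ Φ.F x ↔ x ∈ Icc x₁ x₂)

lemma exists_isSuper {y : ℝ} (h1 : Φ.F Φ.e < y) (h2 : y < Φ.F Φ.c) :
    ∃ x₁ x₂, IsSuper Φ y x₁ x₂ := by
  obtain ⟨x₁, m1, x₂, m2, e1, e2, h⟩ := exists_superlevel h1 h2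
  exact ⟨x₁, x₂, m1, m2, e1, e2, h⟩

lemma IsSuper.mem_Ioo {y x₁ x₂ x : ℝ} (h : IsSuper Φ y x₁ x₂) (hx : x ∈ Icc x₁ x₂) :
    x ∈ Ioo Φ.d Φ.e := ⟨h.left.1.trans_le hx.1, hx.2.trans_lt h.right.2⟩

lemma IsSuper.le_height {y x₁ x₂ x : ℝ} (h : IsSuper Φ y x₁ x₂) (hx : x ∈ Icc x₁ x₂) :
    y ≤ Φ.F x := (h.iff x (h.mem_Ioo hx)).2 hx

/-- A free segment reaching a translate of `c` comes from the big interval around `c`. -/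
lemma mem_big_of_uIcc {u : ℝ} (h : ∀ x ∈ uIcc u Φ.c, x ≠ Φ.c → ¬ Φ.Crit x) :
    u ∈ Ioo (Φ.e - 1) Φ.e := by
  have h3 := Φ.hed
  have h4 := Φ.hdc
  have h5 := Φ.hce
  constructor
  · by_contra hcon
    refine h (Φ.e - 1) (mem_uIcc_of_le (not_lt.1 hcon) (by linarith)) (by linarith)
      ⟨-1, Or.inr (by push_cast; ring)⟩
  · by_contra hcon
    refine h Φ.e (mem_uIcc_of_ge h5.le (not_lt.1 hcon)) (by linarith)
      ⟨0, Or.inr (by push_cast; ring)⟩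

/-- No iterate maps `[y, F c]` into itself up to translation. -/
lemma not_mapsTo_top {y : ℝ} (hy : y ≤ Φ.F Φ.c) {j : ℕ} (hj : 1 ≤ j) (a : ℤ) :
    ¬ MapsTo (fun x => Φ.F^[j] x - a) (Icc y (Φ.F Φ.c)) (Icc y (Φ.F Φ.c)) := by
  intro h
  have key : ∀ t : ℕ, Φ.F^[t * j] (Φ.F Φ.c) - t * a ∈ Icc y (Φ.F Φ.c) := by
    intro t
    induction t with
    | zero => simpa using hy
    | succ k ih =>
      have h1 := h ih
      have e : Φ.F^[(k + 1) * j] (Φ.F Φ.c) - ((k + 1 : ℕ) : ℝ) * a =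
          Φ.F^[j] (Φ.F^[k * j] (Φ.F Φ.c) - k * a) - a := by
        have e2 := Φ.lift.iter_sub j (Φ.F^[k * j] (Φ.F Φ.c)) (k * a)
        push_cast at e2
        rw [e2, ← Function.iterate_add_apply, show j + k * j = (k + 1) * j by ring]
        push_cast; ring
      rw [e]; exact h1
  obtain ⟨t, ht⟩ := Φ.noRestr j hj a (|y| + |Φ.F Φ.c|)
  have h1 := key t
  have h2 : |Φ.F^[t * j] (Φ.F Φ.c) - t * a| ≤ |y| + |Φ.F Φ.c| := by
    rw [abs_le]
    constructor
    · linarith [h1.1, neg_abs_le y, abs_nonneg (Φ.F Φ.c)]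
    · linarith [h1.2, le_abs_self (Φ.F Φ.c), abs_nonneg y]
  linarith

/-- Earlier images are not higher than the current record. -/
lemma IsNext.height_le {r s : RecData} (w : Wandering Φ α β) (h : IsNext Φ α β r s)
    {i : ℕ} (hi : i < s.n) {b : ℤ} {x : ℝ} (hx : x ∈ Icc α β)
    (hm : Φ.F^[i] x - b ∈ Ioo (Φ.e - 1) Φ.e) :
    Φ.F (Φ.F^[i] x - b) < r.y ∨ (i = r.n ∧ b = r.a) := by
  by_cases hde : Φ.F^[i] x - b ∈ Ioo Φ.d Φ.e
  · by_cases hir : i = r.n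
    · subst hir
      exact Or.inr ⟨rfl, int_eq_of_mem hm (mem_big (h.left.sub x hx))⟩
    · exact Or.inl (h.gap i hi hir b x hx hde)
  · exact Or.inl ((height_le_of_notMem hm hde).trans_lt (h.left.lt_y w))

lemma free_of_closure {r s : RecData} (w : Wandering Φ α β) (h : IsNext Φ α β r s)
    {x₁ x₂ : ℝ} (hU : IsSuper Φ r.y x₁ x₂) {p x : ℝ} (hp : p ∈ Icc α β)
    (hpy : Φ.F (Φ.F^[r.n] p - r.a) = r.y)
    (hW : ∀ z ∈ uIcc p x, Φ.F^[s.n] z ∈ Icc (x₁ + s.a) (x₂ + s.a))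
    (hfree : ∀ z ∈ uIcc p x, z ≠ x → Φ.FreeN s.n z) : Φ.FreeN s.n x := by
  intro i
  induction i using Nat.strong_induction_on with
  | _ i ih =>
  intro hi hcrit
  have hfi : ∀ z ∈ uIcc p x, Φ.FreeN i z := by
    intro z hz
    by_cases hzx : z = x
    · subst hzx; exact fun j hj => ih j hj (hj.trans hi)
    · exact (hfree z hz hzx).mono hi.le
  have hinj := iter_injOn hfi
  have himg := iter_image hfi
  obtain ⟨j, hj⟩ : ∃ j, s.n = j + i := ⟨s.n - i, by omega⟩
  have hj1 : 1 ≤ j := by omega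
  have hWj : ∀ z ∈ uIcc p x, Φ.F^[j] (Φ.F^[i] z) ∈ Icc (x₁ + s.a) (x₂ + s.a) := by
    intro z hz
    rw [← Function.iterate_add_apply, ← hj]
    exact hW z hz
  obtain ⟨b, hb | hb⟩ := hcrit
  · set u := Φ.F^[i] p - b with hu
    have hpre : ∀ v ∈ uIcc u Φ.c, ∃ z ∈ uIcc p x, Φ.F^[i] z = v + b := by
      intro v hv
      have : v + b ∈ Φ.F^[i] '' uIcc p x := by
        rw [himg, hb]
        rw [mem_uIcc] at hv ⊢
        rcases hv with hv | hv
        · exact Or.inl ⟨by linarith [hv.1], by linarith [hv.2]⟩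
        · exact Or.inr ⟨by linarith [hv.1], by linarith [hv.2]⟩
      exact this
    have hub : u ∈ Ioo (Φ.e - 1) Φ.e := by
      refine mem_big_of_uIcc fun v hv hvc hcr => ?_
      obtain ⟨z, hz, hzv⟩ := hpre v hv
      have hzx : z ≠ x := by
        rintro rfl
        exact hvc (by linarith)
      refine hfree z hz hzx i hi ?_
      rw [hzv, crit_add_int]; exact hcr
    have hle : Φ.F u ≤ r.y := by
      rcases h.height_le w hi hp hub with h0 | ⟨rfl, rfl⟩
      · exact h0.le
      · exact hpy.le
    refine not_mapsTo_top (h.left.y_lt w).le hj1 (s.a - b) fun y hy => ?_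
    obtain ⟨v, hv, hvy⟩ := intermediate_value_uIcc (a := u) (b := Φ.c) Φ.cont.continuousOn
      (mem_uIcc_of_le (hle.trans hy.1) hy.2)
    obtain ⟨z, hz, hzv⟩ := hpre v hv
    have h1 := hWj z hz
    have h2 : Φ.F^[j] v - (s.a - b : ℤ) ∈ Icc x₁ x₂ := by
      have e := Φ.lift.iter_add j v b
      rw [hzv, e] at h1
      push_cast
      exact ⟨by linarith [h1.1], by linarith [h1.2]⟩
    have h3 := hU.le_height h2
    have h4 := mem_big (hU.mem_Ioo h2)
    have h5 := FoldMap.height_le ⟨h4.1.le, h4.2.le⟩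
    have e : Φ.F^[j] y - ((s.a - b : ℤ) : ℝ) = Φ.F (Φ.F^[j] v - ((s.a - b : ℤ) : ℝ)) := by
      rw [F_iter_sub, ← hvy, ← Function.iterate_succ_apply]
    change Φ.F^[j] y - ((s.a - b : ℤ) : ℝ) ∈ _
    rw [e]
    exact ⟨h3, h5⟩
  · have h1 := hWj x right_mem_uIcc
    rw [hb, Φ.lift.iter_add] at h1
    refine Φ.e_orbit j hj1 (b - s.a) ?_
    push_cast
    have := hU.left.1
    have := hU.right.2
    exact ⟨by linarith [h1.1], by linarith [h1.2]⟩

/-- Exit from a segment in a prescribed direction `σ`. -/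
lemma exists_exit {n : ℕ} {l u p σ : ℝ} (hσ : σ = 1 ∨ σ = -1) (hlu : u < l + 1)
    (hp : Φ.FreeN n p) (hpW : Φ.F^[n] p ∈ Icc l u)
    (hcl : ∀ x, (∀ z ∈ uIcc p x, Φ.F^[n] z ∈ Icc l u) →
      (∀ z ∈ uIcc p x, z ≠ x → Φ.FreeN n z) → Φ.FreeN n x) :
    ∃ t : ℝ, 0 ≤ t ∧ (∀ z ∈ uIcc p (p + σ * t), Φ.FreeN n z ∧ Φ.F^[n] z ∈ Icc l u) ∧
      (Φ.F^[n] (p + σ * t) = l ∨ Φ.F^[n] (p + σ * t) = u) := by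
  set good : ℝ → Prop := fun q => Φ.FreeN n (p + σ * q) ∧ Φ.F^[n] (p + σ * q) ∈ Icc l u
    with hgood
  have huIcc : ∀ t, 0 ≤ t → ∀ z ∈ uIcc p (p + σ * t), ∃ q ∈ Icc 0 t, z = p + σ * q := by
    intro t ht z hz
    rcases hσ with rfl | rfl
    · rw [uIcc_of_le (by linarith)] at hz
      exact ⟨z - p, ⟨by linarith [hz.1], by linarith [hz.2]⟩, by ring⟩
    · rw [uIcc_of_ge (by linarith)] at hz
      exact ⟨p - z, ⟨by linarith [hz.2], by linarith [hz.1]⟩, by ring⟩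
  set T : Set ℝ := {t | 0 ≤ t ∧ ∀ q ∈ Icc 0 t, good q} with hT
  have hg0 : good 0 := by
    simp only [hgood, mul_zero, add_zero]; exact ⟨hp, hpW⟩
  have h0 : (0 : ℝ) ∈ T := ⟨le_rfl, fun q hq => by
    obtain rfl : q = 0 := le_antisymm hq.2 hq.1
    exact hg0⟩
  have hbdd : BddAbove T := by
    refine ⟨1, fun t ht => ?_⟩
    by_contra hcon
    have h1 := (ht.2 1 ⟨by norm_num, (not_le.1 hcon).le⟩).2
    rcases hσ with rfl | rfl
    · have e := Φ.lift.iter_add n p 1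
      push_cast at e
      rw [one_mul, e] at h1
      linarith [h1.2, hpW.1]
    · have e := Φ.lift.iter_sub n p 1
      push_cast at e
      rw [show p + -1 * 1 = p - 1 by ring, e] at h1
      linarith [h1.1, hpW.2]
  set t := sSup T with ht
  have ht0 : 0 ≤ t := le_csSup hbdd h0
  have hlt : ∀ q, 0 ≤ q → q < t → good q := by
    intro q hq hqt
    obtain ⟨t', ht', hqt'⟩ := exists_lt_of_lt_csSup ⟨0, h0⟩ hqt
    exact ht'.2 q ⟨hq, hqt'.le⟩
  have hcont : Continuous fun q => Φ.F^[n] (p + σ * q) :=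
    (cont_iter n).comp (by fun_prop)
  have hWt : Φ.F^[n] (p + σ * t) ∈ Icc l u := by
    rcases ht0.eq_or_lt with h | h
    · rw [← h]; exact hg0.2
    · have hmem : t ∈ closure (Ico 0 t) := by
        rw [closure_Ico h.ne]; exact ⟨ht0, le_rfl⟩
      exact isClosed_Icc.closure_subset
        (map_mem_closure (f := fun q => Φ.F^[n] (p + σ * q)) hcont hmem
          fun q hq => (hlt q hq.1 hq.2).2)
  have hgt : good t := by
    refine ⟨hcl _ ?_ ?_, hWt⟩
    · intro z hz
      obtain ⟨q, hq, rfl⟩ := huIcc t ht0 z hz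
      rcases hq.2.eq_or_lt with h | h
      · rw [h]; exact hWt
      · exact (hlt q hq.1 h).2
    · intro z hz hne
      obtain ⟨q, hq, rfl⟩ := huIcc t ht0 z hz
      rcases hq.2.eq_or_lt with h | h
      · exact absurd (by rw [h]) hne
      · exact (hlt q hq.1 h).1
  have hall : ∀ q ∈ Icc 0 t, good q := by
    intro q hq
    rcases hq.2.eq_or_lt with h | h
    · rw [h]; exact hgt
    · exact hlt q hq.1 h
  refine ⟨t, ht0, fun z hz => ?_, ?_⟩
  · obtain ⟨q, hq, rfl⟩ := huIcc t ht0 z hz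
    exact hall q hq
  · by_contra hcon
    push Not at hcon
    have hmemIoo : Φ.F^[n] (p + σ * t) ∈ Ioo l u :=
      ⟨lt_of_le_of_ne hWt.1 (Ne.symm hcon.1), lt_of_le_of_ne hWt.2 hcon.2⟩
    have ho : IsOpen {q | Φ.FreeN n (p + σ * q) ∧ Φ.F^[n] (p + σ * q) ∈ Ioo l u} :=
      ((isOpen_freeN n).preimage (by fun_prop : Continuous fun q => p + σ * q)).inter
        (isOpen_Ioo.preimage hcont)
    obtain ⟨ε, hε, hball⟩ := Metric.isOpen_iff.1 ho t ⟨hgt.1, hmemIoo⟩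
    have hmem : t + ε / 2 ∈ T := by
      refine ⟨by linarith, fun q hq => ?_⟩
      rcases le_or_gt q t with h | h
      · exact hall q ⟨hq.1, h⟩
      · have := hball (show q ∈ Metric.ball t ε by
          rw [Metric.mem_ball, Real.dist_eq, abs_of_pos (by linarith)]; linarith [hq.2])
        exact ⟨this.1, Ioo_subset_Icc_self this.2⟩
    linarith [le_csSup hbdd hmem]

/-- The segment extends to one mapped at the next record time onto the superlevel set of the
current record. -/
lemma IsNext.exists_pull {r s : RecData} (w : Wandering Φ α β) (h : IsNext Φ α β r s)
    {x₁ x₂ : ℝ} (hU : IsSuper Φ r.y x₁ x₂) :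
    ∃ a b, a < α ∧ β < b ∧
      (∀ z ∈ Icc a b, Φ.FreeN s.n z ∧ Φ.F^[s.n] z ∈ Icc (x₁ + s.a) (x₂ + s.a)) ∧
      ((Φ.F^[s.n] a = x₁ + s.a ∧ Φ.F^[s.n] b = x₂ + s.a) ∨
        (Φ.F^[s.n] a = x₂ + s.a ∧ Φ.F^[s.n] b = x₁ + s.a)) := by
  have h3 := Φ.hed
  obtain ⟨p, hp, hpy⟩ := h.left.att r.y ⟨le_rfl, h.left.y_le_z w⟩
  have hJ : ∀ x ∈ Icc α β, r.y < Φ.F (Φ.F^[s.n] x - s.a) := fun x hx =>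
    (h.left.y_le_z w).trans_lt (h.height_lt.trans_le (h.right.img x hx).1)
  have hpW : Φ.F^[s.n] p ∈ Icc (x₁ + s.a) (x₂ + s.a) := by
    have := (hU.iff _ (h.right.sub p hp)).1 (hJ p hp).le
    exact ⟨by linarith [this.1], by linarith [this.2]⟩
  have hlen : x₂ + s.a < x₁ + s.a + 1 := by linarith [hU.left.1, hU.right.2]
  have hcl := fun x => free_of_closure (x := x) w h hU hp hpy
  obtain ⟨t, ht0, ht, hte⟩ := exists_exit (σ := -1) (Or.inr rfl) hlen (w.freeN hp _) hpW hcl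
  obtain ⟨v, hv0, hv, hve⟩ := exists_exit (σ := 1) (Or.inl rfl) hlen (w.freeN hp _) hpW hcl
  set a := p + -1 * t with ha
  set b := p + 1 * v with hb
  have hap : a ≤ p := by linarith
  have hpb : p ≤ b := by linarith
  rw [uIcc_of_ge hap] at ht
  rw [uIcc_of_le hpb] at hv
  have hend : ∀ x, (Φ.F^[s.n] x = x₁ + s.a ∨ Φ.F^[s.n] x = x₂ + s.a) → x ∉ Icc α β := by
    intro x hx hxJ
    have := hJ x hxJ
    rcases hx with e | e
    · rw [e, add_sub_cancel_right, hU.hleft] at this; exact lt_irrefl _ this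
    · rw [e, add_sub_cancel_right, hU.hright] at this; exact lt_irrefl _ this
  have haα : a < α := by
    by_contra hcon
    exact hend a hte ⟨not_lt.1 hcon, hap.trans hp.2⟩
  have hbβ : β < b := by
    by_contra hcon
    exact hend b hve ⟨hp.1.trans hpb, not_lt.1 hcon⟩
  have hall : ∀ z ∈ Icc a b, Φ.FreeN s.n z ∧ Φ.F^[s.n] z ∈ Icc (x₁ + s.a) (x₂ + s.a) := by
    intro z hz
    rcases le_total z p with hzp | hzp
    · exact ht z ⟨hz.1, hzp⟩
    · exact hv z ⟨hzp, hz.2⟩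
  have hab : a < b := by linarith [w.lt]
  have hne : Φ.F^[s.n] a ≠ Φ.F^[s.n] b := by
    intro e
    have hinj := iter_injOn (Φ := Φ) (n := s.n) (x := a) (y := b) (by
      rw [uIcc_of_le hab.le]; exact fun z hz => (hall z hz).1)
    exact hab.ne (hinj left_mem_uIcc right_mem_uIcc e)
  refine ⟨a, b, haα, hbβ, hall, ?_⟩
  rcases hte with e1 | e1 <;> rcases hve with e2 | e2
  · exact absurd (e1.trans e2.symm) hne
  · exact Or.inl ⟨e1, e2⟩
  · exact Or.inr ⟨e1, e2⟩
  · exact absurd (e1.trans e2.symm) hne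

end FoldMap

namespace FoldMap
variable {Φ : FoldMap} {α β : ℝ}

/-! ### Radii -/

/-- The points higher than `y` lie in the neighbourhood of `c` where `g` is controlled. -/
def Near (Φ : FoldMap) (y : ℝ) : Prop :=
  ∀ x ∈ Ioo Φ.d Φ.e, y ≤ Φ.F x → x ∈ Ioo (Φ.c - Φ.η) (Φ.c + Φ.η)

lemma Near.mono {y y' : ℝ} (h : Near Φ y) (hy : y ≤ y') : Near Φ y' :=
  fun x hx hx' => h x hx (hy.trans hx')

lemma exists_near : ∃ y, Φ.F Φ.e < y ∧ y < Φ.F Φ.c ∧ Near Φ y := by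
  have h3 := Φ.hed
  have h4 := Φ.hdc
  have h5 := Φ.hce
  have hη := Φ.η_pos
  set u := max ((Φ.d + Φ.c) / 2) (Φ.c - Φ.η / 2) with hu
  set v := min ((Φ.c + Φ.e) / 2) (Φ.c + Φ.η / 2) with hv
  have hu1 : u < Φ.c := max_lt (by linarith) (by linarith)
  have hu2 : Φ.d < u := lt_max_of_lt_left (by linarith)
  have hu3 : Φ.c - Φ.η < u := lt_max_of_lt_right (by linarith)
  have hv1 : Φ.c < v := lt_min (by linarith) (by linarith)
  have hv2 : v < Φ.e := min_lt_of_left_lt (by linarith)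
  have hv3 : v < Φ.c + Φ.η := min_lt_of_right_lt (by linarith)
  refine ⟨max (Φ.F u) (Φ.F v), lt_max_of_lt_left (lt_height ⟨hu2, by linarith⟩),
    max_lt (height_lt ⟨by linarith, by linarith⟩ hu1.ne)
      (height_lt ⟨by linarith, by linarith⟩ hv1.ne'), fun x hx hy => ?_⟩
  have hyu := (le_max_left _ _).trans hy
  have hyv := (le_max_right _ _).trans hy
  rcases le_total x Φ.c with h | h
  · rw [Φ.mono.le_iff_le ⟨by linarith, hu1.le⟩ ⟨by linarith [hx.1], h⟩] at hyu
    exact ⟨by linarith, by linarith⟩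
  · rw [Φ.anti.le_iff_ge ⟨hv1.le, hv2.le⟩ ⟨h, hx.2.le⟩] at hyv
    exact ⟨by linarith, by linarith⟩

/-- The value of `|g|` at height `h`. -/
def rad (Φ : FoldMap) (h : ℝ) : ℝ :=
  sInf {q | ∃ x ∈ Ioo (Φ.c - Φ.η) (Φ.c + Φ.η), Φ.F x = h ∧ q = |Φ.g x|}

lemma rad_eq {x : ℝ} (hx : x ∈ Ioo (Φ.c - Φ.η) (Φ.c + Φ.η)) : rad Φ (Φ.F x) = |Φ.g x| := by
  have : {q | ∃ x' ∈ Ioo (Φ.c - Φ.η) (Φ.c + Φ.η), Φ.F x' = Φ.F x ∧ q = |Φ.g x'|} =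
      {|Φ.g x|} := by
    ext q
    constructor
    · rintro ⟨x', hx', e, rfl⟩
      exact le_antisymm ((Φ.g_height x hx x' hx').1 e.ge) ((Φ.g_height x' hx' x hx).1 e.le)
    · rintro rfl
      exact ⟨x, hx, rfl, rfl⟩
  rw [rad, this, csInf_singleton]

lemma abs_g_sub {x y : ℝ} (hx : x ∈ Ioo (Φ.c - Φ.η) (Φ.c + Φ.η))
    (hy : y ∈ Ioo (Φ.c - Φ.η) (Φ.c + Φ.η)) :
    Φ.k₁ * |x - y| ≤ |Φ.g x - Φ.g y| ∧ |Φ.g x - Φ.g y| ≤ Φ.k₂ * |x - y| := by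
  have hk := Φ.k₁_pos
  rcases le_total x y with h | h
  · obtain ⟨h1, h2⟩ := Φ.g_lip x hx y hy h
    rw [abs_sub_comm x, abs_sub_comm (Φ.g x), abs_of_nonneg (sub_nonneg.2 h),
      abs_of_nonneg (le_trans (mul_nonneg hk.le (sub_nonneg.2 h)) h1)]
    exact ⟨h1, h2⟩
  · obtain ⟨h1, h2⟩ := Φ.g_lip y hy x hx h
    rw [abs_of_nonneg (sub_nonneg.2 h),
      abs_of_nonneg (le_trans (mul_nonneg hk.le (sub_nonneg.2 h)) h1)]
    exact ⟨h1, h2⟩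

lemma c_near : Φ.c ∈ Ioo (Φ.c - Φ.η) (Φ.c + Φ.η) :=
  ⟨by linarith [Φ.η_pos], by linarith [Φ.η_pos]⟩

/-- On each side of `c` the function `g` has constant sign. -/
lemma g_sign {x : ℝ} (hx : x ∈ Ioo (Φ.c - Φ.η) (Φ.c + Φ.η)) {σ : ℝ} (hσ : σ = 1 ∨ σ = -1)
    (h : 0 < σ * (x - Φ.c)) : |Φ.g x| = σ * Φ.g x := by
  have hk := Φ.k₁_pos
  rcases hσ with rfl | rfl
  · have h1 := (Φ.g_lip _ c_near x hx (by linarith)).1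
    rw [Φ.g_c] at h1
    rw [one_mul, abs_of_nonneg]
    nlinarith
  · have h1 := (Φ.g_lip x hx _ c_near (by linarith)).1
    rw [Φ.g_c] at h1
    rw [neg_one_mul, abs_of_nonpos]
    nlinarith

/-- The radial length of a record. -/
def len (Φ : FoldMap) (r : RecData) : ℝ := rad Φ r.y - rad Φ r.z

lemma Wandering.exists_side (w : Wandering Φ α β) (n : ℕ) (a : ℤ) :
    ∃ σ : ℝ, (σ = 1 ∨ σ = -1) ∧ ∀ x ∈ Icc α β, 0 < σ * (Φ.F^[n] x - a - Φ.c) := by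
  by_cases h : Φ.F^[n] α - a < Φ.c
  · refine ⟨-1, Or.inr rfl, fun x hx => ?_⟩
    by_contra hcon
    obtain ⟨z, hz, e⟩ := (w.ordConnected n).out (mem_image_of_mem _ w.left_mem)
      (mem_image_of_mem _ hx) (show Φ.c + a ∈ _ from ⟨by linarith, by linarith⟩)
    exact w.free z hz n ⟨a, Or.inl e⟩
  · refine ⟨1, Or.inl rfl, fun x hx => ?_⟩
    by_contra hcon
    obtain ⟨z, hz, e⟩ := (w.ordConnected n).out (mem_image_of_mem _ hx)
      (mem_image_of_mem _ w.left_mem) (show Φ.c + a ∈ _ from ⟨by linarith, by linarith⟩)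
    exact w.free z hz n ⟨a, Or.inl e⟩

namespace IsRec
variable {r : RecData}

lemma near_pt (hr : IsRec Φ α β r) (hn : Near Φ r.y) {x : ℝ} (hx : x ∈ Icc α β) :
    Φ.F^[r.n] x - r.a ∈ Ioo (Φ.c - Φ.η) (Φ.c + Φ.η) := hn _ (hr.sub x hx) (hr.img x hx).1

lemma rad_le_of_le (hr : IsRec Φ α β r) (hn : Near Φ r.y) {h h' : ℝ}
    (h1 : h ∈ Icc r.y r.z) (h2 : h' ∈ Icc r.y r.z) (hh : h ≤ h') : rad Φ h' ≤ rad Φ h := by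
  obtain ⟨x, hx, rfl⟩ := hr.att h h1
  obtain ⟨x', hx', rfl⟩ := hr.att h' h2
  rw [rad_eq (hr.near_pt hn hx), rad_eq (hr.near_pt hn hx')]
  exact (Φ.g_height _ (hr.near_pt hn hx) _ (hr.near_pt hn hx')).1 hh

lemma abs_g_mem (w : Wandering Φ α β) (hr : IsRec Φ α β r) (hn : Near Φ r.y) {x : ℝ}
    (hx : x ∈ Icc α β) : |Φ.g (Φ.F^[r.n] x - r.a)| ∈ Icc (rad Φ r.z) (rad Φ r.y) := by
  rw [← rad_eq (hr.near_pt hn hx)]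
  have hyz := hr.y_le_z w
  have h := hr.img x hx
  exact ⟨hr.rad_le_of_le hn h ⟨hyz, le_rfl⟩ h.2, hr.rad_le_of_le hn ⟨le_rfl, hyz⟩ h h.1⟩

lemma abs_g_sub_abs (w : Wandering Φ α β) (hr : IsRec Φ α β r) (hn : Near Φ r.y) {x x' : ℝ}
    (hx : x ∈ Icc α β) (hx' : x' ∈ Icc α β) :
    |Φ.g (Φ.F^[r.n] x - r.a) - Φ.g (Φ.F^[r.n] x' - r.a)| =
      |(|Φ.g (Φ.F^[r.n] x - r.a)| - |Φ.g (Φ.F^[r.n] x' - r.a)|)| := by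
  obtain ⟨σ, hσ, hs⟩ := w.exists_side r.n r.a
  rw [g_sign (hr.near_pt hn hx) hσ (hs x hx), g_sign (hr.near_pt hn hx') hσ (hs x' hx'),
    ← mul_sub, abs_mul]
  rcases hσ with rfl | rfl <;> simp

lemma len_le (w : Wandering Φ α β) (hr : IsRec Φ α β r) (hn : Near Φ r.y) :
    len Φ r ≤ Φ.k₂ * |Φ.F^[r.n] β - Φ.F^[r.n] α| := by
  have hk := Φ.k₁_pos.trans_le Φ.k₁_le
  have hyz := hr.y_le_z w
  obtain ⟨x, hx, e⟩ := hr.att r.y ⟨le_rfl, hyz⟩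
  obtain ⟨x', hx', e'⟩ := hr.att r.z ⟨hyz, le_rfl⟩
  have h1 := (abs_g_sub (hr.near_pt hn hx) (hr.near_pt hn hx')).2
  rw [hr.abs_g_sub_abs w hn hx hx', ← rad_eq (hr.near_pt hn hx), ← rad_eq (hr.near_pt hn hx'),
    e, e'] at h1
  refine (le_abs_self _).trans (h1.trans (mul_le_mul_of_nonneg_left ?_ hk.le))
  have m1 : Φ.F^[r.n] x ∈ uIcc (Φ.F^[r.n] α) (Φ.F^[r.n] β) := by
    rw [← w.image]; exact mem_image_of_mem _ hx
  have m2 : Φ.F^[r.n] x' ∈ uIcc (Φ.F^[r.n] α) (Φ.F^[r.n] β) := by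
    rw [← w.image]; exact mem_image_of_mem _ hx'
  rw [sub_sub_sub_cancel_right]
  exact abs_sub_le_of_uIcc_subset_uIcc (uIcc_subset_uIcc m2 m1)

lemma le_len (w : Wandering Φ α β) (hr : IsRec Φ α β r) (hn : Near Φ r.y) :
    Φ.k₁ * |Φ.F^[r.n] β - Φ.F^[r.n] α| ≤ len Φ r := by
  have h1 := (abs_g_sub (hr.near_pt hn w.right_mem) (hr.near_pt hn w.left_mem)).1
  rw [hr.abs_g_sub_abs w hn w.right_mem w.left_mem, sub_sub_sub_cancel_right] at h1
  refine h1.trans ?_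
  have m1 := hr.abs_g_mem w hn w.right_mem
  have m2 := hr.abs_g_mem w hn w.left_mem
  unfold len
  rw [abs_le]
  exact ⟨by linarith [m1.1, m2.2], by linarith [m1.2, m2.1]⟩

lemma rad_z_nonneg (w : Wandering Φ α β) (hr : IsRec Φ α β r) (hn : Near Φ r.y) :
    0 ≤ rad Φ r.z := by
  obtain ⟨x', hx', e'⟩ := hr.att r.z ⟨hr.y_le_z w, le_rfl⟩
  rw [← e', rad_eq (hr.near_pt hn hx')]
  exact abs_nonneg _

lemma len_pos (w : Wandering Φ α β) (hr : IsRec Φ α β r) (hn : Near Φ r.y) : 0 < len Φ r := by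
  refine lt_of_lt_of_le (mul_pos Φ.k₁_pos (abs_pos.2 (sub_ne_zero.2 fun e => ?_)))
    (hr.le_len w hn)
  have hinj := iter_injOn (Φ := Φ) (n := r.n) (x := α) (y := β) (by
    rw [w.uIcc_eq]; exact fun z hz => w.freeN hz _)
  exact w.lt.ne' (hinj right_mem_uIcc left_mem_uIcc e)

end IsRec

lemma IsNext.near_right {r s : RecData} (w : Wandering Φ α β) (h : IsNext Φ α β r s)
    (hn : Near Φ r.y) : Near Φ s.y := hn.mono ((h.left.y_le_z w).trans h.height_lt.le)

lemma IsNext.rad_le {r s : RecData} (w : Wandering Φ α β) (h : IsNext Φ α β r s)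
    (hn : Near Φ r.y) : rad Φ s.y ≤ rad Φ r.z := by
  obtain ⟨x, hx, e⟩ := h.right.att s.y ⟨le_rfl, h.right.y_le_z w⟩
  obtain ⟨x', hx', e'⟩ := h.left.att r.z ⟨h.left.y_le_z w, le_rfl⟩
  have n1 := h.right.near_pt (h.near_right w hn) hx
  have n2 := h.left.near_pt hn hx'
  rw [← e, ← e', rad_eq n1, rad_eq n2]
  refine (Φ.g_height _ n2 _ n1).1 ?_
  rw [e, e']; exact h.height_lt.le

/-! ### Total length of the intermediate images -/

lemma sum_abs_le {a b : ℝ} {n k : ℕ} (hfree : ∀ z ∈ uIcc a b, Φ.FreeN n z)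
    (h : ∀ x : ℝ, ∀ t ⊆ Finset.range n, (∀ i ∈ t, ∃ q : ℤ, x + q ∈ Φ.F^[i] '' uIcc a b) →
      t.card ≤ k) : ∑ i ∈ Finset.range n, |Φ.F^[i] b - Φ.F^[i] a| ≤ k := by
  have himg : ∀ i ∈ Finset.range n, Φ.F^[i] '' uIcc a b = uIcc (Φ.F^[i] a) (Φ.F^[i] b) :=
    fun i hi => iter_image fun z hz => (hfree z hz).mono (Finset.mem_range.1 hi).le
  have := sum_length_le_of_multiplicity (Finset.range n)
    (fun i => min (Φ.F^[i] a) (Φ.F^[i] b)) (fun i => max (Φ.F^[i] a) (Φ.F^[i] b)) k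
    (fun i _ => min_le_max) (fun i hi => ?_) (fun x t ht hx => h x t ht fun i hi => ?_)
  · simpa only [max_sub_min_eq_abs] using this
  · have h1 := uIcc_length_lt_one (Φ := Φ) (a := Φ.F^[i] a) (b := Φ.F^[i] b) (by
      rw [← himg i hi]
      rintro _ ⟨z, hz, rfl⟩
      exact hfree z hz i (Finset.mem_range.1 hi))
    rw [← max_sub_min_eq_abs] at h1
    linarith
  · rw [himg i (ht hi)]; exact hx i hi

/-- The images of the pulled back segment between two records are disjoint. -/
lemma IsNext.pull_disjoint {r s : RecData} (w : Wandering Φ α β) (h : IsNext Φ α β r s)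
    {x₁ x₂ a b : ℝ} (hU : IsSuper Φ r.y x₁ x₂) (ha : a < α) (hb : β < b)
    (hW : ∀ z ∈ Icc a b, Φ.F^[s.n] z ∈ Icc (x₁ + s.a) (x₂ + s.a))
    {i j : ℕ} (hi : r.n ≤ i) (hij : i < j) (hj : j < s.n) {x y : ℝ} (hx : x ∈ Icc a b)
    (hy : y ∈ Icc a b) (q : ℤ) : Φ.F^[i] x + q ≠ Φ.F^[j] y := by
  intro e
  obtain ⟨p, hp, hpy⟩ := h.left.att r.y ⟨le_rfl, h.left.y_le_z w⟩
  have hgap : ∀ k, r.n < k → k < s.n → ∀ q : ℤ, Φ.F^[k] p - q ∉ Icc x₁ x₂ := by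
    intro k h1 h2 q hm
    have := h.gap k h2 h1.ne' q p hp (hU.mem_Ioo hm)
    linarith [hU.le_height hm]
  set k := s.n - (j - i) with hk
  have e1 : Φ.F^[k] x - ((s.a - q : ℤ) : ℝ) ∈ Icc x₁ x₂ := by
    have h1 : Φ.F^[s.n - j] (Φ.F^[i] x + q) = Φ.F^[s.n - j] (Φ.F^[j] y) := by rw [e]
    rw [Φ.lift.iter_add, ← Function.iterate_add_apply, ← Function.iterate_add_apply,
      show s.n - j + i = k by omega, show s.n - j + j = s.n by omega] at h1
    have h2 := hW y hy
    push_cast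
    exact ⟨by linarith [h2.1], by linarith [h2.2]⟩
  have e2 := hgap k (by omega) (by omega) (s.a - q)
  have hpab : p ∈ Icc a b := ⟨by linarith [hp.1], by linarith [hp.2]⟩
  obtain ⟨v, hv, hvy⟩ : ∃ v ∈ Icc a b, Φ.F (Φ.F^[k] v - ((s.a - q : ℤ) : ℝ)) = r.y := by
    have hc : ContinuousOn (fun v => Φ.F^[k] v - ((s.a - q : ℤ) : ℝ)) (uIcc p x) :=
      ((cont_iter k).sub continuous_const).continuousOn
    have hsub : uIcc p x ⊆ Icc a b := uIcc_subset_Icc hpab hx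
    rcases lt_or_ge (Φ.F^[k] p - ((s.a - q : ℤ) : ℝ)) x₁ with hl | hl
    · obtain ⟨v, hv, hve⟩ := intermediate_value_uIcc hc (mem_uIcc_of_le hl.le e1.1)
      exact ⟨v, hsub hv, by simp only at hve; rw [hve, hU.hleft]⟩
    · have hg : x₂ < Φ.F^[k] p - ((s.a - q : ℤ) : ℝ) := by
        by_contra hcon
        exact e2 ⟨hl, not_lt.1 hcon⟩
      obtain ⟨v, hv, hve⟩ := intermediate_value_uIcc hc (mem_uIcc_of_ge e1.2 hg.le)
      exact ⟨v, hsub hv, by simp only at hve; rw [hve, hU.hright]⟩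
  have e3 : Φ.F^[j - i - 1] (Φ.F (Φ.F^[k] v - ((s.a - q : ℤ) : ℝ))) =
      Φ.F^[j - i - 1] (Φ.F (Φ.F^[r.n] p - r.a)) := by rw [hvy, hpy]
  rw [F_iter_sub, F_iter_sub, Φ.lift.iter_sub, Φ.lift.iter_sub, ← Function.iterate_add_apply,
    ← Function.iterate_add_apply, show j - i - 1 + (k + 1) = s.n by omega,
    show j - i - 1 + (r.n + 1) = r.n + (j - i) by omega] at e3
  refine hgap (r.n + (j - i)) (by omega) (by omega) (r.a + q) ?_
  have h2 := hW v hv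
  push_cast at e3 ⊢
  exact ⟨by linarith [h2.1], by linarith [h2.2]⟩

end FoldMap

namespace FoldMap
variable {Φ : FoldMap} {α β : ℝ}

/-! ### Distance of a record to the critical point -/

lemma IsSuper.near_left {y x₁ x₂ : ℝ} (hU : IsSuper Φ y x₁ x₂) (hn : Near Φ y) :
    x₁ ∈ Ioo (Φ.c - Φ.η) (Φ.c + Φ.η) :=
  hn _ (hU.mem_Ioo ⟨le_rfl, (hU.left.2.trans hU.right.1).le⟩) hU.hleft.ge

lemma IsSuper.near_right {y x₁ x₂ : ℝ} (hU : IsSuper Φ y x₁ x₂) (hn : Near Φ y) :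
    x₂ ∈ Ioo (Φ.c - Φ.η) (Φ.c + Φ.η) :=
  hn _ (hU.mem_Ioo ⟨(hU.left.2.trans hU.right.1).le, le_rfl⟩) hU.hright.ge

/-- Space around a record inside a superlevel set. -/
lemma gap_le {x y t q : ℝ} (hx : x ∈ Ioo (Φ.c - Φ.η) (Φ.c + Φ.η))
    (hy : y ∈ Ioo (Φ.c - Φ.η) (Φ.c + Φ.η)) (hxt : t ≤ |(|Φ.g x| - |Φ.g y|)|) {τ : ℝ}
    (hq : Φ.k₂ * τ * q ≤ t) : τ * q ≤ |x - y| := by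
  have hk := Φ.k₁_pos.trans_le Φ.k₁_le
  have h1 := (abs_g_sub hx hy).2
  have h2 := abs_abs_sub_abs_le (Φ.g x) (Φ.g y)
  nlinarith

lemma Ordered.dist_le {x₁ x₂ x₃ x₄ x c δ : ℝ} (h : Ordered x₁ x₂ x₃ x₄) (hx : x ∈ uIcc x₂ x₃)
    (hc : c ∉ uIcc x₁ x₄) (h1 : δ ≤ |x₂ - x₁|) (h2 : δ ≤ |x₄ - x₃|) : δ ≤ |x - c| := by
  rcases h with ⟨a, b, d⟩ | ⟨a, b, d⟩
  · rw [uIcc_of_le (by linarith)] at hx hc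
    rw [abs_of_pos (by linarith)] at h1 h2
    rcases lt_or_ge c x₁ with hl | hl
    · rw [abs_of_pos (by linarith [hx.1])]; linarith [hx.1]
    · have : x₄ < c := not_le.1 fun h' => hc ⟨hl, h'⟩
      rw [abs_of_neg (by linarith [hx.2])]; linarith [hx.2]
  · rw [uIcc_of_ge (by linarith)] at hx hc
    rw [abs_of_neg (by linarith)] at h1 h2
    rcases lt_or_ge c x₄ with hl | hl
    · rw [abs_of_pos (by linarith [hx.1])]; linarith [hx.1]
    · have : x₁ < c := not_le.1 fun h' => hc ⟨hl, h'⟩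
      rw [abs_of_neg (by linarith [hx.2])]; linarith [hx.2]

/-- A record followed by a shorter one is far from `c` compared to its length. -/
lemma IsNext.len_le_rad {r s : RecData} (w : Wandering Φ α β) (h : IsNext Φ α β r s)
    (hn : Near Φ r.y) (hlen : len Φ s ≤ len Φ r) :
    Φ.k₁ * len Φ r ≤ Φ.k₂ * Φ.koebe 1 (Φ.k₁ / Φ.k₂) * rad Φ r.z := by
  have hk₁ := Φ.k₁_pos
  have hk₂ := hk₁.trans_le Φ.k₁_le
  set τ := Φ.k₁ / Φ.k₂ with hτdef
  have hτ : 0 < τ := by positivity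
  have hns := h.near_right w hn
  obtain ⟨x₁, x₂, hU⟩ := exists_isSuper (h.left.lt_y w) (h.left.y_lt w)
  obtain ⟨a, b, ha, hb, hab, hends⟩ := h.exists_pull w hU
  have hlt := w.lt
  have hmn := h.lt
  obtain ⟨n, hn'⟩ : ∃ n, s.n = r.n + n := ⟨s.n - r.n, by omega⟩
  have hfree0 : ∀ z ∈ uIcc a b, Φ.FreeN s.n z := by
    rw [uIcc_of_le (by linarith)]; exact fun z hz => (hab z hz).1
  have hfreem : ∀ z ∈ uIcc a b, Φ.FreeN r.n z := fun z hz => (hfree0 z hz).mono hmn.le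
  have himg := iter_image hfreem
  have hfree : ∀ z ∈ uIcc (Φ.F^[r.n] a) (Φ.F^[r.n] b), Φ.FreeN n z := by
    rw [← himg]
    rintro _ ⟨z, hz, rfl⟩
    have := hfree0 z hz
    rw [hn'] at this
    exact this.shift
  have hord : Ordered (Φ.F^[r.n] a) (Φ.F^[r.n] α) (Φ.F^[r.n] β) (Φ.F^[r.n] b) :=
    Ordered.image (Or.inl ⟨ha, hlt, hb⟩) (cont_iter _).continuousOn (iter_injOn hfreem)
  have hS : ∑ i ∈ Finset.range n, |Φ.F^[i] (Φ.F^[r.n] b) - Φ.F^[i] (Φ.F^[r.n] a)| ≤ (1 : ℕ) := by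
    refine sum_abs_le hfree fun x t ht hx => Finset.card_le_one.2 ?_
    have key : ∀ i ∈ t, ∀ j ∈ t, ¬ i < j := by
      intro i hi j hj hij
      obtain ⟨q, hq⟩ := hx i hi
      obtain ⟨q', hq'⟩ := hx j hj
      rw [← himg] at hq hq'
      obtain ⟨_, ⟨u, hu, rfl⟩, e⟩ := hq
      obtain ⟨_, ⟨u', hu', rfl⟩, e'⟩ := hq'
      rw [← Function.iterate_add_apply] at e e'
      have hjn := Finset.mem_range.1 (ht hj)
      rw [uIcc_of_le (by linarith)] at hu hu'
      refine h.pull_disjoint w hU ha hb (fun z hz => (hab z hz).2) (i := i + r.n) (j := j + r.n)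
        (by omega) (by omega) (by omega) hu hu' (q' - q) ?_
      rw [e, e']; push_cast; ring
    exact fun i hi j hj => le_antisymm (not_lt.1 (key j hj i hi)) (not_lt.1 (key i hi j hj))
  rw [Nat.cast_one] at hS
  have hiter : ∀ x, Φ.F^[n] (Φ.F^[r.n] x) = Φ.F^[s.n] x := fun x => by
    rw [← Function.iterate_add_apply, hn', add_comm]
  have hgap : ∀ x ∈ Icc α β, ∀ v, (Φ.F^[s.n] v = x₁ + s.a ∨ Φ.F^[s.n] v = x₂ + s.a) →
      τ * |Φ.F^[s.n] β - Φ.F^[s.n] α| ≤ |Φ.F^[s.n] v - Φ.F^[s.n] x| := by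
    intro x hx v hv
    have hvn : Φ.F^[s.n] v - s.a ∈ Ioo (Φ.c - Φ.η) (Φ.c + Φ.η) ∧
        |Φ.g (Φ.F^[s.n] v - s.a)| = rad Φ r.y := by
      rcases hv with e | e <;> rw [e, add_sub_cancel_right]
      · exact ⟨hU.near_left hn, by rw [← rad_eq (hU.near_left hn), hU.hleft]⟩
      · exact ⟨hU.near_right hn, by rw [← rad_eq (hU.near_right hn), hU.hright]⟩
    have h1 := gap_le (t := len Φ r) (q := |Φ.F^[s.n] β - Φ.F^[s.n] α|) (τ := τ) hvn.1
      (h.right.near_pt hns hx) ?_ ?_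
    · rwa [sub_sub_sub_cancel_right] at h1
    · have h2 := (h.right.abs_g_mem w hns hx).2
      have h3 := h.rad_le w hn
      rw [hvn.2]
      refine le_trans ?_ (le_abs_self _)
      unfold len
      linarith
    · rw [hτdef, mul_div_cancel₀ _ hk₂.ne']
      exact (h.right.le_len w hns).trans hlen
  have hends' : (Φ.F^[s.n] a = x₁ + s.a ∨ Φ.F^[s.n] a = x₂ + s.a) ∧
      (Φ.F^[s.n] b = x₁ + s.a ∨ Φ.F^[s.n] b = x₂ + s.a) := by tauto
  have hkoebe := koebe_space hord hτ hfree hS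
    (by
      simp only [hiter]
      rw [abs_sub_comm (Φ.F^[s.n] α) (Φ.F^[s.n] a)]
      exact hgap α w.left_mem a hends'.1)
    (by simp only [hiter]; exact hgap β w.right_mem b hends'.2)
  have hQ := koebe_pos (Φ := Φ) (S := 1) hτ
  set Q := Φ.koebe 1 τ
  obtain ⟨x, hx, e⟩ := h.left.att r.z ⟨h.left.y_le_z w, le_rfl⟩
  have hxn := h.left.near_pt hn hx
  have hd := hord.dist_le (x := Φ.F^[r.n] x) (c := Φ.c + r.a)
    (by rw [← w.image]; exact mem_image_of_mem _ hx)
    (by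
      rw [← himg]
      rintro ⟨z, hz, e⟩
      exact hfree0 z hz r.n hmn ⟨r.a, Or.inl e⟩) hkoebe.1 hkoebe.2
  have hg := (abs_g_sub hxn c_near).1
  rw [Φ.g_c, sub_zero, ← rad_eq hxn, e, sub_sub, add_comm (r.a : ℝ)] at hg
  have hl := h.left.len_le w hn
  rw [div_le_iff₀ hQ] at hd
  calc Φ.k₁ * len Φ r ≤ Φ.k₁ * (Φ.k₂ * |Φ.F^[r.n] β - Φ.F^[r.n] α|) := by gcongr
    _ ≤ Φ.k₁ * (Φ.k₂ * (|Φ.F^[r.n] x - (Φ.c + r.a)| * Q)) := by gcongr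
    _ = Φ.k₂ * Q * (Φ.k₁ * |Φ.F^[r.n] x - (Φ.c + r.a)|) := by ring
    _ ≤ Φ.k₂ * Q * rad Φ r.z := by gcongr

end FoldMap

namespace FoldMap
variable {Φ : FoldMap} {α β : ℝ} {r s t : RecData}

/-! ### One-sided pull-backs -/

lemma not_crit_of_mem {x : ℝ} (hx : x ∈ Ioo (Φ.e - 1) Φ.e) (hc : x ≠ Φ.c) : ¬ Φ.Crit x := by
  have h3 := Φ.hed
  have h4 := Φ.hdc
  have h5 := Φ.hce
  rintro ⟨a, h | h⟩
  · have : (0 : ℤ) = a := int_eq_of_mem (x := x) (Φ := Φ)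
      (by simpa using hx) (by rw [h]; exact ⟨by linarith, by linarith⟩)
    subst this
    simp at h; exact hc h
  · have h1 : (-1 : ℝ) < a := by linarith [hx.1]
    have h2 : (a : ℝ) < 0 := by linarith [hx.2]
    have h1' : -1 < a := by exact_mod_cast h1
    have h2' : a < 0 := by exact_mod_cast h2
    omega

/-- A critical-point-free segment meeting the big interval is contained in it. -/
lemma mem_big_of_free {u v : ℝ} (h : ∀ x ∈ uIcc u v, ¬ Φ.Crit x)
    (hv : v ∈ Ioo (Φ.e - 1) Φ.e) : u ∈ Ioo (Φ.e - 1) Φ.e := by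
  constructor
  · by_contra hcon
    exact h (Φ.e - 1) (mem_uIcc_of_le (not_lt.1 hcon) hv.1.le) ⟨-1, Or.inr (by push_cast; ring)⟩
  · by_contra hcon
    exact h Φ.e (mem_uIcc_of_ge hv.2.le (not_lt.1 hcon)) ⟨0, Or.inr (by push_cast; ring)⟩

/-- An extension `[A, B]` of the segment mapped at time `s.n + 1` onto the heights between the
bottom of `r` and the top of `t`. -/
structure IsHalf (Φ : FoldMap) (α β : ℝ) (r s t : RecData) (A B : ℝ) : Prop where
  ltA : A < α
  ltB : β < B
  free : ∀ z ∈ Icc A B, Φ.FreeN (s.n + 1) z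
  mem : ∀ z ∈ Icc A B, Φ.F^[s.n] z - s.a ∈ Ioo Φ.d Φ.e
  img : ∀ z ∈ Icc A B, Φ.F (Φ.F^[s.n] z - s.a) ∈ Icc r.y t.z
  endA : Φ.F (Φ.F^[s.n] A - s.a) = r.y ∨ Φ.F (Φ.F^[s.n] A - s.a) = t.z
  endB : Φ.F (Φ.F^[s.n] B - s.a) = r.y ∨ Φ.F (Φ.F^[s.n] B - s.a) = t.z

/-- The part of a superlevel set below a higher level, on a prescribed side of `c`. -/
lemma exists_half_super {y z x₁ x₂ : ℝ} (hU : IsSuper Φ y x₁ x₂) (hyz : y < z)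
    (hz : z < Φ.F Φ.c) {σ : ℝ} (hσ : σ = 1 ∨ σ = -1) :
    ∃ x ∈ Icc x₁ x₂, ∃ v ∈ Icc x₁ x₂, Φ.F x = y ∧ Φ.F v = z ∧
      (∀ u ∈ uIcc x v, Φ.F u ≤ z ∧ u ≠ Φ.c) ∧
      ∀ u ∈ Icc x₁ x₂, 0 < σ * (u - Φ.c) → Φ.F u ≤ z → u ∈ uIcc x v := by
  have h3 := Φ.hed
  have h4 := Φ.hdc
  have h5 := Φ.hce
  have hl := hU.left
  have hr := hU.right
  have hy : Φ.F Φ.e < y := by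
    rw [← hU.hright]; exact FoldMap.lt_height ⟨by linarith [hr.1], hr.2⟩
  obtain ⟨v₁, v₂, hV⟩ := exists_isSuper (hy.trans hyz) hz
  have hl' := hV.left
  have hr' := hV.right
  have m1 : x₁ ≤ v₁ := ((hU.iff v₁ ⟨hl'.1, by linarith [hl'.2]⟩).1
    (by rw [hV.hleft]; exact hyz.le)).1
  have m2 : v₂ ≤ x₂ := ((hU.iff v₂ ⟨by linarith [hr'.1], hr'.2⟩).1
    (by rw [hV.hright]; exact hyz.le)).2
  rcases hσ with rfl | rfl
  · refine ⟨x₂, ⟨by linarith [hl.2, hr.1], le_rfl⟩, v₂, ⟨by linarith [hr'.1, hl.2], m2⟩,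
      hU.hright, hV.hright, fun u hu => ?_, fun u hu hc hz => ?_⟩
    · rw [uIcc_of_ge m2] at hu
      refine ⟨?_, by linarith [hu.1, hr'.1]⟩
      rw [← hV.hright]
      exact Φ.anti.antitoneOn ⟨hr'.1.le, hr'.2.le⟩ ⟨by linarith [hu.1, hr'.1],
        by linarith [hu.2, hr.2]⟩ hu.1
    · rw [uIcc_of_ge m2]
      refine ⟨?_, hu.2⟩
      rw [← hV.hright, Φ.anti.le_iff_ge ⟨by linarith, by linarith [hu.2, hr.2]⟩
        ⟨hr'.1.le, hr'.2.le⟩] at hz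
      exact hz
  · refine ⟨x₁, ⟨le_rfl, by linarith [hl.2, hr.1]⟩, v₁, ⟨m1, by linarith [hl'.2, hr.1]⟩,
      hU.hleft, hV.hleft, fun u hu => ?_, fun u hu hc hz => ?_⟩
    · rw [uIcc_of_le m1] at hu
      refine ⟨?_, by linarith [hu.2, hl'.2]⟩
      rw [← hV.hleft]
      exact Φ.mono.monotoneOn ⟨by linarith [hu.1, hl.1], by linarith [hu.2, hl'.2]⟩
        ⟨by linarith [hl'.1], hl'.2.le⟩ hu.2
    · rw [uIcc_of_le m1]
      refine ⟨hu.1, ?_⟩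
      rw [← hV.hleft, Φ.mono.le_iff_le ⟨by linarith [hu.1, hl.1], by linarith⟩
        ⟨by linarith [hl'.1], hl'.2.le⟩] at hz
      exact hz

lemma exists_isHalf (w : Wandering Φ α β) (h : IsNext Φ α β r s) (h' : IsNext Φ α β s t) :
    ∃ A B, IsHalf Φ α β r s t A B := by
  have hlt := w.lt
  have hry := h.left.y_le_z w
  have hsy := h.right.y_le_z w
  have hty := h'.right.y_le_z w
  have hrs := h.height_lt
  have hst := h'.height_lt
  obtain ⟨x₁, x₂, hU⟩ := exists_isSuper (h.left.lt_y w) (h.left.y_lt w)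
  obtain ⟨a, b, ha, hb, hab, hends⟩ := h.exists_pull w hU
  obtain ⟨σ, hσ, hside⟩ := w.exists_side s.n s.a
  obtain ⟨x, hx, v, hv, hxy, hvz, hlow, hback⟩ :=
    exists_half_super hU (show r.y < t.z by linarith) (h'.right.z_lt w) hσ
  have hable : a ≤ b := by linarith
  have hfree : ∀ z ∈ uIcc a b, Φ.FreeN s.n z := by
    rw [uIcc_of_le hable]; exact fun z hz => (hab z hz).1
  have hinj := iter_injOn hfree
  have himg := iter_image hfree
  have hx12 : x₁ ≤ x₂ := hx.1.trans hx.2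
  have himg' : Φ.F^[s.n] '' Icc a b = Icc (x₁ + s.a) (x₂ + s.a) := by
    rw [← uIcc_of_le hable, himg]
    rcases hends with ⟨e1, e2⟩ | ⟨e1, e2⟩
    · rw [e1, e2, uIcc_of_le (by linarith)]
    · rw [e1, e2, uIcc_of_ge (by linarith)]
  rw [uIcc_of_le hable] at hinj
  have hpre : ∀ u ∈ Icc x₁ x₂, ∃ z ∈ Icc a b, Φ.F^[s.n] z = u + s.a := fun u hu => by
    have : u + s.a ∈ Φ.F^[s.n] '' Icc a b := by
      rw [himg']; exact ⟨by linarith [hu.1], by linarith [hu.2]⟩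
    exact this
  obtain ⟨u₀, hu₀, e₀⟩ := hpre x hx
  obtain ⟨u₁, hu₁, e₁⟩ := hpre v hv
  have hsub : uIcc u₀ u₁ ⊆ Icc a b := uIcc_subset_Icc hu₀ hu₁
  have hTimg : Φ.F^[s.n] '' uIcc u₀ u₁ = uIcc (x + s.a) (v + s.a) := by
    rw [iter_image fun z hz => (hab z (hsub hz)).1, e₀, e₁]
  have hmemT : ∀ z ∈ uIcc u₀ u₁, Φ.F^[s.n] z - s.a ∈ uIcc x v := by
    intro z hz
    have h1 : Φ.F^[s.n] z ∈ uIcc (x + s.a) (v + s.a) := by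
      rw [← hTimg]; exact mem_image_of_mem _ hz
    rw [mem_uIcc] at h1 ⊢
    rcases h1 with h1 | h1
    · exact Or.inl ⟨by linarith [h1.1], by linarith [h1.2]⟩
    · exact Or.inr ⟨by linarith [h1.1], by linarith [h1.2]⟩
  have hJT : ∀ z ∈ Icc α β, z ∈ uIcc u₀ u₁ := by
    intro z hz
    have hzab : z ∈ Icc a b := ⟨by linarith [hz.1], by linarith [hz.2]⟩
    have h1 := (hab z hzab).2
    have h2 := (h.right.img z hz).2
    have h3 := hback (Φ.F^[s.n] z - s.a) ⟨by linarith [h1.1], by linarith [h1.2]⟩ (hside z hz)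
      (by linarith)
    have h4 : Φ.F^[s.n] z ∈ Φ.F^[s.n] '' uIcc u₀ u₁ := by
      rw [hTimg]
      rw [mem_uIcc] at h3 ⊢
      rcases h3 with h3 | h3
      · exact Or.inl ⟨by linarith [h3.1], by linarith [h3.2]⟩
      · exact Or.inr ⟨by linarith [h3.1], by linarith [h3.2]⟩
    obtain ⟨z', hz', e⟩ := h4
    rwa [← hinj (hsub hz') hzab e]
  have hend : ∀ z, (z = u₀ ∨ z = u₁) →
      (Φ.F (Φ.F^[s.n] z - s.a) = r.y ∨ Φ.F (Φ.F^[s.n] z - s.a) = t.z) := by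
    rintro z (rfl | rfl)
    · left; rw [e₀, add_sub_cancel_right, hxy]
    · right; rw [e₁, add_sub_cancel_right, hvz]
  have hnJ : ∀ z, (z = u₀ ∨ z = u₁) → z ∉ Icc α β := by
    intro z hz hzJ
    have h1 := h.right.img z hzJ
    rcases hend z hz with e | e <;> rw [e] at h1
    · linarith [h1.1]
    · linarith [h1.2]
  refine ⟨min u₀ u₁, max u₀ u₁, ?_, ?_, ?_, ?_, ?_, hend _ (min_choice _ _),
    hend _ (max_choice _ _)⟩
  · refine lt_of_le_of_ne (hJT α w.left_mem).1 fun e => ?_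
    exact hnJ _ (min_choice u₀ u₁) (by rw [e]; exact w.left_mem)
  · refine lt_of_le_of_ne (hJT β w.right_mem).2 fun e => ?_
    exact hnJ _ (max_choice u₀ u₁) (by rw [← e]; exact w.right_mem)
  · intro z hz i hi
    rcases Nat.lt_succ_iff_lt_or_eq.1 hi with hi | rfl
    · exact (hab z (hsub hz)).1 i hi
    · rw [← crit_sub_int s.a]
      have h1 := hmemT z hz
      exact not_crit_of_mem (mem_big (hU.mem_Ioo (uIcc_subset_Icc hx hv h1))) (hlow _ h1).2
  · intro z hz
    exact hU.mem_Ioo (uIcc_subset_Icc hx hv (hmemT z hz))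
  · intro z hz
    have h1 := hmemT z hz
    exact ⟨hU.le_height (uIcc_subset_Icc hx hv h1), (hlow _ h1).1⟩

/-! ### Return times of the one-sided pull-back -/

lemma no_return {N k : ℕ} {p u : ℝ} (hfree : ∀ z ∈ uIcc p u, Φ.FreeN (N + k) z) (hk : 1 ≤ k)
    (b c : ℤ) (hlt : Φ.F^[N] p - c < Φ.F^[N] u - c)
    (h0 : Φ.F^[k] (Φ.F^[N] p - c) - b ∈ Icc (Φ.F^[N] p - c) (Φ.F^[N] u - c))
    (h1 : Φ.F^[k] (Φ.F^[N] u - c) - b ∈ Icc (Φ.F^[N] p - c) (Φ.F^[N] u - c)) : False := by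
  set q₀ := Φ.F^[N] p - c
  set q₁ := Φ.F^[N] u - c
  have himg := iter_image (Φ := Φ) (n := N) (x := p) (y := u)
    fun z hz => (hfree z hz).mono (Nat.le_add_right N k)
  have hfr : ∀ z ∈ uIcc q₀ q₁, Φ.FreeN k z := by
    intro z hz
    rw [uIcc_of_le hlt.le] at hz
    have : z + c ∈ Φ.F^[N] '' uIcc p u := by
      rw [himg]; exact mem_uIcc_of_le (by linarith [hz.1]) (by linarith [hz.2])
    obtain ⟨z', hz', e⟩ := this
    have h2 := (hfree z' hz').shift.sub_int c
    rwa [e, add_sub_cancel_right] at h2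
  have hinj := iter_injOn hfr
  have himk := iter_image hfr
  rw [uIcc_of_le hlt.le] at hinj himk
  refine Φ.noAttr q₀ q₁ hlt k hk b (hinj.mono Ioo_subset_Icc_self) fun z hz => ?_
  have h2 : Φ.F^[k] z ∈ uIcc (Φ.F^[k] q₀) (Φ.F^[k] q₁) := by
    rw [← himk]; exact mem_image_of_mem _ hz
  change Φ.F^[k] z - b ∈ Icc q₀ q₁
  rw [mem_uIcc] at h2
  rcases h2 with h2 | h2
  · exact ⟨by linarith [h0.1, h2.1], by linarith [h1.2, h2.2]⟩
  · exact ⟨by linarith [h1.1, h2.1], by linarith [h0.2, h2.2]⟩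

namespace IsHalf
variable {A B : ℝ}

lemma J_sub (H : IsHalf Φ α β r s t A B) {p : ℝ} (hp : p ∈ Icc α β) : p ∈ Icc A B :=
  ⟨H.ltA.le.trans hp.1, hp.2.trans H.ltB.le⟩

lemma forward_time (h : IsNext Φ α β r s)
    (H : IsHalf Φ α β r s t A B) {i j : ℕ} (hij : i < j) (hj : j < s.n) {p u : ℝ}
    (hp : p ∈ Icc α β) (hu : u ∈ Icc A B) {b : ℤ} (e : Φ.F^[i] p - b = Φ.F^[j] u) :
    j - i = s.n - r.n := by
  have h1 : Φ.F^[s.n - j] (Φ.F^[i] p - b) = Φ.F^[s.n - j] (Φ.F^[j] u) := by rw [e]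
  rw [Φ.lift.iter_sub, ← Function.iterate_add_apply, ← Function.iterate_add_apply,
    show s.n - j + i = s.n - (j - i) by omega, show s.n - j + j = s.n by omega] at h1
  have e2 : Φ.F^[s.n - (j - i)] p - ((b + s.a : ℤ) : ℝ) = Φ.F^[s.n] u - s.a := by
    push_cast; linarith
  by_contra hne
  have h2 := h.gap (s.n - (j - i)) (by omega) (by omega) (b + s.a) p hp (by
    rw [e2]; exact H.mem u hu)
  rw [e2] at h2
  linarith [(H.img u hu).1]

/-- Points of the orbit joined to the big interval by a free segment are low. -/
lemma low (w : Wandering Φ α β) (h : IsNext Φ α β r s) (H : IsHalf Φ α β r s t A B) {i : ℕ}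
    (hi : i < s.n) {p u : ℝ} (hp : p ∈ Icc α β) (hu : u ∈ Icc A B) {b : ℤ}
    (hm : Φ.F^[i] u - b ∈ Ioo Φ.d Φ.e) : Φ.F (Φ.F^[i] p - b) ≤ r.z := by
  have hsub : uIcc p u ⊆ Icc A B := uIcc_subset_Icc (H.J_sub hp) hu
  have himg := iter_image (Φ := Φ) (n := i) (x := p) (y := u)
    fun z hz => (H.free z (hsub hz)).mono (by omega)
  have hbig : Φ.F^[i] p - b ∈ Ioo (Φ.e - 1) Φ.e := by
    refine mem_big_of_free (v := Φ.F^[i] u - b) (fun x hx => ?_) (mem_big hm)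
    have : x + b ∈ Φ.F^[i] '' uIcc p u := by
      rw [himg]
      rw [mem_uIcc] at hx ⊢
      rcases hx with hx | hx
      · exact Or.inl ⟨by linarith [hx.1], by linarith [hx.2]⟩
      · exact Or.inr ⟨by linarith [hx.1], by linarith [hx.2]⟩
    obtain ⟨z, hz, e⟩ := this
    have := H.free z (hsub hz) i (by omega)
    rwa [e, crit_add_int] at this
  rcases h.height_le w hi hp hbig with h0 | ⟨rfl, rfl⟩
  · exact h0.le.trans (h.left.y_le_z w)
  · exact (h.left.img p hp).2

lemma backward_time (w : Wandering Φ α β) (h : IsNext Φ α β r s) (h' : IsNext Φ α β s t)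
    (H : IsHalf Φ α β r s t A B) {i j : ℕ} (hij : i < j) (hj : j < s.n) {p u : ℝ}
    (hp : p ∈ Icc α β) (hu : u ∈ Icc A B) {b : ℤ} (e : Φ.F^[j] p - b = Φ.F^[i] u) :
    j - i = t.n - s.n := by
  have hrs := h.height_lt
  have hst := h'.height_lt
  have hnt := h'.lt
  set D := j - i with hD
  have hsub : uIcc p u ⊆ Icc A B := uIcc_subset_Icc (H.J_sub hp) hu
  have iter_e : ∀ k, Φ.F^[k + D + i] p - b = Φ.F^[k + i] u := by
    intro k
    have h1 : Φ.F^[k] (Φ.F^[j] p - b) = Φ.F^[k] (Φ.F^[i] u) := by rw [e]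
    rwa [Φ.lift.iter_sub, ← Function.iterate_add_apply, ← Function.iterate_add_apply,
      show k + j = k + D + i by omega] at h1
  have eA : Φ.F^[s.n - D] u = Φ.F^[s.n] p - b := by
    have := iter_e (s.n - D - i)
    rw [show s.n - D - i + D + i = s.n by omega, show s.n - D - i + i = s.n - D by omega] at this
    exact this.symm
  have eA' : Φ.F^[s.n - D + 1] u = Φ.F^[s.n + 1] p - b := by
    have := iter_e (s.n - D + 1 - i)
    rw [show s.n - D + 1 - i + D + i = s.n + 1 by omega,
      show s.n - D + 1 - i + i = s.n - D + 1 by omega] at this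
    exact this.symm
  have eB : Φ.F^[s.n] u = Φ.F^[s.n + D] p - b := by
    have := iter_e (s.n - i)
    rw [show s.n - i + D + i = s.n + D by omega, show s.n - i + i = s.n by omega] at this
    exact this.symm
  have e2 : Φ.F^[s.n + D] p - ((b + s.a : ℤ) : ℝ) = Φ.F^[s.n] u - s.a := by
    rw [eB]; push_cast; ring
  set q₂ := Φ.F (Φ.F^[s.n] u - s.a) with hq₂
  have hq₂' : q₂ = Φ.F^[s.n + 1] u - s.a := F_iter_sub _ _ _
  have hq₂m := H.img u hu
  rw [← hq₂] at hq₂m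
  have hmem2 := H.mem u hu
  set q₁ := Φ.F (Φ.F^[s.n] p - s.a) with hq₁
  have hq₁' : q₁ = Φ.F^[s.n + 1] p - s.a := F_iter_sub _ _ _
  have hq₁m := h.right.img p hp
  rw [← hq₁] at hq₁m
  have avoid : ∀ ρ : RecData, IsRec Φ α β ρ → s.n + D ≠ ρ.n → q₂ ∉ Icc ρ.y ρ.z := by
    intro ρ hρ hne hq
    obtain ⟨x, hx, ex⟩ := hρ.att q₂ hq
    refine hne (w.disj_height (a := b + s.a) (b := ρ.a) hp hx ?_)
    rw [ex, e2]
  have hgtm : r.z < q₂ := by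
    by_contra hcon
    exact avoid r h.left (by have := h.lt; omega) ⟨hq₂m.1, not_lt.1 hcon⟩
  have hq0 : Φ.F^[s.n - D + 1] p - ((s.a - b : ℤ) : ℝ) ≤ r.z := by
    rw [← F_iter_sub]
    refine H.low w h (by omega) hp hu ?_
    rw [eA]
    have := h.right.sub p hp
    push_cast
    rwa [show Φ.F^[s.n] p - (b : ℝ) - (s.a - b) = Φ.F^[s.n] p - s.a by ring]
  by_contra hne
  have hne' : s.n + D ≠ t.n := by omega
  have hnt2 := avoid t h'.right hne'
  have hns2 := avoid s h.right (by omega)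
  rcases lt_or_ge q₂ s.y with hlow | hhigh
  · have hu1 : Φ.F^[s.n - D + 1] u - ((s.a - b : ℤ) : ℝ) = q₁ := by
      rw [eA', hq₁']; push_cast; ring
    refine no_return (Φ := Φ) (N := s.n - D + 1) (k := D) (p := p) (u := u) (fun z hz => ?_)
      (by omega) b
      (s.a - b) ?_ ?_ ?_
    · rw [show s.n - D + 1 + D = s.n + 1 by omega]; exact H.free z (hsub hz)
    · rw [hu1]; linarith [hq₁m.1]
    · rw [hu1]
      have : Φ.F^[D] (Φ.F^[s.n - D + 1] p - ((s.a - b : ℤ) : ℝ)) - b = q₁ := by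
        rw [Φ.lift.iter_sub, ← Function.iterate_add_apply,
          show D + (s.n - D + 1) = s.n + 1 by omega, hq₁']
        push_cast; ring
      rw [this]
      exact ⟨by linarith [hq₁m.1], le_rfl⟩
    · have : Φ.F^[D] (Φ.F^[s.n - D + 1] u - ((s.a - b : ℤ) : ℝ)) - b = q₂ := by
        rw [Φ.lift.iter_sub, ← Function.iterate_add_apply,
          show D + (s.n - D + 1) = s.n + 1 by omega, hq₂']
        push_cast; ring
      rw [this, hu1]
      exact ⟨by linarith, by linarith [hq₁m.1]⟩
  · have hz2 : s.z < q₂ := not_le.1 fun hc => hns2 ⟨hhigh, hc⟩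
    have hy2 : q₂ < t.y := not_le.1 fun hc => hnt2 ⟨hc, hq₂m.2⟩
    have hbig : t.n < s.n + D := by
      by_contra hcon
      have := h'.gap (s.n + D) (by omega) (by omega) (b + s.a) p hp (by rw [e2]; exact hmem2)
      rw [e2, ← hq₂] at this
      linarith
    set E := t.n - s.n with hE
    have eT : Φ.F^[s.n - D + E] u = Φ.F^[t.n] p - b := by
      have := iter_e (s.n - D + E - i)
      rw [show s.n - D + E - i + D + i = t.n by omega,
        show s.n - D + E - i + i = s.n - D + E by omega] at this
      exact this.symm
    have eT' : Φ.F^[s.n - D + E + 1] u = Φ.F^[t.n + 1] p - b := by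
      have := iter_e (s.n - D + E + 1 - i)
      rw [show s.n - D + E + 1 - i + D + i = t.n + 1 by omega,
        show s.n - D + E + 1 - i + i = s.n - D + E + 1 by omega] at this
      exact this.symm
    set v := Φ.F (Φ.F^[t.n] p - t.a) with hv
    have hv' : v = Φ.F^[t.n + 1] p - t.a := F_iter_sub _ _ _
    have hvm := h'.right.img p hp
    rw [← hv] at hvm
    have hv0 : Φ.F^[s.n - D + E + 1] p - ((t.a - b : ℤ) : ℝ) ≤ r.z := by
      rw [← F_iter_sub]
      refine H.low w h (by omega) hp hu ?_
      rw [eT]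
      have := h'.right.sub p hp
      push_cast
      rwa [show Φ.F^[t.n] p - (b : ℝ) - (t.a - b) = Φ.F^[t.n] p - t.a by ring]
    have hu1 : Φ.F^[s.n - D + E + 1] u - ((t.a - b : ℤ) : ℝ) = v := by
      rw [eT', hv']; push_cast; ring
    refine no_return (Φ := Φ) (N := s.n - D + E + 1) (k := D - E) (p := p) (u := u) (fun z hz => ?_)
      (by omega) (b + s.a - t.a) (t.a - b) ?_ ?_ ?_
    · rw [show s.n - D + E + 1 + (D - E) = s.n + 1 by omega]; exact H.free z (hsub hz)
    · rw [hu1]; linarith [hvm.1, hq₁m.1]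
    · have : Φ.F^[D - E] (Φ.F^[s.n - D + E + 1] p - ((t.a - b : ℤ) : ℝ)) -
          ((b + s.a - t.a : ℤ) : ℝ) = q₁ := by
        rw [Φ.lift.iter_sub, ← Function.iterate_add_apply,
          show D - E + (s.n - D + E + 1) = s.n + 1 by omega, hq₁']
        push_cast; ring
      rw [this, hu1]
      exact ⟨by linarith [hq₁m.1], by linarith [hq₁m.2, hvm.1]⟩
    · have : Φ.F^[D - E] (Φ.F^[s.n - D + E + 1] u - ((t.a - b : ℤ) : ℝ)) -
          ((b + s.a - t.a : ℤ) : ℝ) = q₂ := by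
        rw [Φ.lift.iter_sub, ← Function.iterate_add_apply,
          show D - E + (s.n - D + E + 1) = s.n + 1 by omega, hq₂']
        push_cast; ring
      rw [this, hu1]
      exact ⟨by linarith, by linarith [hvm.1]⟩

end IsHalf

end FoldMap

lemma Finset.card_le_three_of_sub_mem {s : Finset ℕ} {a b : ℕ}
    (h : ∀ i ∈ s, ∀ j ∈ s, i < j → j - i = a ∨ j - i = b) : s.card ≤ 3 := by
  rcases s.eq_empty_or_nonempty with rfl | hne
  · simp
  have hm := s.min'_mem hne
  set m := s.min' hne
  have : s ⊆ {m, m + a, m + b} := by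
    intro j hj
    rcases (s.min'_le j hj).eq_or_lt with e | hlt
    · simp [← e, m]
    · have := h m hm j hj hlt
      simp only [Finset.mem_insert, Finset.mem_singleton]
      omega
  exact (Finset.card_le_card this).trans Finset.card_le_three

namespace FoldMap
variable {Φ : FoldMap} {α β : ℝ} {r s t : RecData}

/-! ### Definite space around a wandering segment -/

namespace IsHalf
variable {A B : ℝ}

lemma sum_le (w : Wandering Φ α β) (h : IsNext Φ α β r s) (h' : IsNext Φ α β s t)
    (H : IsHalf Φ α β r s t A B) :
    ∑ i ∈ Finset.range s.n, |Φ.F^[i] B - Φ.F^[i] A| ≤ (6 : ℕ) := by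
  have hAB : A ≤ B := by linarith [H.ltA, H.ltB, w.lt]
  have hp := w.left_mem
  refine sum_abs_le (Φ := Φ) (fun z hz => ?_) fun x τ hτ hx => ?_
  · rw [uIcc_of_le hAB] at hz
    exact (H.free z hz).mono (Nat.le_succ _)
  rw [uIcc_of_le hAB] at hx
  choose! q hq using hx
  have conv : ∀ i ∈ τ, ∀ v ∈ uIcc (Φ.F^[i] α) (x + q i), ∃ u ∈ Icc A B, Φ.F^[i] u = v := by
    intro i hi v hv
    obtain ⟨u, hu, e⟩ := hq i hi
    have hin : i < s.n := Finset.mem_range.1 (hτ hi)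
    have hsub : uIcc α u ⊆ Icc A B := uIcc_subset_Icc (H.J_sub hp) hu
    have himg := iter_image (Φ := Φ) (n := i) (x := α) (y := u)
      fun z hz => (H.free z (hsub hz)).mono (by omega)
    rw [← e, ← himg] at hv
    obtain ⟨z, hz, e'⟩ := hv
    exact ⟨z, hsub hz, e'⟩
  have fwd : ∀ i ∈ τ, ∀ j ∈ τ, i < j →
      Φ.F^[i] α - q i + q j ∈ uIcc (Φ.F^[j] α) (x + q j) → j - i = s.n - r.n := by
    intro i hi j hj hij hm
    obtain ⟨u, hu, e⟩ := conv j hj _ hm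
    exact H.forward_time h hij (Finset.mem_range.1 (hτ hj)) hp hu (b := q i - q j)
      (by rw [e]; push_cast; ring)
  have bwd : ∀ i ∈ τ, ∀ j ∈ τ, i < j →
      Φ.F^[j] α - q j + q i ∈ uIcc (Φ.F^[i] α) (x + q i) → j - i = t.n - s.n := by
    intro i hi j hj hij hm
    obtain ⟨u, hu, e⟩ := conv i hi _ hm
    exact H.backward_time w h h' hij (Finset.mem_range.1 (hτ hj)) hp hu (b := q j - q i)
      (by rw [e]; push_cast; ring)
  rw [← Finset.card_filter_add_card_filter_not (s := τ) fun i => Φ.F^[i] α ≤ x + q i]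
  refine add_le_add (b := 3) (d := 3)
    (Finset.card_le_three_of_sub_mem (a := s.n - r.n) (b := t.n - s.n) fun i hi j hj hij => ?_)
    (Finset.card_le_three_of_sub_mem (a := s.n - r.n) (b := t.n - s.n) fun i hi j hj hij => ?_)
  · rw [Finset.mem_filter] at hi hj
    rcases le_total (Φ.F^[i] α - q i) (Φ.F^[j] α - q j) with hc | hc
    · exact Or.inr (bwd i hi.1 j hj.1 hij (mem_uIcc_of_le (by linarith) (by linarith [hj.2])))
    · exact Or.inl (fwd i hi.1 j hj.1 hij (mem_uIcc_of_le (by linarith) (by linarith [hi.2])))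
  · rw [Finset.mem_filter, not_le] at hi hj
    rcases le_total (Φ.F^[i] α - q i) (Φ.F^[j] α - q j) with hc | hc
    · exact Or.inl (fwd i hi.1 j hj.1 hij (mem_uIcc_of_ge (by linarith [hi.2]) (by linarith)))
    · exact Or.inr (bwd i hi.1 j hj.1 hij (mem_uIcc_of_ge (by linarith [hj.2]) (by linarith)))

end IsHalf

lemma freeN_of_gap (w : Wandering Φ α β) (h : IsNext Φ α β r s) (h' : IsNext Φ α β s t)
    (hn : Near Φ r.y) (hlen : len Φ s ≤ len Φ r) {C : ℝ} (hC : 0 < C) (hC1 : C ≤ 1)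
    (hgap : C * len Φ s ≤ rad Φ s.z - rad Φ t.z) {x : ℝ}
    (hx : x ∈ Icc (α - (β - α) / Φ.koebe 6 (C * Φ.k₁ / Φ.k₂))
      (β + (β - α) / Φ.koebe 6 (C * Φ.k₁ / Φ.k₂))) : Φ.FreeN s.n x := by
  have hk₁ := Φ.k₁_pos
  have hk₂ := hk₁.trans_le Φ.k₁_le
  set τ := C * Φ.k₁ / Φ.k₂ with hτdef
  have hτ : 0 < τ := by positivity
  have hns := h.near_right w hn
  have hnt := h'.near_right w hns
  have hlt := w.lt
  obtain ⟨A, B, H⟩ := exists_isHalf w h h'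
  have hA := H.ltA
  have hB := H.ltB
  have hAB : A ≤ B := by linarith
  have hfree : ∀ z ∈ uIcc A B, Φ.FreeN s.n z := by
    rw [uIcc_of_le hAB]; exact fun z hz => (H.free z hz).mono (Nat.le_succ _)
  have hg : ∀ x ∈ Icc α β, ∀ v ∈ Icc A B,
      (Φ.F (Φ.F^[s.n] v - s.a) = r.y ∨ Φ.F (Φ.F^[s.n] v - s.a) = t.z) →
      τ * |Φ.F^[s.n] β - Φ.F^[s.n] α| ≤ |Φ.F^[s.n] v - Φ.F^[s.n] x| := by
    intro x hx v hv he
    have hvn := hn _ (H.mem v hv) (H.img v hv).1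
    have hpos := h.right.len_pos w hns
    have h1 := gap_le (t := C * len Φ s) (q := |Φ.F^[s.n] β - Φ.F^[s.n] α|) (τ := τ) hvn
      (h.right.near_pt hns hx) ?_ ?_
    · rwa [sub_sub_sub_cancel_right] at h1
    · have h2 := h.right.abs_g_mem w hns hx
      have h3 := h.rad_le w hn
      rw [← rad_eq hvn]
      rcases he with e | e <;> rw [e]
      · refine le_trans ?_ (le_abs_self _)
        have : C * len Φ s ≤ len Φ r := by nlinarith
        unfold len at this ⊢
        linarith [h2.2]
      · refine le_trans ?_ (neg_le_abs _)
        linarith [h2.1]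
    · have h2 := h.right.le_len w hns
      rw [hτdef, mul_div_cancel₀ _ hk₂.ne', mul_assoc]
      exact mul_le_mul_of_nonneg_left h2 hC.le
  have hS := H.sum_le w h h'
  push_cast at hS
  have hkoebe := koebe_space (Or.inl ⟨hA, hlt, hB⟩) hτ hfree hS
    (by
      rw [abs_sub_comm (Φ.F^[s.n] α) (Φ.F^[s.n] A)]
      exact hg α w.left_mem A ⟨le_rfl, hAB⟩ H.endA)
    (hg β w.right_mem B ⟨hAB, le_rfl⟩ H.endB)
  rw [abs_of_pos (sub_pos.2 hlt), abs_of_pos (sub_pos.2 hA), abs_of_pos (sub_pos.2 hB)] at hkoebe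
  exact hfree x (by
    rw [uIcc_of_le hAB]
    exact ⟨by linarith [hx.1, hkoebe.1], by linarith [hx.2, hkoebe.2]⟩)

lemma exists_isNext_seq (w : Wandering Φ α β) (N : ℕ) :
    ∃ R : ℕ → RecData, N ≤ (R 0).n ∧ Near Φ (R 0).y ∧ ∀ k, IsNext Φ α β (R k) (R (k + 1)) := by
  obtain ⟨y, hy1, hy2, hy⟩ := exists_near (Φ := Φ)
  obtain ⟨r, hr, hN, hyr⟩ := exists_isRec w y hy2 N
  choose nx hnx using fun r : {r // IsRec Φ α β r} => exists_isNext w r.2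
  let step : {r // IsRec Φ α β r} → {r // IsRec Φ α β r} := fun r => ⟨nx r, (hnx r).right⟩
  refine ⟨fun k => (step^[k] ⟨r, hr⟩).1, hN, hy.mono hyr.le, fun k => ?_⟩
  simp only [Function.iterate_succ_apply']
  exact hnx _

lemma exists_rad_lt (w : Wandering Φ α β) {R : ℕ → RecData} (hn : ∀ k, Near Φ (R k).y)
    (hR : ∀ k, IsNext Φ α β (R k) (R (k + 1))) {ε : ℝ} (hε : 0 < ε) (m : ℕ) :
    ∃ k ≥ m, rad Φ (R k).z < ε := by
  have hk₂ := Φ.k₁_pos.trans_le Φ.k₁_le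
  have hη := Φ.η_pos
  have hcd := Φ.hdc
  set δ := min (min (Φ.η / 2) (ε / (2 * Φ.k₂))) ((Φ.c - Φ.d) / 2) with hδ
  have hδ0 : 0 < δ := by
    rw [hδ]
    refine lt_min (lt_min (by positivity) (by positivity)) (by linarith)
  have hδ1 : δ ≤ Φ.η / 2 := (min_le_left _ _).trans (min_le_left _ _)
  have hδ2 : δ ≤ ε / (2 * Φ.k₂) := (min_le_left _ _).trans (min_le_right _ _)
  have hδ3 : δ ≤ (Φ.c - Φ.d) / 2 := min_le_right _ _
  set v := Φ.c - δ
  have hv : v ∈ Ioo (Φ.c - Φ.η) (Φ.c + Φ.η) :=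
    ⟨by simp only [v]; linarith, by simp only [v]; linarith⟩
  have hvF : Φ.F v < Φ.F Φ.c := height_lt
    ⟨by simp only [v]; linarith [Φ.hed], by simp only [v]; linarith [Φ.hce]⟩
    (by simp only [v]; linarith)
  obtain ⟨i, hi, x, hx, b, hb, hlt⟩ := w.acc _ hvF m
  have hmono : ∀ k, k ≤ (R k).n := by
    intro k
    induction k with
    | zero => exact Nat.zero_le _
    | succ k ih => have := (hR k).lt; omega
  have h1 := (hR (i + 1)).left.far i (hmono (i + 1)) b x hx hb
  refine ⟨i + 1, by omega, ?_⟩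
  have hrec := (hR (i + 1)).left
  have hyz := hrec.y_le_z w
  obtain ⟨x', hx', e'⟩ := hrec.att _ ⟨hyz, le_rfl⟩
  have hnear := hrec.near_pt (hn _) hx'
  rw [← e', rad_eq hnear]
  have h2 : |Φ.g (Φ.F^[(R (i + 1)).n] x' - (R (i + 1)).a)| ≤ |Φ.g v| :=
    (Φ.g_height _ hv _ hnear).1 (by rw [e']; linarith)
  have h3 := (abs_g_sub hv c_near).2
  rw [Φ.g_c, sub_zero, show v - Φ.c = -δ by simp only [v]; ring, abs_neg, abs_of_pos hδ0] at h3
  have h4 : Φ.k₂ * δ ≤ ε / 2 := by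
    calc Φ.k₂ * δ ≤ Φ.k₂ * (ε / (2 * Φ.k₂)) := by gcongr
      _ = ε / 2 := by field_simp
  linarith

/-- The uniform space around wandering segments accumulating at `c`. -/
lemma exists_space (Φ : FoldMap) : ∃ Q > 0, ∀ α β, Wandering Φ α β →
    ∀ x ∈ Icc (α - (β - α) / Q) (β + (β - α) / Q), ∀ i, ¬ Φ.Crit (Φ.F^[i] x) := by
  have hk₁ := Φ.k₁_pos
  have hk₂ := hk₁.trans_le Φ.k₁_le
  have hQ₁ := koebe_pos (Φ := Φ) (S := 1) (τ := Φ.k₁ / Φ.k₂) (by positivity)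
  set Q₁ := Φ.koebe 1 (Φ.k₁ / Φ.k₂)
  set C := min (1 / 2) (Φ.k₁ / (4 * Φ.k₂ * Q₁)) with hCdef
  have hC : 0 < C := lt_min (by norm_num) (by positivity)
  have hC1 : C ≤ 1 / 2 := min_le_left _ _
  have hC2 : C * (4 * Φ.k₂ * Q₁) ≤ Φ.k₁ := by
    rw [← le_div_iff₀ (by positivity)]; exact min_le_right _ _
  refine ⟨Φ.koebe 6 (C * Φ.k₁ / Φ.k₂), koebe_pos (by positivity), fun α β w x hx i => ?_⟩
  obtain ⟨R, hN, hn0, hR⟩ := exists_isNext_seq w (i + 1)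
  have hn : ∀ k, Near Φ (R k).y := by
    intro k
    induction k with
    | zero => exact hn0
    | succ k ih => exact (hR k).near_right w ih
  have hmono : ∀ k, i + 1 ≤ (R k).n := by
    intro k
    induction k with
    | zero => exact hN
    | succ k ih => have := (hR k).lt; omega
  by_cases hex : ∃ k, len Φ (R (k + 1)) ≤ len Φ (R k) ∧
      C * len Φ (R (k + 1)) ≤ rad Φ (R (k + 1)).z - rad Φ (R (k + 2)).z
  · obtain ⟨k, h1, h2⟩ := hex
    exact freeN_of_gap w (hR k) (hR (k + 1)) (hn k) h1 hC (by linarith) h2 hx i (hmono (k + 1))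
  exfalso
  push Not at hex
  have hpos : ∀ k, 0 < len Φ (R k) := fun k => (hR k).left.len_pos w (hn k)
  have hz : ∀ k, 0 ≤ rad Φ (R k).z := fun k => (hR k).left.rad_z_nonneg w (hn k)
  have hstep : ∀ k, rad Φ (R (k + 1)).z + len Φ (R (k + 1)) ≤ rad Φ (R k).z := by
    intro k
    have := (hR k).rad_le w (hn k)
    unfold len; linarith
  obtain ⟨k, hk⟩ : ∃ k, len Φ (R (k + 1)) ≤ len Φ (R k) := by
    by_contra hcon
    push Not at hcon
    have h1 : ∀ k, len Φ (R 0) ≤ len Φ (R k) := by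
      intro k
      induction k with
      | zero => exact le_rfl
      | succ k ih => exact ih.trans (hcon k).le
    have h2 : ∀ k : ℕ, rad Φ (R k).z + k * len Φ (R 0) ≤ rad Φ (R 0).z := by
      intro k
      induction k with
      | zero => simp
      | succ k ih => push_cast; linarith [hstep k, h1 (k + 1)]
    obtain ⟨m, hm⟩ := exists_nat_gt (rad Φ (R 0).z / len Φ (R 0))
    rw [div_lt_iff₀ (hpos 0)] at hm
    linarith [h2 m, hz m]
  have hdec : ∀ m, len Φ (R (k + m + 1)) ≤ len Φ (R (k + m)) ∧
      rad Φ (R (k + 1)).z + 2 * C * len Φ (R (k + m + 1)) ≤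
        rad Φ (R (k + m + 1)).z + 2 * C * len Φ (R (k + 1)) := by
    intro m
    induction m with
    | zero => exact ⟨hk, le_rfl⟩
    | succ m ih =>
      have h1 := hex (k + m) ih.1
      have h2 := hstep (k + m + 1)
      have h3 := hpos (k + m + 1)
      have e1 : k + (m + 1) + 1 = k + m + 2 := by omega
      have e2 : k + (m + 1) = k + m + 1 := by omega
      rw [e1, e2]
      have h4 : len Φ (R (k + m + 2)) ≤ C * len Φ (R (k + m + 1)) := by
        have := hstep (k + m + 1)
        change rad Φ (R (k + m + 2)).z + len Φ (R (k + m + 2)) ≤ _ at this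
        linarith
      have h5 := hpos (k + m + 2)
      refine ⟨by nlinarith, ?_⟩
      have : 2 * C * len Φ (R (k + m + 2)) ≤ C * len Φ (R (k + m + 1)) := by nlinarith
      linarith [ih.2]
  have hlim : rad Φ (R (k + 1)).z ≤ 2 * C * len Φ (R (k + 1)) := by
    refine le_of_forall_pos_le_add fun ε hε => ?_
    obtain ⟨l, hl, hle⟩ := exists_rad_lt w hn hR hε (k + 1)
    obtain ⟨m, rfl⟩ : ∃ m, l = k + m + 1 := ⟨l - k - 1, by omega⟩
    have h1 := (hdec m).2
    have h2 : 0 < 2 * C * len Φ (R (k + m + 1)) := by have := hpos (k + m + 1); positivity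
    linarith
  have hS := (hR (k + 1)).len_le_rad w (hn _) (hdec 1).1
  change Φ.k₁ * len Φ (R (k + 1)) ≤ Φ.k₂ * Q₁ * rad Φ (R (k + 1)).z at hS
  have h1 : Φ.k₂ * Q₁ * rad Φ (R (k + 1)).z ≤ Φ.k₂ * Q₁ * (2 * C * len Φ (R (k + 1))) := by gcongr
  have h2 := mul_pos hk₁ (hpos (k + 1))
  nlinarith [mul_le_mul_of_nonneg_right hC2 (hpos (k + 1)).le]

end FoldMap

namespace FoldMap
variable {Φ : FoldMap} {α β p : ℝ}

/-! ### Components of the set of points with noncritical orbit -/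

/-- Points whose orbit avoids the critical points. -/
def free (Φ : FoldMap) : Set ℝ := {x | ∀ i, ¬ Φ.Crit (Φ.F^[i] x)}

lemma iter_mem_free {x : ℝ} (h : x ∈ Φ.free) (n : ℕ) : Φ.F^[n] x ∈ Φ.free := by
  intro i
  rw [← Function.iterate_add_apply]
  exact h (i + n)

lemma add_int_mem_free {x : ℝ} (h : x ∈ Φ.free) (m : ℤ) : x + m ∈ Φ.free := by
  intro i
  rw [Φ.lift.iter_add, crit_add_int]
  exact h i

/-- The component of `p` in `Φ.free`. -/
def comp (Φ : FoldMap) (p : ℝ) : Set ℝ := ordConnectedComponent Φ.free p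

lemma iter_mem_comp {x : ℝ} (h : x ∈ Φ.comp p) (n : ℕ) : Φ.F^[n] x ∈ Φ.comp (Φ.F^[n] p) := by
  intro z hz
  obtain ⟨z', hz', rfl⟩ := intermediate_value_uIcc (cont_iter n).continuousOn hz
  exact iter_mem_free (h hz') n

lemma add_int_mem_comp {x : ℝ} (h : x ∈ Φ.comp p) (m : ℤ) : x + m ∈ Φ.comp (p + m) := by
  intro z hz
  have hz' : z - m ∈ uIcc p x := by
    rw [mem_uIcc] at hz ⊢
    rcases hz with hz | hz
    · exact Or.inl ⟨by linarith [hz.1], by linarith [hz.2]⟩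
    · exact Or.inr ⟨by linarith [hz.1], by linarith [hz.2]⟩
  have := add_int_mem_free (h hz') m
  rwa [sub_add_cancel] at this

lemma comp_eq {x : ℝ} (h : x ∈ Φ.comp p) : Φ.comp p = Φ.comp x := ordConnectedComponent_eq h

lemma Icc_subset_comp (hp : p ∈ Icc α β) (h : Icc α β ⊆ Φ.free) : Icc α β ⊆ Φ.comp p :=
  subset_ordConnectedComponent hp h

/-- Left end of the component of `p`. -/
def lo (Φ : FoldMap) (p : ℝ) : ℝ := sInf (Φ.comp p)

/-- Right end of the component of `p`. -/
def hi (Φ : FoldMap) (p : ℝ) : ℝ := sSup (Φ.comp p)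

lemma abs_sub_lt_one_of_mem_comp {x : ℝ} (h : x ∈ Φ.comp p) : |x - p| < 1 :=
  uIcc_length_lt_one fun _ hz => h hz 0

lemma bddBelow_comp : BddBelow (Φ.comp p) :=
  ⟨p - 1, fun _ hx => by linarith [(abs_lt.1 (abs_sub_lt_one_of_mem_comp hx)).1]⟩

lemma bddAbove_comp : BddAbove (Φ.comp p) :=
  ⟨p + 1, fun _ hx => by linarith [(abs_lt.1 (abs_sub_lt_one_of_mem_comp hx)).2]⟩

lemma comp_subset_Icc : Φ.comp p ⊆ Icc (Φ.lo p) (Φ.hi p) :=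
  subset_Icc_csInf_csSup bddBelow_comp bddAbove_comp

lemma Ioo_subset_comp : Ioo (Φ.lo p) (Φ.hi p) ⊆ Φ.comp p := by
  have hord : OrdConnected (Φ.comp p) := inferInstanceAs (OrdConnected (ordConnectedComponent _ _))
  rcases (Φ.comp p).eq_empty_or_nonempty with he | hne
  · simp [lo, hi, he]
  · exact IsConnected.Ioo_csInf_csSup_subset ⟨hne, hord.isPreconnected⟩ bddBelow_comp bddAbove_comp

lemma mem_Ioo_lo_hi (hp : p ∈ Ioo α β) (h : Icc α β ⊆ Φ.free) : p ∈ Ioo (Φ.lo p) (Φ.hi p) := by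
  have hsub := (Icc_subset_comp ⟨hp.1.le, hp.2.le⟩ h).trans comp_subset_Icc
  have hab : α ≤ β := (hp.1.trans hp.2).le
  exact ⟨(hsub ⟨le_rfl, hab⟩).1.trans_lt hp.1, hp.2.trans_le (hsub ⟨hab, le_rfl⟩).2⟩

lemma exists_iter_interior (hp : p ∈ Ioo α β) (h : Icc α β ⊆ Φ.free) (n : ℕ) :
    ∃ α' β', Φ.F^[n] p ∈ Ioo α' β' ∧ Icc α' β' ⊆ Φ.free := by
  have hab : α ≤ β := (hp.1.trans hp.2).le
  have hfree : ∀ z ∈ uIcc α β, Φ.FreeN n z := by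
    rw [uIcc_of_le hab]; exact fun z hz i _ => h hz i
  have himg := iter_image hfree
  have hinj := iter_injOn hfree
  rw [uIcc_of_le hab] at hinj
  have hp' : p ∈ uIcc α β := by rw [uIcc_of_le hab]; exact ⟨hp.1.le, hp.2.le⟩
  have hm : Φ.F^[n] p ∈ uIcc (Φ.F^[n] α) (Φ.F^[n] β) := by
    rw [← himg]; exact mem_image_of_mem _ hp'
  have hne : ∀ z ∈ Icc α β, z ≠ p → Φ.F^[n] p ≠ Φ.F^[n] z := fun z hz hzp e =>
    hzp (hinj hz ⟨hp.1.le, hp.2.le⟩ e.symm)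
  have h1 := hne α ⟨le_rfl, hab⟩ hp.1.ne
  have h2 := hne β ⟨hab, le_rfl⟩ hp.2.ne'
  refine ⟨min (Φ.F^[n] α) (Φ.F^[n] β), max (Φ.F^[n] α) (Φ.F^[n] β),
    ⟨lt_of_le_of_ne hm.1 fun e => ?_, lt_of_le_of_ne hm.2 fun e => ?_⟩, ?_⟩
  · rcases min_choice (Φ.F^[n] α) (Φ.F^[n] β) with h0 | h0 <;> rw [h0] at e
    · exact h1 e.symm
    · exact h2 e.symm
  · rcases max_choice (Φ.F^[n] α) (Φ.F^[n] β) with h0 | h0 <;> rw [h0] at e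
    · exact h1 e
    · exact h2 e
  · change uIcc _ _ ⊆ _
    rw [← himg, uIcc_of_le hab]
    rintro _ ⟨z, hz, rfl⟩
    exact iter_mem_free (h hz) n

lemma not_mapsTo_comp (hlt : Φ.lo p < Φ.hi p) {j : ℕ} (hj : 1 ≤ j) (a : ℤ) :
    ¬ MapsTo (fun x => Φ.F^[j] x - a) (Φ.comp p) (Φ.comp p) := by
  intro h
  refine Φ.noAttr _ _ hlt j hj a (fun x hx y hy e => ?_) ?_
  · have hsub : uIcc x y ⊆ Ioo (Φ.lo p) (Φ.hi p) :=
      (inferInstance : OrdConnected _).uIcc_subset hx hy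
    exact iter_injOn (fun z hz i _ => ordConnectedComponent_subset (Ioo_subset_comp (hsub hz)) i)
      left_mem_uIcc right_mem_uIcc e
  · have h1 := (h.mono_left Ioo_subset_comp).closure ((cont_iter j).sub continuous_const)
    rw [closure_Ioo hlt.ne] at h1
    exact h1.mono_right (closure_minimal comp_subset_Icc isClosed_Icc)

lemma comp_no_meet (hp : p ∈ Ioo α β) (h : Icc α β ⊆ Φ.free) {i j : ℕ} (hij : i < j) {x y : ℝ}
    (hx : x ∈ Φ.comp (Φ.F^[i] p)) (hy : y ∈ Φ.comp (Φ.F^[j] p)) (a : ℤ) : x + a ≠ y := by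
  rintro rfl
  obtain ⟨α', β', hp', h'⟩ := exists_iter_interior hp h i
  have hm := mem_Ioo_lo_hi hp' h'
  refine not_mapsTo_comp (p := Φ.F^[i] p) (hm.1.trans hm.2) (j := j - i) (by omega) a fun z hz => ?_
  have h1 := iter_mem_comp hz (j - i)
  rw [← Function.iterate_add_apply, show j - i + i = j by omega, comp_eq hy] at h1
  have h2 := add_int_mem_comp h1 (-a)
  push_cast at h2
  rw [add_neg_cancel_right, ← comp_eq hx, ← sub_eq_add_neg] at h2
  exact h2

lemma sum_comp_le (hp : p ∈ Ioo α β) (h : Icc α β ⊆ Φ.free) (n : ℕ) :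
    ∑ i ∈ Finset.range n, (Φ.hi (Φ.F^[i] p) - Φ.lo (Φ.F^[i] p)) ≤ 2 := by
  set l : ℕ → ℝ := fun i => Φ.lo (Φ.F^[i] p)
  set r : ℕ → ℝ := fun i => Φ.hi (Φ.F^[i] p)
  have hlr : ∀ i, l i < r i := fun i => by
    obtain ⟨α', β', hp', h'⟩ := exists_iter_interior hp h i
    have hm := mem_Ioo_lo_hi hp' h'
    exact hm.1.trans hm.2
  have hsub : ∀ i, Icc (l i + (r i - l i) / 4) (r i - (r i - l i) / 4) ⊆ Φ.comp (Φ.F^[i] p) :=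
    fun i x hx => Ioo_subset_comp ⟨by linarith [hx.1, hlr i], by linarith [hx.2, hlr i]⟩
  have := sum_length_le_of_multiplicity (Finset.range n)
    (fun i => l i + (r i - l i) / 4) (fun i => r i - (r i - l i) / 4) 1
    (fun i _ => by linarith [hlr i]) (fun i _ => ?_) (fun x t _ hx => ?_)
  · have e : ∑ i ∈ Finset.range n, (r i - (r i - l i) / 4 - (l i + (r i - l i) / 4)) =
        (∑ i ∈ Finset.range n, (r i - l i)) / 2 := by
      rw [Finset.sum_div]; exact Finset.sum_congr rfl fun i _ => by ring
    rw [e] at this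
    push_cast at this
    linarith
  · have h1 : r i ≤ Φ.F^[i] p + 1 := csSup_le ⟨_, hsub i ⟨le_rfl, by linarith [hlr i]⟩⟩
      fun x hx => by linarith [(abs_lt.1 (abs_sub_lt_one_of_mem_comp hx)).2]
    have h2 : Φ.F^[i] p - 1 ≤ l i := le_csInf ⟨_, hsub i ⟨le_rfl, by linarith [hlr i]⟩⟩
      fun x hx => by linarith [(abs_lt.1 (abs_sub_lt_one_of_mem_comp hx)).1]
    linarith
  · have key : ∀ i ∈ t, ∀ j ∈ t, ¬ i < j := by
      intro i hi j hj hij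
      obtain ⟨b, hb⟩ := hx i hi
      obtain ⟨b', hb'⟩ := hx j hj
      exact comp_no_meet hp h hij (hsub i hb) (hsub j hb') (b' - b) (by push_cast; ring)
    exact Finset.card_le_one.2 fun i hi j hj =>
      le_antisymm (not_lt.1 (key j hj i hi)) (not_lt.1 (key i hi j hj))

lemma tendsto_comp_length (hp : p ∈ Ioo α β) (h : Icc α β ⊆ Φ.free) :
    Tendsto (fun i => Φ.hi (Φ.F^[i] p) - Φ.lo (Φ.F^[i] p)) atTop (nhds 0) := by
  refine (summable_of_sum_range_le (c := 2) (fun i => ?_) (sum_comp_le hp h)).tendsto_atTop_zero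
  obtain ⟨α', β', hp', h'⟩ := exists_iter_interior hp h i
  have hm := mem_Ioo_lo_hi hp' h'
  linarith [hm.1, hm.2]

/-- Orbits in the interior of `Φ.free` do not accumulate at `c`. -/
lemma exists_far_c (hp : p ∈ Ioo α β) (h : Icc α β ⊆ Φ.free) :
    ∃ ε > 0, ∃ N, ∀ i ≥ N, ∀ b : ℤ, ε ≤ |Φ.F^[i] p - Φ.c - b| := by
  by_contra hcon
  push Not at hcon
  obtain ⟨Q, hQ, hspace⟩ := exists_space Φ
  obtain ⟨hu, hv⟩ := mem_Ioo_lo_hi hp h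
  set u := Φ.lo p
  set v := Φ.hi p
  set η := min (min (p - u) (v - p)) ((v - u) / (2 * (Q + 2))) with hη
  have hη0 : 0 < η := lt_min (lt_min (by linarith) (by linarith))
    (div_pos (by linarith) (by linarith))
  have hη1 : η ≤ p - u := (min_le_left _ _).trans (min_le_left _ _)
  have hη2 : η ≤ v - p := (min_le_left _ _).trans (min_le_right _ _)
  have hη3 : η * (2 * (Q + 2)) ≤ v - u := by
    rw [← le_div_iff₀ (by linarith)]; exact min_le_right _ _
  have hsub : Icc (u + η) (v - η) ⊆ Φ.comp p := fun x hx =>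
    Ioo_subset_comp ⟨by linarith [hx.1], by linarith [hx.2]⟩
  have hab : u + η < v - η := by nlinarith
  have hpm : p ∈ Icc (u + η) (v - η) := ⟨by linarith, by linarith⟩
  have w : Wandering Φ (u + η) (v - η) := by
    refine ⟨hab, fun x hx => ordConnectedComponent_subset (hsub hx), ?_, ?_⟩
    · intro i j x hx y hy a e
      rcases lt_trichotomy i j with hij | hij | hij
      · exact (comp_no_meet hp h hij (iter_mem_comp (hsub hx) i) (iter_mem_comp (hsub hy) j)
          a e).elim
      · exact hij
      · refine (comp_no_meet hp h hij (iter_mem_comp (hsub hy) j) (iter_mem_comp (hsub hx) i) (-a)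
          ?_).elim
        push_cast; linarith
    · intro y hy N
      have h1 : ∀ᶠ x in nhds Φ.c, x ∈ Ioo Φ.d Φ.e ∧ y < Φ.F x :=
        Filter.Eventually.and (Ioo_mem_nhds Φ.hdc Φ.hce)
          (Φ.cont.continuousAt.eventually_const_lt hy)
      obtain ⟨ε, hε, hball⟩ := Metric.eventually_nhds_iff.1 h1
      obtain ⟨i, hi, b, hb⟩ := hcon ε hε N
      refine ⟨i, hi, p, hpm, b, hball ?_⟩
      rw [Real.dist_eq, sub_right_comm]; exact hb
  have h1 := hspace _ _ w
  set κ := (v - η - (u + η)) / Q with hκ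
  have hκ0 : 0 < κ := div_pos (by linarith) hQ
  have hκη : η < κ := by
    rw [hκ, lt_div_iff₀ hQ]; nlinarith
  have hmem := Icc_subset_comp (p := p) (Φ := Φ) (α := u + η - κ) (β := v - η + κ)
    ⟨by linarith [hpm.1], by linarith [hpm.2]⟩ h1
  have := (comp_subset_Icc (hmem (a := u + η - κ) ⟨le_rfl, by linarith⟩)).1
  change u ≤ _ at this
  linarith

end FoldMap

namespace FoldMap
variable {Φ : FoldMap} {α β p : ℝ}

/-! ### Free segments staying away from the critical points -/

/-- `x` is at distance at least `ε` from the critical points. -/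
def Far (Φ : FoldMap) (ε x : ℝ) : Prop := ∀ a : ℤ, ε ≤ |x - Φ.c - a| ∧ ε ≤ |x - Φ.e - a|

lemma Far.not_crit {ε x : ℝ} (hε : 0 < ε) (h : Φ.Far ε x) : ¬ Φ.Crit x := by
  rintro ⟨a, rfl | rfl⟩
  · have := (h a).1
    rw [add_sub_cancel_left, sub_self, abs_zero] at this
    linarith
  · have := (h a).2
    rw [add_sub_cancel_left, sub_self, abs_zero] at this
    linarith

lemma Far.of_near {ε δ x y : ℝ} (h : Φ.Far ε x) (hxy : |y - x| ≤ δ) : Φ.Far (ε - δ) y := by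
  intro a
  obtain ⟨h1, h2⟩ := h a
  have k1 := abs_sub_abs_le_abs_sub (x - Φ.c - a) (y - Φ.c - a)
  have k2 := abs_sub_abs_le_abs_sub (x - Φ.e - a) (y - Φ.e - a)
  rw [show x - Φ.c - a - (y - Φ.c - a) = -(y - x) by ring, abs_neg] at k1
  rw [show x - Φ.e - a - (y - Φ.e - a) = -(y - x) by ring, abs_neg] at k2
  exact ⟨by linarith, by linarith⟩

/-- Ratio distortion away from the critical points. -/
def RatioBound (Φ : FoldMap) (ε L : ℝ) : Prop :=
  ∀ x y z : ℝ, (x < y ∧ y < z ∨ z < y ∧ y < x) → (∀ w ∈ uIcc x z, Φ.Far ε w) →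
    |Φ.F z - Φ.F y| * |y - x| ≤ Real.exp (L * |z - x|) * (|Φ.F y - Φ.F x| * |z - y|)

lemma abs_sub_le_of_mem_uIcc {a b x y : ℝ} (hx : x ∈ uIcc a b) (hy : y ∈ uIcc a b) :
    |x - y| ≤ |b - a| :=
  abs_sub_le_of_uIcc_subset_uIcc (uIcc_subset_uIcc hy hx)

lemma freeN_left_of_far (hp : p ∈ Ioo α β) (h : Icc α β ⊆ Φ.free) {ε L : ℝ} (hε : 0 < ε)
    (hL : 0 ≤ L) (hR : Φ.RatioBound ε L) (hfar : ∀ i, Φ.Far (2 * ε) (Φ.F^[i] p))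
    (hlen : ∀ i, Φ.hi (Φ.F^[i] p) - Φ.lo (Φ.F^[i] p) ≤ ε / 2) {A : ℝ} (hA : A < α)
    (hAα : α - A ≤ Real.exp (-(4 * L)) * (β - α)) (n : ℕ) :
    (∀ w ∈ Icc A β, Φ.FreeN n w) ∧ |Φ.F^[n] A - Φ.F^[n] α| * (β - α) ≤
      Real.exp (2 * L * ∑ i ∈ Finset.range n, (Φ.hi (Φ.F^[i] p) - Φ.lo (Φ.F^[i] p))) *
        (|Φ.F^[n] α - Φ.F^[n] β| * (α - A)) := by
  have hαβ := hp.1.trans hp.2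
  induction n with
  | zero =>
    refine ⟨fun w _ i hi => absurd hi (Nat.not_lt_zero i), ?_⟩
    simp only [Function.iterate_zero, id, Finset.range_zero, Finset.sum_empty, mul_zero,
      Real.exp_zero, one_mul]
    rw [abs_of_neg (by linarith), abs_of_neg (by linarith)]
    nlinarith
  | succ n ih =>
    obtain ⟨hfree, hrat⟩ := ih
    have hAβ : A ≤ β := by linarith
    have hfree' : ∀ w ∈ uIcc A β, Φ.FreeN n w := by rwa [uIcc_of_le hAβ]
    have himg := iter_image hfree'
    have hinj := iter_injOn hfree'
    set ℓ : ℕ → ℝ := fun i => Φ.hi (Φ.F^[i] p) - Φ.lo (Φ.F^[i] p)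
    set S := ∑ i ∈ Finset.range n, ℓ i with hS
    have hS2 : S ≤ 2 := sum_comp_le hp h n
    have hsub := Icc_subset_comp ⟨hp.1.le, hp.2.le⟩ h
    have hJ : |Φ.F^[n] α - Φ.F^[n] β| ≤ ℓ n := by
      have h1 := comp_subset_Icc (iter_mem_comp (hsub ⟨le_rfl, hαβ.le⟩) n)
      have h2 := comp_subset_Icc (iter_mem_comp (hsub ⟨hαβ.le, le_rfl⟩) n)
      rw [abs_le]
      exact ⟨by linarith [h1.1, h2.2], by linarith [h1.2, h2.1]⟩
    have hJ0 : 0 < |Φ.F^[n] α - Φ.F^[n] β| := by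
      refine abs_pos.2 (sub_ne_zero.2 fun e => hαβ.ne (hinj ?_ right_mem_uIcc e))
      exact mem_uIcc_of_le hA.le hαβ.le
    have hAJ : |Φ.F^[n] A - Φ.F^[n] α| ≤ |Φ.F^[n] α - Φ.F^[n] β| := by
      have h1 : Real.exp (2 * L * S) * Real.exp (-(4 * L)) ≤ 1 := by
        rw [← Real.exp_add, Real.exp_le_one_iff]; nlinarith
      have h2 : Real.exp (2 * L * S) * (|Φ.F^[n] α - Φ.F^[n] β| * (α - A)) ≤
          |Φ.F^[n] α - Φ.F^[n] β| * (β - α) := by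
        calc _ ≤ Real.exp (2 * L * S) * (|Φ.F^[n] α - Φ.F^[n] β| *
              (Real.exp (-(4 * L)) * (β - α))) := by gcongr
          _ = (Real.exp (2 * L * S) * Real.exp (-(4 * L))) *
              (|Φ.F^[n] α - Φ.F^[n] β| * (β - α)) := by ring
          _ ≤ 1 * (|Φ.F^[n] α - Φ.F^[n] β| * (β - α)) := by
              have : 0 ≤ β - α := by linarith
              gcongr
          _ = _ := one_mul _
      exact le_of_mul_le_mul_right (hrat.trans h2) (by linarith)
    have hAβ' : |Φ.F^[n] A - Φ.F^[n] β| ≤ 2 * ℓ n := by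
      have := abs_sub_le (Φ.F^[n] A) (Φ.F^[n] α) (Φ.F^[n] β)
      linarith
    have hfarn : ∀ w ∈ uIcc (Φ.F^[n] A) (Φ.F^[n] β), Φ.Far ε w := by
      intro w hw
      have hpm : Φ.F^[n] p ∈ uIcc (Φ.F^[n] A) (Φ.F^[n] β) := by
        rw [← himg]
        exact mem_image_of_mem _ (mem_uIcc_of_le (by linarith [hp.1]) hp.2.le)
      have h1 := abs_sub_le_of_mem_uIcc hw hpm
      rw [abs_sub_comm (Φ.F^[n] β)] at h1
      have := (hfar n).of_near (δ := ε) (h1.trans (by linarith [hlen n]))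
      rwa [show 2 * ε - ε = ε by ring] at this
    have hord : Φ.F^[n] β < Φ.F^[n] α ∧ Φ.F^[n] α < Φ.F^[n] A ∨
        Φ.F^[n] A < Φ.F^[n] α ∧ Φ.F^[n] α < Φ.F^[n] β := by
      have mA : A ∈ uIcc A β := left_mem_uIcc
      have mα : α ∈ uIcc A β := mem_uIcc_of_le hA.le hαβ.le
      have mβ : β ∈ uIcc A β := right_mem_uIcc
      rcases (cont_iter (Φ := Φ) n).continuousOn.strictMonoOn_or_strictAntiOn_uIcc hinj with hm | hm
      · exact Or.inr ⟨hm mA mα hA, hm mα mβ hαβ⟩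
      · exact Or.inl ⟨hm mα mβ hαβ, hm mA mα hA⟩
    have hstep := hR _ _ _ hord (by rwa [uIcc_comm])
    rw [← Function.iterate_succ_apply' Φ.F, ← Function.iterate_succ_apply' Φ.F,
      ← Function.iterate_succ_apply' Φ.F] at hstep
    refine ⟨fun w hw i hi => ?_, ?_⟩
    · rcases Nat.lt_succ_iff_lt_or_eq.1 hi with hi | rfl
      · exact hfree w hw i hi
      · refine (hfarn _ ?_).not_crit hε
        rw [← himg, uIcc_of_le hAβ]; exact mem_image_of_mem _ hw
    · rw [Finset.sum_range_succ, ← hS, mul_add, Real.exp_add]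
      have hE : Real.exp (L * |Φ.F^[n] A - Φ.F^[n] β|) ≤ Real.exp (2 * L * ℓ n) := by
        rw [Real.exp_le_exp]; nlinarith
      refine le_of_mul_le_mul_right ?_ hJ0
      have hα0 : 0 ≤ β - α := by linarith
      calc |Φ.F^[n + 1] A - Φ.F^[n + 1] α| * (β - α) * |Φ.F^[n] α - Φ.F^[n] β|
          = |Φ.F^[n + 1] A - Φ.F^[n + 1] α| * |Φ.F^[n] α - Φ.F^[n] β| * (β - α) := by ring
        _ ≤ Real.exp (2 * L * ℓ n) *
            (|Φ.F^[n + 1] α - Φ.F^[n + 1] β| * |Φ.F^[n] A - Φ.F^[n] α|) * (β - α) := by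
            refine mul_le_mul_of_nonneg_right (hstep.trans ?_) hα0
            gcongr
        _ = Real.exp (2 * L * ℓ n) * |Φ.F^[n + 1] α - Φ.F^[n + 1] β| *
            (|Φ.F^[n] A - Φ.F^[n] α| * (β - α)) := by ring
        _ ≤ Real.exp (2 * L * ℓ n) * |Φ.F^[n + 1] α - Φ.F^[n + 1] β| *
            (Real.exp (2 * L * S) * (|Φ.F^[n] α - Φ.F^[n] β| * (α - A))) := by gcongr
        _ = _ := by ring

lemma false_of_far (hp : p ∈ Ioo α β) (h : Icc α β ⊆ Φ.free) {ε L : ℝ} (hε : 0 < ε)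
    (hL : 0 ≤ L) (hR : Φ.RatioBound ε L) (hfar : ∀ i, Φ.Far (2 * ε) (Φ.F^[i] p))
    (hlen : ∀ i, Φ.hi (Φ.F^[i] p) - Φ.lo (Φ.F^[i] p) ≤ ε / 2) : False := by
  obtain ⟨hu, hv⟩ := mem_Ioo_lo_hi hp h
  set u := Φ.lo p
  set v := Φ.hi p
  set κ := Real.exp (-(4 * L))
  have hκ : 0 < κ := Real.exp_pos _
  set η := min (min ((p - u) / 2) ((v - p) / 2)) (κ * (v - u) / (2 * (1 + 2 * κ))) with hη
  have hη0 : 0 < η := lt_min (lt_min (by linarith) (by linarith))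
    (div_pos (mul_pos hκ (by linarith)) (by linarith))
  have hη1 : η ≤ (p - u) / 2 := (min_le_left _ _).trans (min_le_left _ _)
  have hη2 : η ≤ (v - p) / 2 := (min_le_left _ _).trans (min_le_right _ _)
  have hη3 : η * (2 * (1 + 2 * κ)) ≤ κ * (v - u) := by
    rw [← le_div_iff₀ (by linarith)]; exact min_le_right _ _
  have hJ : Icc (u + η) (v - η) ⊆ Φ.free := fun x hx =>
    ordConnectedComponent_subset (Ioo_subset_comp (p := p)
      ⟨by linarith [hx.1], by linarith [hx.2]⟩)
  have hpJ : p ∈ Ioo (u + η) (v - η) := ⟨by linarith, by linarith⟩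
  set A := u + η - κ * (v - η - (u + η)) with hA
  have hA1 : A < u + η := by
    have : 0 < κ * (v - η - (u + η)) := mul_pos hκ (by linarith [hpJ.1, hpJ.2])
    linarith
  have hA2 : A < u := by nlinarith
  have hfree := fun n => (freeN_left_of_far hpJ hJ hε hL hR hfar hlen hA1 (by simp [hA, κ]) n).1
  have hsub := Icc_subset_comp (p := p) (Φ := Φ) (α := A) (β := v - η)
    ⟨by linarith [hpJ.1], hpJ.2.le⟩ fun x hx i => hfree (i + 1) x hx i (Nat.lt_succ_self i)
  have := (comp_subset_Icc (hsub (a := A) ⟨le_rfl, by linarith [hpJ.1, hpJ.2]⟩)).1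
  change u ≤ A at this
  linarith

/-- No segment consists of points with noncritical orbit. -/
theorem not_Icc_subset_free (Φ Ψ : FoldMap) (hF : ∀ x, Ψ.F x = -Φ.F (-x)) (hc : Ψ.c = -Φ.e)
    (he : Ψ.e = -Φ.c) (hR : ∀ ε > 0, ∃ L ≥ 0, Φ.RatioBound ε L) {α β : ℝ} (hαβ : α < β) :
    ¬ Icc α β ⊆ Φ.free := by
  intro h
  set p := (α + β) / 2
  have hp : p ∈ Ioo α β := ⟨by simp only [p]; linarith, by simp only [p]; linarith⟩
  have hiter : ∀ n x, Ψ.F^[n] x = -Φ.F^[n] (-x) := by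
    intro n
    induction n with
    | zero => simp
    | succ n ih => intro x; rw [Function.iterate_succ_apply', Function.iterate_succ_apply', ih, hF,
        neg_neg]
  have hcrit : ∀ x, Ψ.Crit x → Φ.Crit (-x) := by
    rintro x ⟨a, rfl | rfl⟩
    · exact ⟨-a, Or.inr (by rw [hc]; push_cast; ring)⟩
    · exact ⟨-a, Or.inl (by rw [he]; push_cast; ring)⟩
  obtain ⟨ε₁, hε₁, N₁, h₁⟩ := exists_far_c hp h
  obtain ⟨ε₂, hε₂, N₂, h₂⟩ := exists_far_c (Φ := Ψ) (p := -p) (α := -β) (β := -α)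
    ⟨by linarith [hp.2], by linarith [hp.1]⟩ (fun x hx i hi => by
      have := hcrit _ hi
      rw [hiter, neg_neg] at this
      exact h ⟨by linarith [hx.2], by linarith [hx.1]⟩ i this)
  set ε := min ε₁ ε₂ / 2
  have hε : 0 < ε := by have := lt_min hε₁ hε₂; positivity
  obtain ⟨L, hL, hRL⟩ := hR ε hε
  obtain ⟨N₃, h₃⟩ := eventually_atTop.1
    ((tendsto_comp_length hp h).eventually_le_const (show (0 : ℝ) < ε / 2 by positivity))
  set N := max (max N₁ N₂) N₃
  have hN1 : N₁ ≤ N := (le_max_left _ _).trans (le_max_left _ _)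
  have hN2 : N₂ ≤ N := (le_max_right _ _).trans (le_max_left _ _)
  have hN3 : N₃ ≤ N := le_max_right _ _
  obtain ⟨α', β', hp', h'⟩ := exists_iter_interior hp h N
  refine false_of_far hp' h' hε hL hRL (fun i a => ?_) fun i => ?_
  · rw [← Function.iterate_add_apply]
    have e1 := h₁ (i + N) (by omega) a
    have e2 := h₂ (i + N) (by omega) (-a)
    rw [hiter, neg_neg, hc] at e2
    push_cast at e2
    rw [show -Φ.F^[i + N] p - -Φ.e - -(a : ℝ) = -(Φ.F^[i + N] p - Φ.e - a) by ring, abs_neg] at e2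
    have e3 : 2 * ε = min ε₁ ε₂ := by simp only [ε]; ring
    rw [e3]
    exact ⟨(min_le_left _ _).trans e1, (min_le_right _ _).trans e2⟩
  · rw [← Function.iterate_add_apply]
    exact h₃ (i + N) (by omega)

end FoldMap

lemma exists_bilipschitz_chart {ψ : ℝ → ℝ} {c : ℝ} (hψ : ContDiff ℝ 2 ψ) (hψd : deriv ψ c ≠ 0)
    (hψ0 : ψ c = 0) :
    ∃ (g : ℝ → ℝ) (k₁ k₂ : ℝ), (∀ x, |g x| = |ψ x|) ∧ g c = 0 ∧ 0 < k₁ ∧ k₁ ≤ k₂ ∧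
      ∃ η > 0, ∀ x ∈ Ioo (c - η) (c + η), ∀ y ∈ Ioo (c - η) (c + η), x ≤ y →
        k₁ * (y - x) ≤ g y - g x ∧ g y - g x ≤ k₂ * (y - x) := by
  have key : ∀ g : ℝ → ℝ, ContDiff ℝ 2 g → 0 < deriv g c →
      ∃ η > 0, ∀ x ∈ Ioo (c - η) (c + η), ∀ y ∈ Ioo (c - η) (c + η), x ≤ y →
        deriv g c / 2 * (y - x) ≤ g y - g x ∧ g y - g x ≤ 2 * deriv g c * (y - x) := by
    intro g hg hpos
    have h1 : HasStrictDerivAt g (deriv g c) c :=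
      (hg.contDiffAt (x := c)).hasStrictDerivAt (by norm_num)
    have h2 := h1.hasStrictFDerivAt.isLittleO.def (half_pos hpos)
    obtain ⟨η, hη, h3⟩ := Metric.eventually_nhds_iff_ball.1 h2
    refine ⟨η, hη, fun x hx y hy hxy => ?_⟩
    have hmem : (y, x) ∈ Metric.ball (c, c) η := by
      rw [Metric.mem_ball, Prod.dist_eq, max_lt_iff, Real.dist_eq, Real.dist_eq]
      exact ⟨abs_lt.2 ⟨by linarith [hy.1], by linarith [hy.2]⟩,
        abs_lt.2 ⟨by linarith [hx.1], by linarith [hx.2]⟩⟩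
    have h4 := h3 _ hmem
    simp only [Real.norm_eq_abs, ContinuousLinearMap.toSpanSingleton_apply, smul_eq_mul] at h4
    rw [abs_of_nonneg (sub_nonneg.2 hxy)] at h4
    have h5 := abs_le.1 h4
    have h6 : 0 ≤ deriv g c * (y - x) := mul_nonneg hpos.le (sub_nonneg.2 hxy)
    constructor <;> nlinarith [h5.1, h5.2]
  rcases lt_or_gt_of_ne hψd with h | h
  · have hd : deriv (fun x => -ψ x) c = -deriv ψ c := deriv.fun_neg
    refine ⟨fun x => -ψ x, _, _, fun x => abs_neg _, by simp [hψ0], ?_, ?_,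
      key (fun x => -ψ x) hψ.neg (by rw [hd]; linarith)⟩ <;> rw [hd] <;> linarith
  · exact ⟨ψ, _, _, fun x => rfl, hψ0, half_pos h, by linarith, key ψ hψ h⟩

lemma IsLift.deriv_add_int {F : ℝ → ℝ} (h : IsLift F) (x : ℝ) (m : ℤ) :
    deriv F (x + m) = deriv F x := by
  have h1 : (fun y => F (y + m)) = fun y => F y + m := funext fun y => h.add_int y m
  have h2 : deriv (fun y => F (y + m)) x = deriv F (x + m) := deriv_comp_add_const ..
  rw [← h2, h1, deriv_add_const]

lemma exists_int_sub_mem_Ico (b x : ℝ) : ∃ m : ℤ, x - m ∈ Ico b (b + 1) :=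
  ⟨⌊x - b⌋, by linarith [Int.floor_le (x - b)], by linarith [Int.lt_floor_add_one (x - b)]⟩

/-- A lift of a `C²` bimodal degree one circle map with non-flat critical points `c` (maximum)
and `e` (minimum), repelling periodic orbits, and critical orbits as they arise when the
rotation numbers of the upper and lower maps are irrational. -/
structure BimodalLift where
  F : ℝ → ℝ
  c : ℝ
  e : ℝ
  dc : ℝ
  de : ℝ
  lc : ℝ
  le : ℝ
  ψc : ℝ → ℝ
  ψe : ℝ → ℝ
  lift : IsLift F
  hC2 : ContDiff ℝ 2 F
  hce : c < e
  decr : ∀ x ∈ Ioo c e, deriv F x < 0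
  incr : ∀ x ∈ Ioo e (c + 1), 0 < deriv F x
  hlc : 1 < lc
  hle : 1 < le
  ψcC2 : ContDiff ℝ 2 ψc
  ψeC2 : ContDiff ℝ 2 ψe
  ψcD : deriv ψc c ≠ 0
  ψeD : deriv ψe e ≠ 0
  ψc0 : ψc c = 0
  ψe0 : ψe e = 0
  ψcEq : ∀ᶠ x in nhds c, F x = F c - |ψc x| ^ lc
  ψeEq : ∀ᶠ x in nhds e, F x = F e + |ψe x| ^ le
  hdc : dc ∈ Ioo e (c + 1)
  hdcF : F dc = F c
  hde : de ∈ Ioo (e - 1) c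
  hdeF : F de = F e
  rep : PeriodicRepelling F
  c_orbit : ∀ j : ℕ, 1 ≤ j → ∀ a : ℤ, F^[j] c + a ∉ Icc c dc
  e_orbit : ∀ j : ℕ, 1 ≤ j → ∀ a : ℤ, F^[j] e + a ∉ Icc de e
  c_unbounded : ∀ j : ℕ, 1 ≤ j → ∀ (a : ℤ) (C : ℝ), ∃ t : ℕ, C < |F^[t * j] (F c) - t * a|
  e_unbounded : ∀ j : ℕ, 1 ≤ j → ∀ (a : ℤ) (C : ℝ), ∃ t : ℕ, C < |F^[t * j] (F e) - t * a|

namespace BimodalLift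
variable (B : BimodalLift)

lemma strictAntiOn : StrictAntiOn B.F (Icc B.c B.e) :=
  strictAntiOn_of_deriv_neg (convex_Icc _ _) B.hC2.continuous.continuousOn
    (by rw [interior_Icc]; exact B.decr)

lemma strictMonoOn : StrictMonoOn B.F (Icc B.e (B.c + 1)) :=
  strictMonoOn_of_deriv_pos (convex_Icc _ _) B.hC2.continuous.continuousOn
    (by rw [interior_Icc]; exact B.incr)

lemma strictMonoOn_left : StrictMonoOn B.F (Icc (B.e - 1) B.c) := by
  intro x hx y hy hxy
  have := B.strictMonoOn (a := x + 1) ⟨by linarith [hx.1], by linarith [hx.2]⟩ (b := y + 1)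
    ⟨by linarith [hy.1], by linarith [hy.2]⟩ (by linarith)
  rw [B.lift, B.lift] at this
  linarith

lemma exists_cross : ∃ K, 0 ≤ K ∧ ∀ x₁ x₂ x₃ x₄ : ℝ, x₁ < x₂ → x₂ < x₃ → x₃ < x₄ →
    (∀ x ∈ Icc x₁ x₄, ∀ a : ℤ, x ≠ B.c + a ∧ x ≠ B.e + a) →
    Real.exp (-(K * (x₄ - x₁))) * crossX (x₂ - x₁) (x₃ - x₂) (x₄ - x₃) ≤
      crossX |B.F x₂ - B.F x₁| |B.F x₃ - B.F x₂| |B.F x₄ - B.F x₃| := by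
  have hec : B.e < B.c + 1 := by linarith [B.hdc.1, B.hdc.2]
  obtain ⟨Mc, hMc⟩ := nonflat_bound (s := -1) (Or.inr rfl) B.hlc B.hC2 B.ψcC2 B.ψcD B.ψc0
    (by filter_upwards [B.ψcEq] with x hx; rw [hx]; ring)
  obtain ⟨Me, hMe⟩ := nonflat_bound (s := 1) (Or.inl rfl) B.hle B.hC2 B.ψeC2 B.ψeD B.ψe0
    (by filter_upwards [B.ψeEq] with x hx; rw [hx]; ring)
  obtain ⟨Mc', hMc'⟩ := nonflat_bound (c := B.c + 1) (ψ := fun x => B.ψc (x - 1)) (s := -1)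
    (Or.inr rfl) B.hlc B.hC2 (B.ψcC2.comp (contDiff_id.sub contDiff_const))
    (by rw [deriv_comp_sub_const, add_sub_cancel_right]; exact B.ψcD)
    (by simp [B.ψc0]) (by
      have ht : Tendsto (fun x : ℝ => x - 1) (nhds (B.c + 1)) (nhds B.c) := by
        have : Continuous fun x : ℝ => x - 1 := by fun_prop
        simpa using this.tendsto (B.c + 1)
      filter_upwards [ht.eventually B.ψcEq] with x hx
      have h := B.lift (x - 1)
      rw [sub_add_cancel] at h
      rw [h, hx, B.lift]; ring)
  obtain ⟨K₁, hK₁, h1⟩ := exists_lap_crossX B.hC2 B.hce (Or.inr B.decr) B.hlc B.hle hMc hMe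
  obtain ⟨K₂, hK₂, h2⟩ := exists_lap_crossX B.hC2 hec (Or.inl B.incr) B.hle B.hlc hMe hMc'
  refine ⟨max K₁ K₂, le_max_of_le_left hK₁, fun x₁ x₂ x₃ x₄ h12 h23 h34 hx => ?_⟩
  have hcx : 0 ≤ crossX (x₂ - x₁) (x₃ - x₂) (x₄ - x₃) := by
    unfold crossX
    have := sub_pos.2 h12
    have := sub_pos.2 h23
    have := sub_pos.2 h34
    positivity
  have hmon : ∀ K, K ≤ max K₁ K₂ →
      Real.exp (-(max K₁ K₂ * (x₄ - x₁))) * crossX (x₂ - x₁) (x₃ - x₂) (x₄ - x₃) ≤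
      Real.exp (-(K * (x₄ - x₁))) * crossX (x₂ - x₁) (x₃ - x₂) (x₄ - x₃) := by
    intro K hK
    refine mul_le_mul_of_nonneg_right (Real.exp_le_exp.2 ?_) hcx
    have : K * (x₄ - x₁) ≤ max K₁ K₂ * (x₄ - x₁) :=
      mul_le_mul_of_nonneg_right hK (by linarith)
    linarith
  obtain ⟨m, h | h⟩ := exists_lap_of_ne
    (by linarith : x₁ ≤ x₄) hx
  · refine (hmon K₂ (le_max_right _ _)).trans ?_
    have := h2 (x₁ - (m - 1 : ℤ)) (x₂ - (m - 1 : ℤ)) (x₃ - (m - 1 : ℤ)) (x₄ - (m - 1 : ℤ))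
      (by push_cast; linarith [h.1]) (by linarith) (by linarith) (by linarith)
      (by push_cast; linarith [h.2])
    simpa only [B.lift.sub_int, sub_sub_sub_cancel_right] using this
  · refine (hmon K₁ (le_max_left _ _)).trans ?_
    have := h1 (x₁ - m) (x₂ - m) (x₃ - m) (x₄ - m) (by linarith [h.1]) (by linarith)
      (by linarith) (by linarith) (by linarith [h.2])
    simpa only [B.lift.sub_int, sub_sub_sub_cancel_right] using this

lemma exists_foldMap : ∃ Φ : FoldMap, Φ.F = B.F ∧ Φ.c = B.c ∧ Φ.e = B.e := by
  obtain ⟨K, hK, hcross⟩ := B.exists_cross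
  obtain ⟨g, k₁, k₂, hg, gc, hk₁, hk, η₁, hη₁, hlip⟩ :=
    exists_bilipschitz_chart B.ψcC2 B.ψcD B.ψc0
  obtain ⟨η₂, hη₂, hEq⟩ := Metric.eventually_nhds_iff.1 B.ψcEq
  have hsub : ∀ x ∈ Ioo (B.c - min η₁ η₂) (B.c + min η₁ η₂), x ∈ Ioo (B.c - η₁) (B.c + η₁) ∧
      B.F x = B.F B.c - |g x| ^ B.lc := by
    intro x hx
    have h1 := min_le_left η₁ η₂
    have h2 := min_le_right η₁ η₂
    refine ⟨⟨by linarith [hx.1], by linarith [hx.2]⟩, ?_⟩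
    rw [hg]
    exact hEq (by rw [Real.dist_eq]; exact abs_lt.2 ⟨by linarith [hx.1], by linarith [hx.2]⟩)
  refine ⟨{
    F := B.F
    c := B.c
    d := B.de
    e := B.e
    cont := B.hC2.continuous
    lift := B.lift
    hed := B.hde.1
    hdc := B.hde.2
    hce := B.hce
    mono := B.strictMonoOn_left
    anti := B.strictAntiOn
    hde := B.hdeF
    noAttr := fun u v huv j hj a hinj =>
      B.rep.not_mapsTo B.lift (B.hC2.differentiable (by norm_num)) huv hj a hinj
    noRestr := B.c_unbounded
    e_orbit := B.e_orbit
    K := K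
    K_nonneg := hK
    cross := hcross
    g := g
    η := min η₁ η₂
    k₁ := k₁
    k₂ := k₂
    η_pos := lt_min hη₁ hη₂
    k₁_pos := hk₁
    k₁_le := hk
    g_c := gc
    g_lip := fun x hx y hy => hlip x (hsub x hx).1 y (hsub y hy).1
    g_height := fun x hx y hy => ?_ }, rfl, rfl, rfl⟩
  rw [(hsub x hx).2, (hsub y hy).2, sub_le_sub_iff_left,
    Real.rpow_le_rpow_iff (abs_nonneg _) (abs_nonneg _) (by linarith [B.hlc])]

lemma exists_ratioBound (Φ : FoldMap) (hF : Φ.F = B.F) (hc : Φ.c = B.c) (he : Φ.e = B.e)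
    {ε : ℝ} (hε : 0 < ε) : ∃ L ≥ 0, Φ.RatioBound ε L := by
  have hF1 : ContDiff ℝ 1 (deriv B.F) := (contDiff_succ_iff_deriv (n := 1)).1 B.hC2 |>.2.2
  have hFd : Differentiable ℝ (deriv B.F) := hF1.differentiable (by norm_num)
  have hF0 : Differentiable ℝ B.F := B.hC2.differentiable (by norm_num)
  have hcont2 : Continuous (deriv (deriv B.F)) := hF1.continuous_deriv le_rfl
  obtain ⟨M, hM⟩ := (isCompact_Icc (a := B.c) (b := B.c + 1)).exists_bound_of_continuousOn
    hcont2.continuousOn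
  have hM' : ∀ x, ‖deriv (deriv B.F) x‖ ≤ M := by
    intro x
    obtain ⟨m, hm⟩ := exists_int_sub_mem_Ico B.c x
    have h1 : deriv (deriv B.F) (x - m + m) = deriv (deriv B.F) (x - m) := by
      rw [← deriv_comp_add_const]
      congr 1
      exact funext fun y => B.lift.deriv_add_int y m
    rw [sub_add_cancel] at h1
    rw [h1]
    exact hM _ ⟨hm.1, hm.2.le⟩
  have hM0 : 0 ≤ M := (norm_nonneg _).trans (hM' 0)
  have hlipM : ∀ s t, |deriv B.F s - deriv B.F t| ≤ M * |s - t| := fun s t =>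
    Convex.norm_image_sub_le_of_norm_deriv_le (fun x _ => hFd x) (fun x _ => hM' x) convex_univ
      (mem_univ t) (mem_univ s)
  have hcl : IsClosed {x | Φ.Far ε x} := by
    simp only [FoldMap.Far, ofPred_forall, ofPred_and]
    refine isClosed_iInter fun a => IsClosed.inter ?_ ?_ <;>
      exact isClosed_le continuous_const (by fun_prop)
  have hcomp : IsCompact ({x | Φ.Far ε x} ∩ Icc B.c (B.c + 1)) := isCompact_Icc.inter_left hcl
  obtain ⟨m, hm0, hm⟩ := hcomp.exists_forall_le' (f := fun x => |deriv B.F x|)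
    hF1.continuous.abs.continuousOn (a := 0) (by
      rintro x ⟨hx, hx1, hx2⟩
      rw [abs_pos]
      have h1 := (hx 0).1
      have h2 := (hx 1).1
      have h3 := (hx 0).2
      rw [hc] at h1 h2
      rw [he] at h3
      push_cast at h1 h2 h3
      have n1 : x ≠ B.c := by rintro rfl; simp at h1; linarith
      have n2 : x ≠ B.c + 1 := by rintro rfl; simp at h2; linarith
      have n3 : x ≠ B.e := by rintro rfl; simp at h3; linarith
      rcases lt_or_gt_of_ne n3 with h | h
      · exact (B.decr x ⟨lt_of_le_of_ne hx1 n1.symm, h⟩).ne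
      · exact (B.incr x ⟨h, lt_of_le_of_ne hx2 n2⟩).ne')
  have hm' : ∀ x, Φ.Far ε x → m ≤ |deriv B.F x| := by
    intro x hx
    obtain ⟨k, hk⟩ := exists_int_sub_mem_Ico B.c x
    have h1 := B.lift.deriv_add_int (x - k) k
    rw [sub_add_cancel] at h1
    rw [h1]
    refine hm _ ⟨fun a => ?_, hk.1, hk.2.le⟩
    have := hx (a + k)
    push_cast at this
    rwa [show x - k - Φ.c - a = x - Φ.c - (a + k) by ring,
      show x - k - Φ.e - a = x - Φ.e - (a + k) by ring]
  have mvt : ∀ p q, ∃ t ∈ uIcc p q, |B.F q - B.F p| = |deriv B.F t| * |q - p| := by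
    intro p q
    wlog hpq : p ≤ q generalizing p q
    · obtain ⟨t, ht, h⟩ := this q p (le_of_not_ge hpq)
      exact ⟨t, uIcc_comm p q ▸ ht, by rw [abs_sub_comm, h, abs_sub_comm p]⟩
    rcases hpq.eq_or_lt with rfl | hlt
    · exact ⟨p, left_mem_uIcc, by simp⟩
    · obtain ⟨t, ht, h⟩ := exists_deriv_eq_slope B.F hlt B.hC2.continuous.continuousOn
        hF0.differentiableOn
      refine ⟨t, Icc_subset_uIcc (Ioo_subset_Icc_self ht), ?_⟩
      rw [h, ← abs_mul, div_mul_cancel₀ _ (sub_pos.2 hlt).ne']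
  refine ⟨M / m, by positivity, fun x y z hxyz hfar => ?_⟩
  rw [hF]
  have hy : y ∈ uIcc x z := by
    rw [mem_uIcc]; rcases hxyz with h | h
    · exact Or.inl ⟨h.1.le, h.2.le⟩
    · exact Or.inr ⟨h.1.le, h.2.le⟩
  obtain ⟨s, hs, hse⟩ := mvt y z
  obtain ⟨t, ht, hte⟩ := mvt x y
  have hs' : s ∈ uIcc x z := uIcc_subset_uIcc_right hy hs
  have ht' : t ∈ uIcc x z := uIcc_subset_uIcc_left hy ht
  have hst : |s - t| ≤ |z - x| := FoldMap.abs_sub_le_of_mem_uIcc hs' ht'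
  have hmt := hm' t (hfar t ht')
  have hle : |deriv B.F s| ≤ Real.exp (M / m * |z - x|) * |deriv B.F t| := by
    have h1 : |deriv B.F s| ≤ |deriv B.F t| + M * |z - x| := by
      have h2 := hlipM s t
      have h3 := abs_sub_abs_le_abs_sub (deriv B.F s) (deriv B.F t)
      have h4 : M * |s - t| ≤ M * |z - x| := mul_le_mul_of_nonneg_left hst hM0
      linarith
    have h2 : M * |z - x| ≤ M / m * |z - x| * |deriv B.F t| := by
      calc M * |z - x| = M / m * |z - x| * m := by field_simp
        _ ≤ _ := mul_le_mul_of_nonneg_left hmt (by positivity)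
    have h3 : (M / m * |z - x| + 1) * |deriv B.F t| ≤
        Real.exp (M / m * |z - x|) * |deriv B.F t| :=
      mul_le_mul_of_nonneg_right (Real.add_one_le_exp _) (abs_nonneg _)
    linarith
  rw [hse, hte]
  calc |deriv B.F s| * |z - y| * |y - x|
      ≤ Real.exp (M / m * |z - x|) * |deriv B.F t| * |z - y| * |y - x| := by gcongr
    _ = _ := by ring

lemma iterate_neg_conj (F : ℝ → ℝ) (n : ℕ) (x : ℝ) :
    (fun x => -F (-x))^[n] x = -F^[n] (-x) := by
  induction n generalizing x with
  | zero => simp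
  | succ n ih => rw [Function.iterate_succ_apply, ih, Function.iterate_succ_apply, neg_neg]

/-- Conjugation by `x ↦ -x`. -/
def reflect : BimodalLift where
  F := fun x => -B.F (-x)
  c := -B.e
  e := -B.c
  dc := -B.de
  de := -B.dc
  lc := B.le
  le := B.lc
  ψc := fun x => B.ψe (-x)
  ψe := fun x => B.ψc (-x)
  lift := fun x => by
    have := B.lift.sub_int (-x) 1
    push_cast at this
    simp only [neg_add, ← sub_eq_add_neg, this]
    ring
  hC2 := (B.hC2.comp contDiff_neg).neg
  hce := neg_lt_neg B.hce
  decr := fun x hx => by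
    have h1 : deriv (fun x => -B.F (-x)) x = deriv B.F (-x) := by
      rw [deriv.fun_neg, deriv_comp_neg, neg_neg]
    rw [h1]
    exact B.decr _ ⟨by linarith [hx.2], by linarith [hx.1]⟩
  incr := fun x hx => by
    have h1 : deriv (fun x => -B.F (-x)) x = deriv B.F (-x) := by
      rw [deriv.fun_neg, deriv_comp_neg, neg_neg]
    have h2 := B.lift.deriv_add_int (-x) 1
    rw [h1, ← h2]
    push_cast
    exact B.incr _ ⟨by linarith [hx.2], by linarith [hx.1]⟩
  hlc := B.hle
  hle := B.hlc
  ψcC2 := B.ψeC2.comp contDiff_neg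
  ψeC2 := B.ψcC2.comp contDiff_neg
  ψcD := by rw [deriv_comp_neg, neg_neg]; exact neg_ne_zero.2 B.ψeD
  ψeD := by rw [deriv_comp_neg, neg_neg]; exact neg_ne_zero.2 B.ψcD
  ψc0 := by rw [neg_neg, B.ψe0]
  ψe0 := by rw [neg_neg, B.ψc0]
  ψcEq := by
    have ht : Tendsto (fun x : ℝ => -x) (nhds (-B.e)) (nhds B.e) := by
      simpa using (continuous_neg (G := ℝ)).tendsto (-B.e)
    filter_upwards [ht.eventually B.ψeEq] with x hx
    rw [hx, neg_neg]; ring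
  ψeEq := by
    have ht : Tendsto (fun x : ℝ => -x) (nhds (-B.c)) (nhds B.c) := by
      simpa using (continuous_neg (G := ℝ)).tendsto (-B.c)
    filter_upwards [ht.eventually B.ψcEq] with x hx
    rw [hx, neg_neg]; ring
  hdc := ⟨by linarith [B.hde.2], by linarith [B.hde.1]⟩
  hdcF := by simp only [neg_neg, B.hdeF]
  hde := ⟨by linarith [B.hdc.2], by linarith [B.hdc.1]⟩
  hdeF := by simp only [neg_neg, B.hdcF]
  rep := fun x n hn ⟨m, hm⟩ => by
    have h1 : (fun x => -B.F (-x))^[n] = fun x => -B.F^[n] (-x) :=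
      funext (iterate_neg_conj B.F n)
    have h2 : deriv (fun x => -B.F^[n] (-x)) x = deriv B.F^[n] (-x) := by
      rw [deriv.fun_neg, deriv_comp_neg, neg_neg]
    rw [h1] at hm ⊢
    rw [h2]
    exact B.rep (-x) n hn ⟨-m, by push_cast; linarith⟩
  c_orbit := fun j hj a h => by
    rw [iterate_neg_conj, neg_neg] at h
    exact B.e_orbit j hj (-a) ⟨by push_cast; linarith [h.2], by push_cast; linarith [h.1]⟩
  e_orbit := fun j hj a h => by
    rw [iterate_neg_conj, neg_neg] at h
    exact B.c_orbit j hj (-a) ⟨by push_cast; linarith [h.2], by push_cast; linarith [h.1]⟩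
  c_unbounded := fun j hj a C => by
    obtain ⟨t, ht⟩ := B.e_unbounded j hj (-a) C
    refine ⟨t, ht.trans_eq ?_⟩
    rw [iterate_neg_conj, ← abs_neg]
    congr 1; push_cast; simp only [neg_neg]; ring
  e_unbounded := fun j hj a C => by
    obtain ⟨t, ht⟩ := B.c_unbounded j hj (-a) C
    refine ⟨t, ht.trans_eq ?_⟩
    rw [iterate_neg_conj, ← abs_neg]
    congr 1; push_cast; simp only [neg_neg]; ring

/-- The orbit of every nondegenerate interval contains a lift of a critical point. -/
theorem exists_crit {α β : ℝ} (hαβ : α < β) :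
    ∃ n, ∃ x ∈ Icc α β, ∃ a : ℤ, B.F^[n] x = B.c + a ∨ B.F^[n] x = B.e + a := by
  obtain ⟨Φ, hF, hc, he⟩ := B.exists_foldMap
  obtain ⟨Ψ, hF', hc', he'⟩ := B.reflect.exists_foldMap
  have h := FoldMap.not_Icc_subset_free Φ Ψ (fun x => by rw [hF', hF]; rfl)
    (by rw [hc', he]; rfl) (by rw [he', hc]; rfl)
    (fun ε hε => B.exists_ratioBound Φ hF hc he hε) hαβ
  simp only [subset_def, FoldMap.free, mem_ofPred_eq, FoldMap.Crit] at h
  push Not at h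
  obtain ⟨x, hx, n, a, ha⟩ := h
  exact ⟨n, x, hx, a, by rwa [← hF, ← hc, ← he]⟩

end BimodalLift

namespace CircleDeg1Lift

lemma abs_iterate_sub_le (G : CircleDeg1Lift) (n : ℕ) (x : ℝ) :
    |G^[n] x - x - n * G.translationNumber| ≤ 1 := by
  have h1 := (G ^ n).map_lt_add_translationNumber_add_one x
  have h2 := (G ^ n).lt_map_of_int_lt_translationNumber
    (n := ⌈(G ^ n).translationNumber⌉ - 1)
    (by push_cast; linarith [Int.ceil_lt_add_one (G ^ n).translationNumber]) x
  have h3 := Int.le_ceil (G ^ n).translationNumber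
  push_cast at h2
  rw [translationNumber_pow] at h1 h2 h3
  rw [coe_pow] at h1 h2
  exact abs_le.2 ⟨by linarith, by linarith⟩

lemma isLift (G : CircleDeg1Lift) : IsLift G := fun x => G.map_add_one x

lemma ne_add_int_of_irrational {G : CircleDeg1Lift} (hG : Irrational G.translationNumber)
    {n : ℕ} (hn : 0 < n) (x : ℝ) (m : ℤ) : G^[n] x ≠ x + m := by
  intro h
  have := G.translationNumber_of_map_pow_eq_add_int (x := x) (n := n) (m := m)
    (by rw [coe_pow]; exact h) hn
  exact hG ⟨(m / n : ℚ), by rw [this]; push_cast; rfl⟩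

section Plateau
variable {G : CircleDeg1Lift} {F : ℝ → ℝ} {p q : ℝ}

lemma iterate_plateau_notMem (hG : Irrational G.translationNumber)
    (h1 : ∀ x ∈ Icc p q, G x = G p) {n : ℕ} (hn : 1 ≤ n) (a : ℤ) : G^[n] p + a ∉ Icc p q := by
  intro h
  have h2 := h1 _ h
  rw [G.isLift.add_int, ← Function.iterate_succ_apply' G, Function.iterate_succ_apply] at h2
  exact ne_add_int_of_irrational hG hn (G p) (-a) (by push_cast; linarith)

lemma eq_of_forall_notMem (hF : IsLift F) (h2 : ∀ x ∈ Icc q (p + 1), G x = F x) {x : ℝ}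
    (hx : ∀ a : ℤ, x + a ∉ Ioo p q) : F x = G x := by
  obtain ⟨m, hm⟩ := exists_int_sub_mem_Ico p x
  rcases lt_or_ge (x - m) q with h | h
  · rcases hm.1.eq_or_lt with h0 | h0
    · have hpq : q ≤ p + 1 ∨ p + 1 < q := le_or_gt _ _
      rcases hpq with hpq | hpq
      · have h3 := h2 (p + 1) ⟨hpq, le_rfl⟩
        rw [G.isLift, hF] at h3
        have h4 : x = p + m := by linarith
        rw [h4, hF.add_int, G.isLift.add_int]
        linarith
      · exact absurd (⟨by push_cast; linarith, by push_cast; linarith⟩ :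
          x + ((-m + 1 : ℤ) : ℝ) ∈ Ioo p q) (hx (-m + 1))
    · exact absurd (⟨by push_cast; linarith, by push_cast; linarith⟩ :
        x + ((-m : ℤ) : ℝ) ∈ Ioo p q) (hx (-m))
  · have h3 := h2 (x - m) ⟨h, hm.2.le⟩
    rw [hF.sub_int, G.isLift.sub_int] at h3
    linarith

lemma iterate_plateau_eq (hF : IsLift F) (hG : Irrational G.translationNumber) (hqp : q ≤ p + 1)
    (h1 : ∀ x ∈ Icc p q, G x = G p) (h2 : ∀ x ∈ Icc q (p + 1), G x = F x) (n : ℕ) :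
    F^[n] p = G^[n] p := by
  induction n with
  | zero => rfl
  | succ n ih =>
    rw [Function.iterate_succ_apply', Function.iterate_succ_apply', ih]
    refine eq_of_forall_notMem hF h2 fun a ha => ?_
    rcases Nat.eq_zero_or_pos n with rfl | hn
    · simp only [Function.iterate_zero, id_eq] at ha
      have h3 : (0 : ℝ) < a := by linarith [ha.1]
      have h4 : (a : ℝ) < 1 := by linarith [ha.2]
      norm_cast at h3 h4
      omega
    · exact iterate_plateau_notMem hG h1 hn a (Ioo_subset_Icc_self ha)

lemma iterate_unbounded (hG : Irrational G.translationNumber) (x : ℝ) {j : ℕ}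
    (hj : 1 ≤ j) (a : ℤ) (C : ℝ) : ∃ t : ℕ, C < |G^[t * j] x - t * a| := by
  set ρ := G.translationNumber with hρ
  have hne : j * ρ - a ≠ 0 := by
    intro h
    have hj0 : (j : ℝ) ≠ 0 := by positivity
    exact hG ⟨(a / j : ℚ), by push_cast; field_simp; linarith⟩
  obtain ⟨t, ht⟩ := exists_nat_gt ((C + |x| + 1) / |j * ρ - a|)
  rw [div_lt_iff₀ (abs_pos.2 hne)] at ht
  refine ⟨t, ?_⟩
  have h1 := G.abs_iterate_sub_le (t * j) x
  have h2 : t * |j * ρ - a| = |t * (j * ρ - a)| := by rw [abs_mul, Nat.abs_cast]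
  push_cast at h1
  rw [h2] at ht
  have h3 : t * (j * ρ - a) = (G^[t * j] x - t * a) - x - (G^[t * j] x - x - t * j * ρ) := by
    ring
  rw [h3] at ht
  have h4 := abs_sub ((G^[t * j] x - t * a) - x) (G^[t * j] x - x - t * j * ρ)
  have h5 := abs_sub (G^[t * j] x - t * a) x
  linarith

end Plateau

end CircleDeg1Lift

namespace BimodalLift
variable (B : BimodalLift)

lemma exists_ne {α β : ℝ} (hαβ : α < β) : ∃ x ∈ Icc α β, ∃ y ∈ Icc α β, B.F x ≠ B.F y := by
  obtain ⟨m, hm⟩ := exists_int_sub_mem_Ico B.c α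
  have key : ∃ z, α - m < z ∧ z ≤ β - m ∧ B.F (α - m) ≠ B.F z := by
    rcases lt_or_ge (α - m) B.e with h | h
    · have hlt : α - m < min (β - m) B.e := lt_min (by linarith) h
      exact ⟨_, hlt, min_le_left _ _, (B.strictAntiOn ⟨hm.1, h.le⟩
        ⟨hm.1.trans hlt.le, min_le_right _ _⟩ hlt).ne'⟩
    · have hlt : α - m < min (β - m) (B.c + 1) := lt_min (by linarith) hm.2
      exact ⟨_, hlt, min_le_left _ _, (B.strictMonoOn ⟨h, hm.2.le⟩
        ⟨h.trans hlt.le, min_le_right _ _⟩ hlt).ne⟩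
  obtain ⟨z, h1, h2, h3⟩ := key
  refine ⟨α, ⟨le_rfl, hαβ.le⟩, z + m, ⟨by linarith, by linarith⟩, ?_⟩
  rw [B.lift.add_int]
  rw [B.lift.sub_int] at h3
  intro h
  exact h3 (by linarith)

lemma exists_Icc_subset_image_iterate (n : ℕ) {α β : ℝ} (hαβ : α < β) :
    ∃ α' β', α' < β' ∧ Icc α' β' ⊆ B.F^[n] '' Icc α β := by
  induction n with
  | zero => exact ⟨α, β, hαβ, by simp⟩
  | succ n ih =>
    obtain ⟨α', β', h', hsub⟩ := ih
    obtain ⟨x, hx, y, hy, hne⟩ := B.exists_ne h'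
    refine ⟨min (B.F x) (B.F y), max (B.F x) (B.F y), min_lt_max.2 hne, ?_⟩
    rw [Function.iterate_succ', image_comp]
    refine Subset.trans ?_ (image_mono hsub)
    exact (intermediate_value_uIcc B.hC2.continuous.continuousOn).trans
      (image_mono (uIcc_subset_Icc hx hy))

/-- The orbit of every nondegenerate interval contains a lift of `e`. -/
lemma exists_iterate_eq_e {α β : ℝ} (hαβ : α < β) :
    ∃ n, ∃ x ∈ Icc α β, ∃ a : ℤ, B.F^[n] x = B.e + a := by
  by_contra! h
  obtain ⟨n₁, x₁, hx₁, a₁, h1⟩ := B.exists_crit hαβ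
  replace h1 := h1.resolve_right (h n₁ x₁ hx₁ a₁)
  obtain ⟨α', β', hαβ', hsub⟩ := B.exists_Icc_subset_image_iterate (n₁ + 1) hαβ
  obtain ⟨n₂, y, hy, a₂, h2⟩ := B.exists_crit hαβ'
  obtain ⟨x₂, hx₂, rfl⟩ := hsub hy
  rw [← Function.iterate_add_apply] at h2
  replace h2 := h2.resolve_right (h _ x₂ hx₂ a₂)
  set K := B.F^[n₁ + 1] '' Icc α β with hK
  set p := B.F B.c + a₁ with hp
  set j := n₂ + 1 with hj
  have hpK : p ∈ K := ⟨x₁, hx₁, by rw [Function.iterate_succ_apply', h1, B.lift.add_int]⟩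
  have hq : B.F^[j] (B.F^[n₁ + 1] x₂) = p + (a₂ - a₁ : ℤ) := by
    rw [← Function.iterate_add_apply, show j + (n₁ + 1) = (n₂ + (n₁ + 1)) + 1 by omega,
      Function.iterate_succ_apply', h2, B.lift.add_int, hp]
    push_cast
    ring
  let S : ℕ → Set ℝ := fun k => (fun x => B.F^[k * j] x - k * (a₂ - a₁ : ℤ)) '' K
  have hS : IsPreconnected (⋃ k, S k) := by
    refine IsPreconnected.iUnion_of_chain (fun k => ?_) (fun k => ?_)
    · refine IsPreconnected.image ?_ _
        ((B.hC2.continuous.iterate _).sub continuous_const).continuousOn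
      exact isPreconnected_Icc.image _ (B.hC2.continuous.iterate _).continuousOn
    · refine ⟨B.F^[k * j] p - k * (a₂ - a₁ : ℤ), ⟨p, hpK, rfl⟩, B.F^[n₁ + 1] x₂,
        ⟨x₂, hx₂, rfl⟩, ?_⟩
      simp only [Order.succ_eq_add_one, add_mul, one_mul]
      rw [Function.iterate_add_apply, hq, B.lift.iter_add]
      push_cast
      ring
  obtain ⟨t, ht⟩ := B.c_unbounded j (by omega) (a₂ - a₁) (|B.F B.c| + 1)
  have hm1 : p ∈ ⋃ k, S k := mem_iUnion.2 ⟨0, p, hpK, by simp⟩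
  have hm2 : B.F^[t * j] p - t * (a₂ - a₁ : ℤ) ∈ ⋃ k, S k := mem_iUnion.2 ⟨t, p, hpK, rfl⟩
  have hfar : 1 < |B.F^[t * j] p - t * (a₂ - a₁ : ℤ) - p| := by
    rw [hp, B.lift.iter_add]
    have h3 := abs_sub_abs_le_abs_sub (B.F^[t * j] (B.F B.c) - t * (a₂ - a₁ : ℤ)) (B.F B.c)
    have h4 : B.F^[t * j] (B.F B.c) + a₁ - t * (a₂ - a₁ : ℤ) - (B.F B.c + a₁) =
      B.F^[t * j] (B.F B.c) - t * (a₂ - a₁ : ℤ) - B.F B.c := by ring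
    rw [h4]
    linarith
  have hex : ∀ u v : ℝ, 1 < v - u → ∃ b : ℤ, B.e + b ∈ Icc u v := by
    intro u v huv
    refine ⟨⌈u - B.e⌉, by linarith [Int.le_ceil (u - B.e)],
      by linarith [Int.ceil_lt_add_one (u - B.e)]⟩
  have hmem : ∃ b : ℤ, B.e + b ∈ ⋃ k, S k := by
    rcases lt_abs.1 hfar with h3 | h3
    · obtain ⟨b, hb⟩ := hex _ _ h3
      exact ⟨b, hS.ordConnected.out hm1 hm2 hb⟩
    · obtain ⟨b, hb⟩ := hex _ _ (by linarith : 1 < p - (B.F^[t * j] p - t * (a₂ - a₁ : ℤ)))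
      exact ⟨b, hS.ordConnected.out hm2 hm1 hb⟩
  obtain ⟨b, hb⟩ := hmem
  obtain ⟨k, _, ⟨x, hx, rfl⟩, hk⟩ := mem_iUnion.1 hb
  refine h (k * j + (n₁ + 1)) x hx (b + k * (a₂ - a₁)) ?_
  rw [Function.iterate_add_apply]
  push_cast at hk ⊢
  linarith

/-- The orbit of every nondegenerate interval contains a lift of `c`. -/
lemma exists_iterate_eq_c {α β : ℝ} (hαβ : α < β) :
    ∃ n, ∃ x ∈ Icc α β, ∃ a : ℤ, B.F^[n] x = B.c + a := by
  obtain ⟨n, x, hx, a, h⟩ := B.reflect.exists_iterate_eq_e (neg_lt_neg hαβ)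
  refine ⟨n, -x, ⟨by linarith [hx.2], by linarith [hx.1]⟩, -a, ?_⟩
  have h1 : B.reflect.F^[n] x = -B.F^[n] (-x) := iterate_neg_conj B.F n x
  have h2 : B.reflect.e = -B.c := rfl
  rw [h1, h2] at h
  push_cast
  linarith

end BimodalLift

namespace CircleDeg1Lift
variable (G : CircleDeg1Lift)

/-- A monotone map semiconjugating `G` to the translation by its translation number. -/
def toTranslation (x : ℝ) : ℝ := limsup (fun n : ℕ => G^[n] x - n * G.translationNumber) atTop

lemma iterate_sub_mem_Icc (n : ℕ) (x : ℝ) :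
    G^[n] x - n * G.translationNumber ∈ Icc (x - 1) (x + 1) := by
  have := abs_le.1 (G.abs_iterate_sub_le n x)
  exact ⟨by linarith [this.1], by linarith [this.2]⟩

lemma isBoundedUnder_iterate_sub (x : ℝ) :
    IsBoundedUnder (· ≤ ·) atTop fun n : ℕ => G^[n] x - n * G.translationNumber :=
  isBoundedUnder_of ⟨x + 1, fun n => (G.iterate_sub_mem_Icc n x).2⟩

lemma isCoboundedUnder_iterate_sub (x : ℝ) :
    IsCoboundedUnder (· ≤ ·) atTop fun n : ℕ => G^[n] x - n * G.translationNumber :=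
  IsBoundedUnder.isCoboundedUnder_le
    (isBoundedUnder_of ⟨x - 1, fun n => (G.iterate_sub_mem_Icc n x).1⟩)

lemma toTranslation_mem_Icc (x : ℝ) : G.toTranslation x ∈ Icc (x - 1) (x + 1) :=
  ⟨le_limsup_of_frequently_le
    (Frequently.of_forall fun n => (G.iterate_sub_mem_Icc n x).1)
    (G.isBoundedUnder_iterate_sub x),
   limsup_le_of_le (G.isCoboundedUnder_iterate_sub x)
    (Eventually.of_forall fun n => (G.iterate_sub_mem_Icc n x).2)⟩

lemma monotone_toTranslation : Monotone G.toTranslation := fun x y hxy =>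
  limsup_le_limsup (Eventually.of_forall fun n =>
      sub_le_sub_right (G.monotone.iterate n hxy) _)
    (G.isCoboundedUnder_iterate_sub x) (G.isBoundedUnder_iterate_sub y)

lemma toTranslation_add_int (x : ℝ) (m : ℤ) :
    G.toTranslation (x + m) = G.toTranslation x + m := by
  unfold toTranslation
  rw [← limsup_add_const _ _ _ (G.isBoundedUnder_iterate_sub x)
    (G.isCoboundedUnder_iterate_sub x)]
  congr 1
  funext n
  rw [G.isLift.iter_add]
  ring

lemma toTranslation_map (x : ℝ) :
    G.toTranslation (G x) = G.toTranslation x + G.translationNumber := by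
  unfold toTranslation
  rw [← limsup_add_const _ _ _ (G.isBoundedUnder_iterate_sub x)
    (G.isCoboundedUnder_iterate_sub x), 
    ← limsup_nat_add (fun n : ℕ => G^[n] x - n * G.translationNumber + G.translationNumber) 1]
  congr 1
  funext n
  rw [Function.iterate_succ_apply]
  push_cast
  ring

lemma toTranslation_iterate (n : ℕ) (x : ℝ) :
    G.toTranslation (G^[n] x) = G.toTranslation x + n * G.translationNumber := by
  induction n with
  | zero => simp
  | succ n ih =>
    rw [Function.iterate_succ_apply', toTranslation_map, ih]
    push_cast
    ring

end CircleDeg1Lift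

namespace BimodData
variable (B : BimodData)

lemma isLift : IsLift B.F := B.hlift

lemma Fp_plateau : ∀ x ∈ Icc B.ctp B.dtp, B.Fp x = B.Fp B.ctp := fun x hx => by
  rw [B.hFp1 x hx, B.hFp1 _ (left_mem_Icc.2 (hx.1.trans hx.2))]

lemma Fm_plateau : ∀ x ∈ Icc B.dtm B.ctm, B.Fm x = B.Fm B.dtm := fun x hx => by
  rw [B.hFm1 x hx, B.hFm1 _ (left_mem_Icc.2 (hx.1.trans hx.2))]

lemma iterate_ctp (n : ℕ) : B.F^[n] B.ctp = B.Fp^[n] B.ctp :=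
  CircleDeg1Lift.iterate_plateau_eq B.isLift B.hirrp B.hdtp.2.le B.Fp_plateau B.hFp2 n

lemma iterate_dtm (n : ℕ) : B.F^[n] B.dtm = B.Fm^[n] B.dtm :=
  CircleDeg1Lift.iterate_plateau_eq B.isLift B.hirrm (by linarith [B.hdtm.1]) B.Fm_plateau
    B.hFm2 n

lemma iterate_ctm {n : ℕ} (hn : 1 ≤ n) : B.F^[n] B.ctm = B.Fm^[n] B.dtm := by
  obtain ⟨n, rfl⟩ := Nat.exists_eq_add_of_le' hn
  rw [← iterate_dtm, Function.iterate_succ_apply, Function.iterate_succ_apply, B.hdtmF]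

/-- The lift together with the dynamical properties of its critical orbits. -/
def toBimodalLift : BimodalLift where
  F := B.F
  c := B.ctp
  e := B.ctm
  dc := B.dtp
  de := B.dtm
  lc := B.lp
  le := B.lm
  ψc := B.psip
  ψe := B.psim
  lift := B.hlift
  hC2 := B.hC2
  hce := B.h1
  decr := B.hdecr
  incr := B.hincr
  hlc := B.hlp
  hle := B.hlm
  ψcC2 := B.hpsipC2
  ψeC2 := B.hpsimC2
  ψcD := B.hpsipD _
  ψeD := B.hpsimD _
  ψc0 := B.hpsip0
  ψe0 := B.hpsim0
  ψcEq := B.hpsipEq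
  ψeEq := B.hpsimEq
  hdc := B.hdtp
  hdcF := B.hdtpF
  hde := B.hdtm
  hdeF := B.hdtmF
  rep := B.hA3
  c_orbit := fun j hj a => by
    rw [iterate_ctp]
    exact CircleDeg1Lift.iterate_plateau_notMem B.hirrp B.Fp_plateau hj a
  e_orbit := fun j hj a => by
    rw [iterate_ctm B hj]
    exact CircleDeg1Lift.iterate_plateau_notMem B.hirrm B.Fm_plateau hj a
  c_unbounded := fun j hj a C => by
    obtain ⟨t, ht⟩ := CircleDeg1Lift.iterate_unbounded B.hirrp (B.Fp B.ctp) hj a C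
    refine ⟨t, ?_⟩
    rwa [← Function.iterate_succ_apply, iterate_ctp, Function.iterate_succ_apply]
  e_unbounded := fun j hj a C => by
    obtain ⟨t, ht⟩ := CircleDeg1Lift.iterate_unbounded B.hirrm (B.Fm B.dtm) hj a C
    refine ⟨t, ?_⟩
    rwa [← Function.iterate_succ_apply, iterate_ctm B (by omega), Function.iterate_succ_apply]

lemma le_Fp (x : ℝ) : B.F x ≤ B.Fp x := by
  obtain ⟨m, hm⟩ := exists_int_sub_mem_Ico B.ctp x
  suffices h : B.F (x - m) ≤ B.Fp (x - m) by
    rw [B.isLift.sub_int, B.Fp.isLift.sub_int] at h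
    linarith
  rcases le_or_gt (x - m) B.dtp with h | h
  · rw [B.hFp1 _ ⟨hm.1, h⟩]
    rcases le_or_gt (x - m) B.ctm with h' | h'
    · exact B.toBimodalLift.strictAntiOn.antitoneOn (left_mem_Icc.2 B.h1.le) ⟨hm.1, h'⟩ hm.1
    · rw [← B.hdtpF]
      exact B.toBimodalLift.strictMonoOn.monotoneOn ⟨h'.le, hm.2.le⟩
        ⟨B.hdtp.1.le, B.hdtp.2.le⟩ h
  · exact (B.hFp2 _ ⟨h.le, hm.2.le⟩).ge

lemma Fm_le (x : ℝ) : B.Fm x ≤ B.F x := by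
  obtain ⟨m, hm⟩ := exists_int_sub_mem_Ico B.dtm x
  suffices h : B.Fm (x - m) ≤ B.F (x - m) by
    rw [B.isLift.sub_int, B.Fm.isLift.sub_int] at h
    linarith
  rcases le_or_gt (x - m) B.ctm with h | h
  · rw [B.hFm1 _ ⟨hm.1, h⟩]
    rcases le_or_gt (x - m) B.ctp with h' | h'
    · rw [← B.hdtmF]
      exact B.toBimodalLift.strictMonoOn_left.monotoneOn ⟨B.hdtm.1.le, B.hdtm.2.le⟩
        ⟨B.hdtm.1.le.trans hm.1, h'⟩ hm.1
    · exact B.toBimodalLift.strictAntiOn.antitoneOn ⟨h'.le, h⟩ (right_mem_Icc.2 B.h1.le) h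
  · exact (B.hFm2 _ ⟨h.le, hm.2.le⟩).le

lemma Fm_iterate_le (n : ℕ) (x : ℝ) : B.Fm^[n] x ≤ B.F^[n] x :=
  B.Fm.monotone.iterate_le_of_le B.Fm_le n x

lemma toTranslation_lt {w : ℝ} (hw : w < B.F B.ctp) :
    B.Fp.toTranslation w < B.Fp.toTranslation (B.F B.ctp) := by
  refine lt_of_le_of_ne (B.Fp.monotone_toTranslation hw.le) fun hconst => ?_
  set ρ := B.Fp.translationNumber with hρ
  have hc : B.Fp B.ctp = B.F B.ctp :=
    B.hFp1 _ (left_mem_Icc.2 (B.h1.le.trans B.hdtp.1.le))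
  have hval : ∀ x ∈ Icc w (B.F B.ctp), B.Fp.toTranslation x = B.Fp.toTranslation B.ctp + ρ := by
    intro x hx
    rw [← B.Fp.toTranslation_map, hc]
    exact le_antisymm (B.Fp.monotone_toTranslation hx.2)
      (hconst ▸ B.Fp.monotone_toTranslation hx.1)
  have havoid : ∀ x ∈ Icc w (B.F B.ctp), ∀ (n : ℕ) (a : ℤ),
      B.Fp^[n] x + a ∉ Icc B.ctp B.dtp := by
    intro x hx n a ha
    have h1 : B.Fp.toTranslation (B.Fp^[n] x + a) = B.Fp.toTranslation B.ctp := by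
      have h2 := B.Fp.toTranslation_map (B.Fp^[n] x + a)
      rw [B.Fp_plateau _ ha, B.Fp.toTranslation_map] at h2
      linarith
    rw [B.Fp.toTranslation_add_int, B.Fp.toTranslation_iterate, hval x hx] at h1
    have h2 : ((n + 1 : ℕ) : ℝ) * ρ = (-a : ℤ) := by push_cast; linarith
    have h3 : ((n + 1 : ℕ) : ℝ) ≠ 0 := by positivity
    exact B.hirrp ⟨((-a : ℤ) / (n + 1 : ℕ) : ℚ), by
      rw [Rat.cast_div, Rat.cast_intCast, Rat.cast_natCast, div_eq_iff h3, ← h2, mul_comm]⟩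
  have heq : ∀ x ∈ Icc w (B.F B.ctp), ∀ n : ℕ, B.F^[n] x = B.Fp^[n] x := by
    intro x hx n
    induction n with
    | zero => rfl
    | succ n ih =>
      rw [Function.iterate_succ_apply', Function.iterate_succ_apply', ih]
      exact CircleDeg1Lift.eq_of_forall_notMem B.isLift B.hFp2 fun a ha =>
        havoid x hx n a (Ioo_subset_Icc_self ha)
  obtain ⟨n, x, hx, a, h⟩ := B.toBimodalLift.exists_crit hw
  have h1 : B.Fp^[n] x = B.ctp + a ∨ B.Fp^[n] x = B.ctm + a := heq x hx n ▸ h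
  refine havoid x hx n (-a) ?_
  push_cast
  have := B.h1
  have := B.hdtp.1
  rcases h1 with h1 | h1 <;> rw [h1] <;> constructor <;> linarith

lemma toTranslation_F_le (x : ℝ) :
    B.Fp.toTranslation (B.F x) ≤ B.Fp.toTranslation x + B.Fp.translationNumber := by
  rw [← B.Fp.toTranslation_map]
  exact B.Fp.monotone_toTranslation (B.le_Fp x)

lemma toTranslation_F_iterate_le (n : ℕ) (x : ℝ) :
    B.Fp.toTranslation (B.F^[n] x) ≤ B.Fp.toTranslation x + n * B.Fp.translationNumber := by
  induction n with
  | zero => simp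
  | succ n ih =>
    rw [Function.iterate_succ_apply']
    have := B.toTranslation_F_le (B.F^[n] x)
    push_cast
    linarith

/-- Every orbit through a neighbourhood of `ctm` falls behind the upper map by a definite
amount. -/
lemma exists_defect : ∃ δ > 0, ∃ η > 0, ∀ x, |x - B.ctm| ≤ η →
    B.Fp.toTranslation (B.F x) ≤
      B.Fp.toTranslation x + B.Fp.translationNumber - δ := by
  have h1 := B.h1
  have hlt : B.F B.ctm < B.F B.ctp := B.toBimodalLift.strictAntiOn (left_mem_Icc.2 h1.le)
    (right_mem_Icc.2 h1.le) h1
  obtain ⟨w, hw1, hw2⟩ := exists_between hlt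
  have hd := B.hdtp.1
  have hev : ∀ᶠ x in nhds B.ctm, B.F x < w ∧ x ∈ Ioo B.ctp B.dtp :=
    (B.hC2.continuous.continuousAt.eventually_lt continuousAt_const hw1).and
      (Ioo_mem_nhds h1 hd)
  obtain ⟨η, hη, hball⟩ := Metric.eventually_nhds_iff.1 hev
  refine ⟨_, sub_pos.2 (B.toTranslation_lt hw2), η / 2, half_pos hη, fun x hx => ?_⟩
  obtain ⟨h2, h3⟩ := hball (y := x) (by rw [Real.dist_eq]; linarith)
  have h4 := B.Fp.monotone_toTranslation h2.le
  have h5 := B.Fp.toTranslation_map x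
  rw [B.hFp1 x (Ioo_subset_Icc_self h3)] at h5
  linarith

theorem translationNumber_lt : B.Fm.translationNumber < B.Fp.translationNumber := by
  have hle : B.Fm.translationNumber ≤ B.Fp.translationNumber :=
    CircleDeg1Lift.translationNumber_mono fun x => (B.Fm_le x).trans (B.le_Fp x)
  refine lt_of_le_of_ne hle fun heq => ?_
  obtain ⟨δ, hδ, η, hη, hdef⟩ := B.exists_defect
  set ρ := B.Fp.translationNumber with hρ
  have key : ∀ (k : ℕ) (α β : ℝ), α < β → ∃ x ∈ Icc α β, ∃ N : ℕ,
      B.Fp.toTranslation (B.F^[N] x) ≤ B.Fp.toTranslation x + N * ρ - k * δ := by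
    intro k
    induction k with
    | zero => exact fun α β h => ⟨α, left_mem_Icc.2 h.le, 0, by simp⟩
    | succ k ih =>
      intro α β hαβ
      obtain ⟨n, x₀, hx₀, a, h0⟩ := B.toBimodalLift.exists_iterate_eq_e hαβ
      change B.F^[n] x₀ = B.ctm + a at h0
      obtain ⟨r, hr, hball⟩ := Metric.continuousAt_iff.1
        ((B.hC2.continuous.iterate n).continuousAt (x := x₀)) η hη
      obtain ⟨α₁, β₁, hαβ₁, hα₁, hβ₁, hnear⟩ : ∃ α₁ β₁, α₁ < β₁ ∧ α ≤ α₁ ∧ β₁ ≤ β ∧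
          ∀ x ∈ Icc α₁ β₁, |x - x₀| < r := by
        rcases hx₀.2.eq_or_lt with h | h
        · refine ⟨max α (x₀ - r / 2), x₀, max_lt (by linarith) (by linarith), le_max_left _ _,
            hx₀.2, fun x hx => abs_lt.2 ⟨?_, by linarith [hx.2]⟩⟩
          linarith [hx.1, le_max_right α (x₀ - r / 2)]
        · refine ⟨x₀, min β (x₀ + r / 2), lt_min h (by linarith), hx₀.1, min_le_left _ _,
            fun x hx => abs_lt.2 ⟨by linarith [hx.1], ?_⟩⟩
          linarith [hx.2, min_le_right β (x₀ + r / 2)]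
      obtain ⟨α₂, β₂, hαβ₂, hsub⟩ :=
        B.toBimodalLift.exists_Icc_subset_image_iterate (n + 1) hαβ₁
      obtain ⟨_, hy, N, hN⟩ := ih α₂ β₂ hαβ₂
      obtain ⟨x, hx, rfl⟩ := hsub hy
      change B.Fp.toTranslation (B.F^[N] (B.F^[n + 1] x)) ≤
        B.Fp.toTranslation (B.F^[n + 1] x) + N * ρ - k * δ at hN
      refine ⟨x, ⟨hα₁.trans hx.1, hx.2.trans hβ₁⟩, N + (n + 1), ?_⟩
      rw [Function.iterate_add_apply]
      have h1 := hball (x := x) (hnear x hx)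
      rw [h0, Real.dist_eq] at h1
      have h2 := hdef (B.F^[n] x - a) 
        (by rw [sub_right_comm, sub_sub]; exact h1.le)
      have h3 : ∀ y, B.Fp.toTranslation (y - a) = B.Fp.toTranslation y - a := fun y => by
        have := B.Fp.toTranslation_add_int y (-a)
        push_cast at this
        rw [sub_eq_add_neg, this]; ring
      rw [B.isLift.sub_int, h3, h3, ← Function.iterate_succ_apply' B.F] at h2
      have h4 := B.toTranslation_F_iterate_le n x
      push_cast
      simp only [Nat.succ_eq_add_one] at h2
      linarith
  obtain ⟨k, hk⟩ := exists_nat_gt (3 / δ)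
  rw [div_lt_iff₀ hδ] at hk
  obtain ⟨x, -, N, hN⟩ := key k 0 1 one_pos
  have h1 := (B.Fp.toTranslation_mem_Icc (B.F^[N] x)).1
  have h2 := (B.Fp.toTranslation_mem_Icc x).2
  have h3 := (B.Fm.iterate_sub_mem_Icc N x).1
  have h4 := B.Fm_iterate_le N x
  rw [heq] at h3
  linarith

/-- The images of a nondegenerate interval eventually contain fundamental domains. -/
theorem exists_forall_Icc_subset_image {α β : ℝ} (hαβ : α < β) :
    ∃ N : ℕ, 1 ≤ N ∧ ∀ n, N ≤ n → ∃ s, Icc s (s + 1) ⊆ B.F^[n] '' Icc α β := by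
  obtain ⟨n, x, hx, a, h1⟩ := B.toBimodalLift.exists_iterate_eq_c hαβ
  obtain ⟨n', y, hy, b, h2⟩ := B.toBimodalLift.exists_iterate_eq_e hαβ
  change B.F^[n] x = B.ctp + a at h1
  change B.F^[n'] y = B.ctm + b at h2
  set r := B.Fp.translationNumber with hr
  set s := B.Fm.translationNumber with hs
  have hlt : 0 < r - s := sub_pos.2 B.translationNumber_lt
  obtain ⟨M, hM⟩ := exists_nat_gt
    ((3 - (B.ctp + a) + (B.dtm + b) + n * r - n' * s) / (r - s))
  rw [div_lt_iff₀ hlt] at hM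
  refine ⟨M + n + n' + 1, by omega, fun m hm => ⟨B.F^[m] y, ?_⟩⟩
  have hcx : B.F^[m] x = B.Fp^[m - n] B.ctp + a := by
    rw [show m = (m - n) + n by omega, Function.iterate_add_apply, h1, B.isLift.iter_add,
      iterate_ctp, Nat.add_sub_cancel]
  have hcy : B.F^[m] y = B.Fm^[m - n'] B.dtm + b := by
    rw [show m = (m - n') + n' by omega, Function.iterate_add_apply, h2, B.isLift.iter_add,
      B.iterate_ctm (by omega), Nat.add_sub_cancel]
  have h3 := (B.Fp.iterate_sub_mem_Icc (m - n) B.ctp).1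
  have h4 := (B.Fm.iterate_sub_mem_Icc (m - n') B.dtm).2
  rw [Nat.cast_sub (by omega)] at h3 h4
  have hmM : (M : ℝ) * (r - s) ≤ m * (r - s) :=
    mul_le_mul_of_nonneg_right (by exact_mod_cast (by omega : M ≤ m)) hlt.le
  have h5 : B.F^[m] y + 1 ≤ B.F^[m] x := by
    rw [hcx, hcy]
    linarith
  have hcont : ContinuousOn B.F^[m] (uIcc y x) := (B.hC2.continuous.iterate m).continuousOn
  refine (Icc_subset_Icc_right h5).trans (Icc_subset_uIcc.trans
    ((intermediate_value_uIcc hcont).trans (image_mono (uIcc_subset_Icc hy hx))))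

lemma iterate_coe (n : ℕ) (x : ℝ) :
    B.f^[n] (x : UnitAddCircle) = ((B.F^[n] x : ℝ) : UnitAddCircle) := by
  induction n generalizing x with
  | zero => rfl
  | succ n ih => rw [Function.iterate_succ_apply, B.hf, ih, Function.iterate_succ_apply]

/-- Every set with nonempty interior eventually covers the circle. -/
theorem exists_forall_image_eq_univ {I : Set UnitAddCircle} (hI : (interior I).Nonempty) :
    ∃ N : ℕ, 1 ≤ N ∧ ∀ n, N ≤ n → B.f^[n] '' I = univ := by
  obtain ⟨p, hp⟩ := hI
  obtain ⟨x, rfl⟩ := QuotientAddGroup.mk_surjective p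
  have hopen : IsOpen ((fun x : ℝ => (x : UnitAddCircle)) ⁻¹' interior I) :=
    isOpen_interior.preimage (AddCircle.continuous_mk' 1)
  obtain ⟨ε, hε, hball⟩ := Metric.isOpen_iff.1 hopen x hp
  obtain ⟨N, hN, h⟩ := B.exists_forall_Icc_subset_image
    (show x - ε / 2 < x + ε / 2 by linarith)
  refine ⟨N, hN, fun n hn => eq_univ_of_forall fun q => ?_⟩
  obtain ⟨s, hs⟩ := h n hn
  obtain ⟨y, hy, rfl⟩ := (AddCircle.coe_image_Icc_eq (1 : ℝ) s).ge (mem_univ q)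
  obtain ⟨z, hz, rfl⟩ := hs hy
  refine ⟨z, interior_subset (hball ?_), B.iterate_coe n z⟩
  rw [Metric.mem_ball, Real.dist_eq]
  exact abs_lt.2 ⟨by linarith [hz.1], by linarith [hz.2]⟩

end BimodData

/-- **Proposition (topological mixing).** For every `f ∈ Bimod` and every interval
(connected subset) `I ⊆ 𝕋¹` with nonempty interior there is `N ≥ 1` with `f^N(I) = 𝕋¹`;
in particular `f` is topologically mixing. -/
theorem top_mixing (B : BimodData) :
    (∀ I : Set UnitAddCircle, IsPreconnected I → (interior I).Nonempty →
      ∃ N : ℕ, 1 ≤ N ∧ B.f^[N] '' I = Set.univ)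
    ∧ ∀ U V : Set UnitAddCircle, IsOpen U → U.Nonempty → IsOpen V → V.Nonempty →
      ∃ n₀ : ℕ, ∀ n, n₀ ≤ n → (B.f^[n] '' U ∩ V).Nonempty := by
  refine ⟨fun I _ hI => ?_, fun U V hU hU' _ hV => ?_⟩
  · obtain ⟨N, hN, h⟩ := B.exists_forall_image_eq_univ hI
    exact ⟨N, hN, h N le_rfl⟩
  · obtain ⟨N, -, h⟩ := B.exists_forall_image_eq_univ (hU.interior_eq.symm ▸ hU')
    exact ⟨N, fun n hn => by rw [h n hn, univ_inter]; exact hV⟩
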